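/- arXiv:2601.14928 — 7 statements merged into one kernel-verified Lean document; each statement's English description precedes it below -/
import Mathlib

section
/- Let (Y,d) be a complete, separable metric space satisfying the Heine–Borel property (every closed bounded subset is compact). Fix 1 ≤ p < ∞, κ > 0, an integer K ≥ 2, weights λ_1,…,λ_K ∈ (0,1) with Σ_{k=1}^K λ_k = 1, and μ_1,…,μ_K ∈ 𝒫_p(Y). Then the function ν ↦ Σ_{k=1}^K λ_k MK_p(μ_k,ν)^κ attains its infimum over 𝒫_p(Y): there exists ν* ∈ 𝒫_p(Y) such that Σ_{k=1}^K λ_k MK_p(μ_k,ν*)^κ ≤ Σ_{k=1}^K λ_k MK_p(μ_k,ν)^κ for every ν ∈ 𝒫_p(Y). -/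
open MeasureTheory ENNReal

/-- The `p`-Monge–Kantorovich (Wasserstein) distance between two measures on a metric
space: the infimum over all couplings `γ` of `μ` and `ν` of the `L^p(γ)`-norm of the
distance function. -/
noncomputable def MK {X : Type*} [PseudoEMetricSpace X] [MeasurableSpace X] (p : ℝ)
    (μ ν : Measure X) : ℝ≥0∞ :=
  ⨅ (γ : Measure (X × X)) (_ : γ.map Prod.fst = μ ∧ γ.map Prod.snd = ν),
    (∫⁻ z, edist z.1 z.2 ^ p ∂γ) ^ (1 / p)

/-- `μ` has finite `p`-th moment about the point `x0`. -/
def FiniteMoment {X : Type*} [PseudoEMetricSpace X] [MeasurableSpace X] (p : ℝ) (x0 : X)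
    (μ : Measure X) : Prop :=
  ∫⁻ x, edist x0 x ^ p ∂μ ≠ ∞

/-- Integration of a continuous nonnegative function is lower semicontinuous. -/
lemma lsc_lintegral_aux {X : Type*} [TopologicalSpace X] [MeasurableSpace X]
    [OpensMeasurableSpace X] (f : X → NNReal) (hf : Continuous f) :
    LowerSemicontinuous (fun γ : ProbabilityMeasure X => ∫⁻ x, (f x : ℝ≥0∞) ∂(γ : Measure X)) := by
  have h1 : ∀ γ : ProbabilityMeasure X, ∫⁻ x, (f x : ℝ≥0∞) ∂(γ : Measure X) =
      ⨆ n : ℕ, ∫⁻ x, ((min (f x) (n : NNReal) : NNReal) : ℝ≥0∞) ∂(γ : Measure X) := by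
    intro γ
    rw [← lintegral_iSup]
    · refine lintegral_congr fun x => ?_
      apply le_antisymm
      · obtain ⟨n, hn⟩ := exists_nat_ge (f x)
        refine le_iSup_of_le n ?_
        rw [min_eq_left hn]
      · refine iSup_le fun n => ?_
        exact_mod_cast min_le_left _ _
    · intro n
      have : Continuous fun x => min (f x) (n : NNReal) := by fun_prop
      exact this.measurable.coe_nnreal_ennreal
    · intro n m hnm x
      have : (n : NNReal) ≤ m := by exact_mod_cast hnm
      exact ENNReal.coe_le_coe.2 (min_le_min_left (f x) this)
  simp_rw [h1]
  refine lowerSemicontinuous_iSup fun n => ?_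
  have hc : Continuous fun x => min (f x) (n : NNReal) := by fun_prop
  let g : BoundedContinuousFunction X NNReal :=
    BoundedContinuousFunction.mkOfBound ⟨_, hc⟩ n (by
      intro x y
      simp only [ContinuousMap.coe_mk]
      rw [NNReal.dist_eq, abs_le]
      have h1 : ((min (f x) (n : NNReal) : NNReal) : ℝ) ≤ n := by
        exact_mod_cast min_le_right _ _
      have h2 : ((min (f y) (n : NNReal) : NNReal) : ℝ) ≤ n := by
        exact_mod_cast min_le_right _ _
      have h3 := (min (f x) (n : NNReal)).coe_nonneg
      have h4 := (min (f y) (n : NNReal)).coe_nonneg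
      constructor <;> linarith)
  exact (ProbabilityMeasure.continuous_lintegral_boundedContinuousFunction g).lowerSemicontinuous

/-- Sublevel sets of the integral of a coercive function are compact. -/
lemma compact_sublevel_aux {X : Type*} [TopologicalSpace X] [T2Space X] [MeasurableSpace X]
    [BorelSpace X] (f : X → NNReal) (hf : Continuous f)
    (hK : ∀ r : NNReal, IsCompact {x | f x ≤ r}) (R : ℝ≥0∞) (hR : R ≠ ∞) :
    IsCompact {γ : ProbabilityMeasure X | ∫⁻ x, (f x : ℝ≥0∞) ∂(γ : Measure X) ≤ R} := by
  have hcl : IsClosed {γ : ProbabilityMeasure X | ∫⁻ x, (f x : ℝ≥0∞) ∂(γ : Measure X) ≤ R} :=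
    (lsc_lintegral_aux f hf).isClosed_preimage R
  rw [← hcl.closure_eq]
  apply isCompact_closure_of_isTightMeasureSet
  rw [isTightMeasureSet_iff_exists_isCompact_measure_compl_le]
  intro ε hε
  by_cases hεt : ε = ∞
  · exact ⟨∅, isCompact_empty, fun _ _ => by simp [hεt]⟩
  have hr0 : (R + 1) / ε ≠ 0 := by
    simp [ENNReal.div_eq_zero_iff, hεt]
  have hrt : (R + 1) / ε ≠ ∞ := ENNReal.div_ne_top (by simp [hR]) hε.ne'
  refine ⟨_, hK ((R + 1) / ε).toNNReal, ?_⟩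
  rintro _ ⟨γ, hγ, rfl⟩
  have hm := mul_meas_ge_le_lintegral (μ := (γ : Measure X))
    hf.measurable.coe_nnreal_ennreal ((R + 1) / ε)
  have hsub : {x | f x ≤ ((R + 1) / ε).toNNReal}ᶜ ⊆ {x | (R + 1) / ε ≤ (f x : ℝ≥0∞)} := by
    intro x hx
    have hx' : ((R + 1) / ε).toNNReal < f x := by simpa using hx
    change (R + 1) / ε ≤ (f x : ℝ≥0∞)
    rw [← ENNReal.coe_toNNReal hrt]
    exact_mod_cast hx'.le
  refine (measure_mono hsub).trans ?_
  rw [← ENNReal.mul_le_mul_iff_right hr0 hrt]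
  calc _ ≤ _ := hm
    _ ≤ R := hγ
    _ ≤ R + 1 := le_self_add
    _ = (R + 1) / ε * ε := (ENNReal.div_mul_cancel hε.ne' hεt).symm

lemma edist_rpow_aux {Y : Type*} [PseudoEMetricSpace Y] {p : ℝ} (hp : 1 ≤ p) (x y z : Y) :
    edist x z ^ p ≤ 2 ^ (p - 1) * (edist x y ^ p + edist y z ^ p) :=
  (ENNReal.rpow_le_rpow (edist_triangle x y z) (by linarith)).trans
    (ENNReal.rpow_add_le_mul_rpow_add_rpow _ _ hp)

lemma two_rpow_aux (q : ℝ) : (2 : ℝ≥0∞) ^ q ≠ ∞ :=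
  ENNReal.rpow_ne_top_of_ne_zero (by simp) (by simp)

lemma snd_moment_aux {Y : Type*} [MetricSpace Y] [SecondCountableTopology Y]
    [MeasurableSpace Y] [BorelSpace Y] (y0 : Y) {p : ℝ} (hp : 1 ≤ p) (γ : Measure (Y × Y)) :
    ∫⁻ z, edist y0 z.2 ^ p ∂γ ≤
      2 ^ (p - 1) * (∫⁻ z, edist y0 z.1 ^ p ∂γ + ∫⁻ z, edist z.1 z.2 ^ p ∂γ) := by
  rw [← lintegral_add_left (by fun_prop), ← lintegral_const_mul' _ _ (two_rpow_aux _)]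
  exact lintegral_mono fun z => edist_rpow_aux hp _ _ _

lemma cost_moment_aux {Y : Type*} [MetricSpace Y] [SecondCountableTopology Y]
    [MeasurableSpace Y] [BorelSpace Y] (y0 : Y) {p : ℝ} (hp : 1 ≤ p) (γ : Measure (Y × Y)) :
    ∫⁻ z, edist z.1 z.2 ^ p ∂γ ≤
      2 ^ (p - 1) * (∫⁻ z, edist y0 z.1 ^ p ∂γ + ∫⁻ z, edist y0 z.2 ^ p ∂γ) := by
  rw [← lintegral_add_left (by fun_prop), ← lintegral_const_mul' _ _ (two_rpow_aux _)]
  refine lintegral_mono fun z => ?_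
  have := edist_rpow_aux hp z.1 y0 z.2
  rwa [edist_comm z.1 y0] at this

lemma moment_fst_aux {Y : Type*} [MetricSpace Y] [SecondCountableTopology Y]
    [MeasurableSpace Y] [BorelSpace Y] (y0 : Y) (p : ℝ) (γ : Measure (Y × Y)) :
    ∫⁻ z, edist y0 z.1 ^ p ∂γ = ∫⁻ y, edist y0 y ^ p ∂(γ.map Prod.fst) := by
  rw [lintegral_map (by fun_prop) measurable_fst]

lemma moment_snd_aux {Y : Type*} [MetricSpace Y] [SecondCountableTopology Y]
    [MeasurableSpace Y] [BorelSpace Y] (y0 : Y) (p : ℝ) (γ : Measure (Y × Y)) :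
    ∫⁻ z, edist y0 z.2 ^ p ∂γ = ∫⁻ y, edist y0 y ^ p ∂(γ.map Prod.snd) := by
  rw [lintegral_map (by fun_prop) measurable_snd]

lemma coupling_prob_aux {Y : Type*} [MeasurableSpace Y] {γ : Measure (Y × Y)} {μ : Measure Y}
    [IsProbabilityMeasure μ] (h : γ.map Prod.fst = μ) : IsProbabilityMeasure γ := by
  constructor
  have : (γ.map Prod.fst) Set.univ = 1 := by rw [h]; exact measure_univ
  rwa [Measure.map_apply measurable_fst MeasurableSet.univ, Set.preimage_univ] at this

lemma compact_moment_aux {Y : Type*} [MetricSpace Y] [SecondCountableTopology Y] [ProperSpace Y]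
    [MeasurableSpace Y] [BorelSpace Y] (y0 : Y) {p : ℝ} (hp : 1 ≤ p) (R : ℝ≥0∞) (hR : R ≠ ∞) :
    IsCompact {γ : ProbabilityMeasure (Y × Y) |
      ∫⁻ z, edist y0 z.1 ^ p ∂(γ : Measure (Y × Y)) +
        ∫⁻ z, edist y0 z.2 ^ p ∂(γ : Measure (Y × Y)) ≤ R} := by
  have hp0 : 0 < p := by linarith
  have hc : Continuous fun z : Y × Y => nndist y0 z.1 ^ p + nndist y0 z.2 ^ p := by
    have h1 := NNReal.continuous_rpow_const hp0.le
    exact (h1.comp (by fun_prop : Continuous fun z : Y × Y => nndist y0 z.1)).add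
      (h1.comp (by fun_prop : Continuous fun z : Y × Y => nndist y0 z.2))
  have key := compact_sublevel_aux _ hc (fun r => ?_) R hR
  · convert key using 4 with γ
    rw [← lintegral_add_left (by fun_prop)]
    refine lintegral_congr fun z => ?_
    rw [edist_nndist, edist_nndist, ENNReal.coe_add, ENNReal.coe_rpow_of_nonneg _ hp0.le,
      ENNReal.coe_rpow_of_nonneg _ hp0.le]
  · refine ((isCompact_closedBall y0 ((r ^ (1 / p) : NNReal) : ℝ)).prod
      (isCompact_closedBall y0 ((r ^ (1 / p) : NNReal) : ℝ))).of_isClosed_subset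
      (isClosed_le hc continuous_const) ?_
    intro z hz
    have hz' : nndist y0 z.1 ^ p + nndist y0 z.2 ^ p ≤ r := hz
    have aux : ∀ y : Y, nndist y0 y ^ p ≤ r → y ∈ Metric.closedBall y0 ((r ^ (1 / p) : NNReal) : ℝ) := by
      intro y hy
      rw [Metric.mem_closedBall, dist_comm, ← coe_nndist, NNReal.coe_le_coe, one_div,
        NNReal.le_rpow_inv_iff hp0]
      exact hy
    exact ⟨aux _ (le_self_add.trans hz'), aux _ (le_add_self.trans hz')⟩

lemma lsc_cost_aux {Y : Type*} [MetricSpace Y] [SecondCountableTopology Y]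
    [MeasurableSpace Y] [BorelSpace Y] {p : ℝ} (hp : 1 ≤ p) :
    LowerSemicontinuous (fun γ : ProbabilityMeasure (Y × Y) =>
      ∫⁻ z, edist z.1 z.2 ^ p ∂(γ : Measure (Y × Y))) := by
  have hp0 : 0 < p := by linarith
  have hc : Continuous fun z : Y × Y => nndist z.1 z.2 ^ p :=
    (NNReal.continuous_rpow_const hp0.le).comp (by fun_prop : Continuous fun z : Y × Y => nndist z.1 z.2)
  convert lsc_lintegral_aux _ hc using 4 with γ z
  rw [edist_nndist, ENNReal.coe_rpow_of_nonneg _ hp0.le]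

/-- **Existence of classical Monge–Kantorovich barycenters.**
If `(Y, d)` is a complete, separable metric space with the Heine–Borel property
(every closed bounded set is compact, i.e. `Y` is a proper space), `1 ≤ p < ∞`, `κ > 0`,
`K ≥ 2`, `(λ_k)` are weights in `(0,1)` summing to `1` and `μ_1, …, μ_K ∈ 𝒫_p(Y)`,
then `ν ↦ ∑ k λ_k MK_p(μ_k, ν)^κ` attains its infimum over `𝒫_p(Y)`. -/
theorem classical_barycenter_existence
    {Y : Type*} [MetricSpace Y] [CompleteSpace Y] [SecondCountableTopology Y] [ProperSpace Y]
    [MeasurableSpace Y] [BorelSpace Y] (y0 : Y)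
    (p κ : ℝ) (hp : 1 ≤ p) (hκ : 0 < κ)
    (K : ℕ) (hK : 2 ≤ K)
    (lam : Fin K → ℝ) (hlam : ∀ k, lam k ∈ Set.Ioo (0 : ℝ) 1) (hsum : ∑ k, lam k = 1)
    (μ : Fin K → Measure Y) (hprob : ∀ k, IsProbabilityMeasure (μ k))
    (hmom : ∀ k, FiniteMoment p y0 (μ k)) :
    ∃ ν : Measure Y, IsProbabilityMeasure ν ∧ FiniteMoment p y0 ν ∧
      ∀ ν' : Measure Y, IsProbabilityMeasure ν' → FiniteMoment p y0 ν' →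
        ∑ k, ENNReal.ofReal (lam k) * MK p (μ k) ν ^ κ ≤
          ∑ k, ENNReal.ofReal (lam k) * MK p (μ k) ν' ^ κ := by
  have hp0 : 0 < p := by linarith
  have h1p : 0 < 1 / p := by positivity
  let c : Measure (Y × Y) → ℝ≥0∞ := fun γ => (∫⁻ z, edist z.1 z.2 ^ p ∂γ) ^ (1 / p)
  let F : (Fin K → ProbabilityMeasure (Y × Y)) → ℝ≥0∞ := fun γ =>
    ∑ k, ENNReal.ofReal (lam k) * c (γ k : Measure (Y × Y)) ^ κ
  have hF : LowerSemicontinuous F := by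
    refine lowerSemicontinuous_sum fun k _ => ?_
    have h1 : LowerSemicontinuous fun γ : Fin K → ProbabilityMeasure (Y × Y) =>
        ∫⁻ z, edist z.1 z.2 ^ p ∂(γ k : Measure (Y × Y)) :=
      (lsc_cost_aux hp).comp (continuous_apply k)
    have h2 : Continuous fun t : ℝ≥0∞ => ENNReal.ofReal (lam k) * (t ^ (1 / p)) ^ κ :=
      (ENNReal.continuous_const_mul ENNReal.ofReal_ne_top).comp
        (ENNReal.continuous_rpow_const.comp ENNReal.continuous_rpow_const)
    refine h2.comp_lowerSemicontinuous h1 ?_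
    intro s t hst
    dsimp only
    gcongr
  let k0 : Fin K := ⟨0, by omega⟩
  let P : Fin K → ProbabilityMeasure Y := fun k => ⟨μ k, hprob k⟩
  let fs : ProbabilityMeasure (Y × Y) → ProbabilityMeasure Y := fun γ =>
    γ.map (continuous_fst.measurable.aemeasurable)
  let sn : ProbabilityMeasure (Y × Y) → ProbabilityMeasure Y := fun γ =>
    γ.map (continuous_snd.measurable.aemeasurable)
  have hfs : Continuous fs := ProbabilityMeasure.continuous_map continuous_fst
  have hsn : Continuous sn := ProbabilityMeasure.continuous_map continuous_snd
  have hfsv : ∀ γ, (fs γ : Measure Y) = (γ : Measure (Y × Y)).map Prod.fst := fun γ => rfl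
  have hsnv : ∀ γ, (sn γ : Measure Y) = (γ : Measure (Y × Y)).map Prod.snd := fun γ => rfl
  -- the starting competitor
  let γ0 : Fin K → ProbabilityMeasure (Y × Y) := fun k => (P k).prod (P k0)
  have hγ0f : ∀ k, fs (γ0 k) = P k := fun k => by
    apply Subtype.ext
    change (((P k : Measure Y).prod (P k0 : Measure Y)).map Prod.fst) = (P k : Measure Y)
    rw [Measure.map_fst_prod]; simp
  have hγ0s : ∀ k, sn (γ0 k) = P k0 := fun k => by
    apply Subtype.ext
    change (((P k : Measure Y).prod (P k0 : Measure Y)).map Prod.snd) = (P k0 : Measure Y)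
    rw [Measure.map_snd_prod]; simp
  have hmom' : ∀ k, ∀ γ, fs γ = P k →
      ∫⁻ z, edist y0 z.1 ^ p ∂(γ : Measure (Y × Y)) = ∫⁻ y, edist y0 y ^ p ∂(μ k) := by
    intro k γ h
    rw [moment_fst_aux, ← hfsv, h]
    rfl
  have hM : F γ0 ≠ ∞ := by
    refine (ENNReal.sum_lt_top.2 fun k _ => ?_).ne
    refine ENNReal.mul_lt_top ENNReal.ofReal_lt_top ?_
    refine ENNReal.rpow_lt_top_of_nonneg hκ.le (ENNReal.rpow_ne_top_of_nonneg h1p.le ?_)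
    refine ne_top_of_le_ne_top ?_ (cost_moment_aux y0 hp _)
    refine ENNReal.mul_ne_top (two_rpow_aux _) (ENNReal.add_ne_top.2 ⟨?_, ?_⟩)
    · rw [hmom' k _ (hγ0f k)]; exact hmom k
    · rw [moment_snd_aux, ← hsnv, hγ0s k]; exact hmom k0
  let C : Set (Fin K → ProbabilityMeasure (Y × Y)) :=
    {γ | (∀ k, fs (γ k) = P k) ∧ (∀ k, sn (γ k) = sn (γ k0)) ∧ F γ ≤ F γ0}
  have hCcl : IsClosed C := by
    refine IsClosed.inter (s₁ := {γ | ∀ k, fs (γ k) = P k}) ?_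
      (IsClosed.inter (s₁ := {γ | ∀ k, sn (γ k) = sn (γ k0)}) ?_ (hF.isClosed_preimage (F γ0)))
    · simp only [Set.ofPred_forall]
      exact isClosed_iInter fun k =>
        isClosed_eq (hfs.comp (continuous_apply k)) continuous_const
    · simp only [Set.ofPred_forall]
      exact isClosed_iInter fun k =>
        isClosed_eq (hsn.comp (continuous_apply k)) (hsn.comp (continuous_apply k0))
  let B : Fin K → ℝ≥0∞ := fun k => ((F γ0 / ENNReal.ofReal (lam k)) ^ κ⁻¹) ^ p
  have hB : ∀ k, B k ≠ ∞ := fun k => by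
    refine ENNReal.rpow_ne_top_of_nonneg hp0.le (ENNReal.rpow_ne_top_of_nonneg (by positivity) ?_)
    exact ENNReal.div_ne_top hM (by simpa using (hlam k).1)
  let R2 : Fin K → ℝ≥0∞ := fun k => 2 ^ (p - 1) * (∫⁻ y, edist y0 y ^ p ∂(μ k) + B k)
  have hR2 : ∀ k, R2 k ≠ ∞ := fun k =>
    ENNReal.mul_ne_top (two_rpow_aux _) (ENNReal.add_ne_top.2 ⟨hmom k, hB k⟩)
  have hCb : ∀ γ ∈ C, ∀ k, ∫⁻ z, edist y0 z.2 ^ p ∂(γ k : Measure (Y × Y)) ≤ R2 k := by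
    rintro γ ⟨h1, -, h3⟩ k
    refine (snd_moment_aux y0 hp _).trans ?_
    rw [hmom' k _ (h1 k)]
    have hk : ENNReal.ofReal (lam k) * c (γ k : Measure (Y × Y)) ^ κ ≤ F γ0 :=
      (Finset.single_le_sum (f := fun k => ENNReal.ofReal (lam k) * c (γ k : Measure (Y × Y)) ^ κ)
        (fun _ _ => zero_le) (Finset.mem_univ k)).trans h3
    have hk2 : c (γ k : Measure (Y × Y)) ^ κ ≤ F γ0 / ENNReal.ofReal (lam k) := by
      rw [ENNReal.le_div_iff_mul_le (Or.inl (by simpa using (hlam k).1))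
        (Or.inl ENNReal.ofReal_ne_top), mul_comm]
      exact hk
    have hk3 : c (γ k : Measure (Y × Y)) ≤ (F γ0 / ENNReal.ofReal (lam k)) ^ κ⁻¹ :=
      (ENNReal.le_rpow_inv_iff hκ).2 hk2
    have hk4 : ∫⁻ z, edist z.1 z.2 ^ p ∂(γ k : Measure (Y × Y)) ≤ B k := by
      have := ENNReal.rpow_le_rpow hk3 hp0.le
      simp only [c] at this
      rwa [one_div, ENNReal.rpow_inv_rpow hp0.ne'] at this
    change _ ≤ 2 ^ (p - 1) * (∫⁻ y, edist y0 y ^ p ∂(μ k) + B k)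
    gcongr
  have hCc : IsCompact C := by
    refine (isCompact_univ_pi (fun k => compact_moment_aux y0 hp
      (∫⁻ y, edist y0 y ^ p ∂(μ k) + R2 k)
      (ENNReal.add_ne_top.2 ⟨hmom k, hR2 k⟩))).of_isClosed_subset hCcl ?_
    intro γ hγ k _
    exact add_le_add (hmom' k _ (hγ.1 k)).le (hCb γ hγ k)
  have hCn : C.Nonempty := ⟨γ0, hγ0f, fun k => by rw [hγ0s, hγ0s], le_rfl⟩
  obtain ⟨γs, hγs, hmin⟩ := LowerSemicontinuousOn.exists_isMinOn hCn hCc (hF.lowerSemicontinuousOn C)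
  refine ⟨(sn (γs k0) : Measure Y), inferInstance, ?_, ?_⟩
  · have := hCb γs hγs k0
    rw [moment_snd_aux] at this
    exact ne_top_of_le_ne_top (hR2 k0) this
  intro ν' hν' hmν'
  have hle : ∑ k, ENNReal.ofReal (lam k) * MK p (μ k) (sn (γs k0) : Measure Y) ^ κ ≤ F γs := by
    refine Finset.sum_le_sum fun k _ => ?_
    have : MK p (μ k) (sn (γs k0) : Measure Y) ≤ c (γs k : Measure (Y × Y)) := by
      refine iInf₂_le _ ⟨?_, ?_⟩
      · rw [← hfsv, hγs.1 k]; rfl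
      · rw [← hsnv, hγs.2.1 k]
    gcongr
  refine hle.trans ?_
  have hseq : ∀ k, ∃ g : ℕ → Measure (Y × Y),
      (∀ n, (g n).map Prod.fst = μ k ∧ (g n).map Prod.snd = ν') ∧
      Filter.Tendsto (fun n => c (g n)) Filter.atTop (nhds (MK p (μ k) ν')) := by
    intro k
    let S : Set ℝ≥0∞ := Set.image c {γ | γ.map Prod.fst = μ k ∧ γ.map Prod.snd = ν'}
    have hS : S.Nonempty := by
      refine ⟨_, (μ k).prod ν', ⟨?_, ?_⟩, rfl⟩
      · rw [Measure.map_fst_prod]; simp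
      · rw [Measure.map_snd_prod]; simp
    obtain ⟨u, -, hu, huS⟩ := exists_seq_tendsto_sInf hS (OrderBot.bddBelow S)
    choose g hg1 hg2 using huS
    refine ⟨g, hg1, ?_⟩
    have hSi : sInf S = MK p (μ k) ν' := by
      rw [sInf_image]; rfl
    rw [← hSi]
    simpa only [hg2] using hu
  choose g hg hgt using hseq
  have hlim : Filter.Tendsto (fun n => ∑ k, ENNReal.ofReal (lam k) * c (g k n) ^ κ) Filter.atTop
      (nhds (∑ k, ENNReal.ofReal (lam k) * MK p (μ k) ν' ^ κ)) := by
    refine tendsto_finsetSum _ fun k _ => ?_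
    have h2 : Continuous fun t : ℝ≥0∞ => ENNReal.ofReal (lam k) * t ^ κ :=
      (ENNReal.continuous_const_mul ENNReal.ofReal_ne_top).comp ENNReal.continuous_rpow_const
    exact (h2.tendsto _).comp (hgt k)
  refine ge_of_tendsto' hlim fun n => ?_
  let γ' : Fin K → ProbabilityMeasure (Y × Y) := fun k =>
    ⟨g k n, coupling_prob_aux (hg k n).1⟩
  change F γs ≤ F γ'
  rcases le_total (F γ') (F γ0) with h | h
  · refine hmin ⟨fun k => Subtype.ext (hg k n).1, fun k => Subtype.ext ?_, h⟩
    change (g k n).map Prod.snd = (g k0 n).map Prod.snd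
    rw [(hg k n).2, (hg k0 n).2]
  · exact hγs.2.2.trans h
end

section
/- Let d ≥ 1, 1 < p < ∞, K ≥ 2 an integer, λ_1,…,λ_K ∈ (0,1) weights with Σ_{k=1}^K λ_k = 1, and μ_1,…,μ_K ∈ 𝒫_p(ℝ^d) (with the Euclidean distance). Suppose that for some index k0 the measure μ_{k0} is absolutely continuous with respect to Lebesgue measure on ℝ^d. Then the function ν ↦ Σ_{k=1}^K λ_k MK_p(μ_k,ν)^p has exactly one minimizer in 𝒫_p(ℝ^d). -/
open MeasureTheory ENNReal

/-- Optimal plans are 2-monotone almost everywhere for the product measure. -/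
lemma swap_null {X : Type*} [MeasurableSpace X] (γ : Measure (X × X)) [IsProbabilityMeasure γ]
    (c : X × X → ℝ≥0∞) (hc : Measurable c) (hfin : ∫⁻ z, c z ∂γ ≠ ∞)
    (hopt : ∀ γ' : Measure (X × X), γ'.map Prod.fst = γ.map Prod.fst →
      γ'.map Prod.snd = γ.map Prod.snd → ∫⁻ z, c z ∂γ ≤ ∫⁻ z, c z ∂γ') :
    (γ.prod γ) {w | c (w.1.1, w.2.2) + c (w.2.1, w.1.2) < c w.1 + c w.2} = 0 := by
  classical
  set B : Set ((X × X) × (X × X)) :=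
    {w | c (w.1.1, w.2.2) + c (w.2.1, w.1.2) < c w.1 + c w.2} with hB
  have mB : MeasurableSet B := measurableSet_lt (by fun_prop) (by fun_prop)
  have swapB : Prod.swap ⁻¹' B = B := by
    ext w
    simp only [hB, Set.mem_preimage, Set.mem_ofPred_eq, Prod.fst_swap, Prod.snd_swap]
    rw [add_comm (c w.2) (c w.1), add_comm (c (w.2.1, w.1.2))]
  have mp : MeasurePreserving Prod.swap (γ.prod γ) (γ.prod γ) :=
    ⟨measurable_swap, Measure.prod_swap⟩
  have hswap : ∀ f : (X × X) × (X × X) → ℝ≥0∞, Measurable f →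
      ∫⁻ w in B, f w.swap ∂(γ.prod γ) = ∫⁻ w in B, f w ∂(γ.prod γ) := by
    intro f hf
    have := mp.setLIntegral_comp_preimage mB hf
    rwa [swapB] at this
  set T : (X × X) × (X × X) → X × X := fun w => if w ∈ B then (w.1.1, w.2.2) else w.1 with hT
  have mT : Measurable T := Measurable.ite mB (by fun_prop) (by fun_prop)
  have key : ∀ f : X × X → ℝ≥0∞, Measurable f →
      ∫⁻ z, f z ∂((γ.prod γ).map T) =
        ∫⁻ w in B, f (w.1.1, w.2.2) ∂(γ.prod γ) + ∫⁻ w in Bᶜ, f w.1 ∂(γ.prod γ) := by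
    intro f hf
    rw [lintegral_map hf mT, ← lintegral_add_compl _ mB]
    congr 1
    · refine setLIntegral_congr_fun mB fun w hw => ?_
      simp [hT, hw]
    · refine setLIntegral_congr_fun mB.compl fun w hw => ?_
      have : w ∉ B := hw
      simp [hT, this]
  have base : ∀ f : X × X → ℝ≥0∞, Measurable f →
      ∫⁻ z, f z ∂γ = ∫⁻ w in B, f w.1 ∂(γ.prod γ) + ∫⁻ w in Bᶜ, f w.1 ∂(γ.prod γ) := by
    intro f hf
    rw [lintegral_add_compl _ mB]
    have : (γ.prod γ).map Prod.fst = γ := by simp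
    conv_lhs => rw [← this]
    rw [lintegral_map hf measurable_fst]
  have h1 : ((γ.prod γ).map T).map Prod.fst = γ.map Prod.fst := by
    rw [Measure.map_map measurable_fst mT]
    have : Prod.fst ∘ T = Prod.fst ∘ Prod.fst := by
      funext w
      simp only [hT, Function.comp]
      split_ifs <;> rfl
    rw [this, ← Measure.map_map measurable_fst measurable_fst]
    simp
  have h2 : ((γ.prod γ).map T).map Prod.snd = γ.map Prod.snd := by
    refine Measure.ext_of_lintegral _ fun f hf => ?_
    rw [lintegral_map hf measurable_snd, lintegral_map hf measurable_snd,
      key (fun z => f z.2) (by fun_prop), base (fun z => f z.2) (by fun_prop)]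
    congr 1
    exact hswap (fun w => f w.1.2) (by fun_prop)
  have hle := hopt _ h1 h2
  rw [key c hc, base c hc] at hle
  have hfin' := hfin
  rw [base c hc] at hfin'
  obtain ⟨f1, f2⟩ := ENNReal.add_ne_top.1 hfin'
  have hle2 := (ENNReal.add_le_add_iff_right f2).1 hle
  have e1 : ∫⁻ w in B, (c w.1 + c w.2) ∂(γ.prod γ) =
      ∫⁻ w in B, c w.1 ∂(γ.prod γ) + ∫⁻ w in B, c w.1 ∂(γ.prod γ) := by
    rw [lintegral_add_left (by fun_prop)]
    congr 1
    exact hswap (fun w => c w.1) (by fun_prop)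
  have e2 : ∫⁻ w in B, (c (w.1.1, w.2.2) + c (w.2.1, w.1.2)) ∂(γ.prod γ) =
      ∫⁻ w in B, c (w.1.1, w.2.2) ∂(γ.prod γ) + ∫⁻ w in B, c (w.1.1, w.2.2) ∂(γ.prod γ) := by
    rw [lintegral_add_left (by fun_prop)]
    congr 1
    exact hswap (fun w => c (w.1.1, w.2.2)) (by fun_prop)
  by_contra hne
  have hlt : ∫⁻ w in B, (c (w.1.1, w.2.2) + c (w.2.1, w.1.2)) ∂(γ.prod γ) <
      ∫⁻ w in B, (c w.1 + c w.2) ∂(γ.prod γ) := by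
    refine setLIntegral_strict_mono mB hne (by fun_prop) ?_ ?_
    · have : ∫⁻ w in B, (c (w.1.1, w.2.2) + c (w.2.1, w.1.2)) ∂(γ.prod γ) ≤
          ∫⁻ w in B, (c w.1 + c w.2) ∂(γ.prod γ) :=
        setLIntegral_mono (by fun_prop) fun w hw => le_of_lt hw
      refine ne_top_of_le_ne_top ?_ this
      rw [e1]
      exact ENNReal.add_ne_top.2 ⟨f1, f1⟩
    · exact Filter.Eventually.of_forall fun w hw => hw
  rw [e1, e2] at hlt
  exact absurd (add_le_add hle2 hle2) (not_le.2 hlt)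

/-- The support of an optimal plan for a continuous cost is 2-monotone. -/
lemma support_monotone {X : Type*} [TopologicalSpace X] [SecondCountableTopology X]
    [MeasurableSpace X] [BorelSpace X] (γ : Measure (X × X)) [IsProbabilityMeasure γ]
    (c : X × X → ℝ≥0∞) (hc : Continuous c) (hfin : ∫⁻ z, c z ∂γ ≠ ∞)
    (hopt : ∀ γ' : Measure (X × X), γ'.map Prod.fst = γ.map Prod.fst →
      γ'.map Prod.snd = γ.map Prod.snd → ∫⁻ z, c z ∂γ ≤ ∫⁻ z, c z ∂γ')
    (a b : X × X) (ha : a ∈ γ.support) (hb : b ∈ γ.support) :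
    c a + c b ≤ c (a.1, b.2) + c (b.1, a.2) := by
  by_contra hlt
  rw [not_le] at hlt
  have h0 := swap_null γ c hc.measurable hfin hopt
  set B : Set ((X × X) × (X × X)) :=
    {w | c (w.1.1, w.2.2) + c (w.2.1, w.1.2) < c w.1 + c w.2} with hB
  have oB : IsOpen B := isOpen_lt (by fun_prop) (by fun_prop)
  have hmem : B ∈ nhds (a, b) := oB.mem_nhds hlt
  rw [mem_nhds_prod_iff] at hmem
  obtain ⟨U, hU, V, hV, hUV⟩ := hmem
  have hpos : (γ.prod γ) (U ×ˢ V) ≠ 0 := by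
    rw [Measure.prod_prod]
    exact mul_ne_zero (((Measure.mem_support_iff_forall a).1 ha U hU).ne')
      (((Measure.mem_support_iff_forall b).1 hb V hV).ne')
  exact hpos (measure_mono_null hUV h0)

/-- Strict monotonicity of the derivative of `‖·‖ ^ p`. -/
lemma deriv_strict {E : Type*} [NormedAddCommGroup E] [InnerProductSpace ℝ E] {p : ℝ}
    (hp : 1 < p) {a b : E} (hab : a ≠ b) :
    0 < (fderiv ℝ (fun x : E => ‖x‖ ^ p) a - fderiv ℝ (fun x : E => ‖x‖ ^ p) b) (a - b) := by
  rw [fderiv_norm_rpow a hp, fderiv_norm_rpow b hp]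
  have hdiff : ∀ x : E, ‖x‖ ^ (p - 2) * ‖x‖ ^ 2 = ‖x‖ ^ (p - 1) * ‖x‖ := by
    intro x
    rcases eq_or_ne x 0 with rfl | hx
    · simp
    · have hx' : 0 < ‖x‖ := norm_pos_iff.2 hx
      rw [show p - 1 = (p - 2) + 1 by ring, Real.rpow_add hx', Real.rpow_one]
      ring
  have hdiff2 : ∀ x : E, x ≠ 0 → ‖x‖ ^ (p - 2) * ‖x‖ = ‖x‖ ^ (p - 1) := by
    intro x hx
    have hx' : 0 < ‖x‖ := norm_pos_iff.2 hx
    rw [show p - 1 = (p - 2) + 1 by ring, Real.rpow_add hx', Real.rpow_one]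
  have hexp : ((p * ‖a‖ ^ (p - 2)) • (innerSL ℝ) a - (p * ‖b‖ ^ (p - 2)) • (innerSL ℝ) b) (a - b) =
      p * (‖a‖ ^ (p - 2) * ‖a‖ ^ 2 + ‖b‖ ^ (p - 2) * ‖b‖ ^ 2 -
        (‖a‖ ^ (p - 2) + ‖b‖ ^ (p - 2)) * inner ℝ a b) := by
    simp only [_root_.sub_apply, _root_.smul_apply, innerSL_apply_apply,
      inner_sub_right, smul_eq_mul, real_inner_self_eq_norm_sq, real_inner_comm a b]
    ring
  rw [hexp]
  refine mul_pos (by linarith) ?_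
  rcases eq_or_ne a 0 with rfl | ha
  · have hb : 0 < ‖b‖ := norm_pos_iff.2 hab.symm
    simp only [inner_zero_left, mul_zero, sub_zero, norm_zero]
    have := Real.rpow_pos_of_pos hb (p - 2)
    positivity
  rcases eq_or_ne b 0 with rfl | hb
  · have hb : 0 < ‖a‖ := norm_pos_iff.2 hab
    simp only [inner_zero_right, mul_zero, sub_zero, norm_zero]
    have := Real.rpow_pos_of_pos hb (p - 2)
    positivity
  have ha' : 0 < ‖a‖ := norm_pos_iff.2 ha
  have hb' : 0 < ‖b‖ := norm_pos_iff.2 hb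
  have pa := Real.rpow_pos_of_pos ha' (p - 2)
  have pb := Real.rpow_pos_of_pos hb' (p - 2)
  have hcs := real_inner_le_norm a b
  have ident : ‖a‖ ^ (p - 2) * ‖a‖ ^ 2 + ‖b‖ ^ (p - 2) * ‖b‖ ^ 2 -
        (‖a‖ ^ (p - 2) + ‖b‖ ^ (p - 2)) * (‖a‖ * ‖b‖) =
      (‖a‖ ^ (p - 1) - ‖b‖ ^ (p - 1)) * (‖a‖ - ‖b‖) := by
    rw [← hdiff2 a ha, ← hdiff2 b hb]; ring
  rcases lt_trichotomy ‖a‖ ‖b‖ with h | h | h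
  · have := Real.rpow_lt_rpow ha'.le h (by linarith : 0 < p - 1)
    nlinarith [mul_pos (sub_pos.2 this) (sub_pos.2 h),
      mul_nonneg (add_pos pa pb).le (sub_nonneg.2 hcs)]
  · have hlt : inner ℝ a b < ‖a‖ * ‖b‖ := by
      refine lt_of_le_of_ne hcs fun heq => hab ?_
      rw [inner_eq_norm_mul_iff_real, h] at heq
      exact (smul_right_injective E hb'.ne' heq)
    rw [h] at ident pa ⊢
    rw [h] at hlt
    nlinarith [mul_pos (add_pos pa pb) (sub_pos.2 hlt)]
  · have := Real.rpow_lt_rpow hb'.le h (by linarith : 0 < p - 1)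
    nlinarith [mul_pos (sub_pos.2 this) (sub_pos.2 h),
      mul_nonneg (add_pos pa pb).le (sub_nonneg.2 hcs)]

/-- Density points: for almost every point of `S`, small shifted balls meet `S`. -/
lemma density_meet {E : Type*} [NormedAddCommGroup E] [InnerProductSpace ℝ E] [FiniteDimensional ℝ E]
    [MeasurableSpace E] [BorelSpace E] (S : Set (E)) (K : ℕ) :
    ∀ᵐ x ∂(volume : Measure (E)), x ∈ S →
      ∀ (e : E) (η : ℝ), 0 < η → ‖e‖ ≤ K * η →
        ∀ᶠ t in nhdsWithin (0 : ℝ) (Set.Ioi 0),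
          (S ∩ Metric.closedBall (x + t • e) (η * t)).Nonempty := by
  have h := IsUnifLocDoublingMeasure.ae_tendsto_measure_inter_div
    (volume : Measure (E)) S (K : ℝ)
  filter_upwards [ae_imp_of_ae_restrict h] with x hx hxS e η hη he
  have h1 : Filter.Tendsto (fun t : ℝ => η * t) (nhdsWithin (0 : ℝ) (Set.Ioi 0))
      (nhdsWithin (0 : ℝ) (Set.Ioi 0)) := by
    refine tendsto_nhdsWithin_iff.2 ⟨?_, ?_⟩
    · have : Filter.Tendsto (fun t : ℝ => η * t) (nhds 0) (nhds (η * 0)) :=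
        (continuous_const.mul continuous_id).tendsto 0
      rw [mul_zero] at this
      exact this.mono_left nhdsWithin_le_nhds
    · filter_upwards [self_mem_nhdsWithin] with t ht
      exact mul_pos hη ht
  have h2 : ∀ᶠ t in nhdsWithin (0 : ℝ) (Set.Ioi 0),
      x ∈ Metric.closedBall (x + t • e) (K * (η * t)) := by
    filter_upwards [self_mem_nhdsWithin] with t ht
    have ht' : 0 < t := ht
    rw [Metric.mem_closedBall, dist_eq_norm]
    simp only [sub_add_cancel_left, norm_neg, norm_smul, Real.norm_eq_abs, abs_of_pos ht']
    nlinarith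
  have h3 := hx hxS (fun t : ℝ => x + t • e) (fun t => η * t) h1 h2
  have h4 := h3.eventually_ne (one_ne_zero)
  filter_upwards [h4] with t ht
  by_contra hne
  rw [Set.not_nonempty_iff_eq_empty] at hne
  rw [hne] at ht
  simp at ht

/-- A set that is 2-monotone for the cost `‖x - y‖ ^ p` is a graph outside a Lebesgue null set. -/
lemma graph_ae {E : Type*} [NormedAddCommGroup E] [InnerProductSpace ℝ E] [FiniteDimensional ℝ E]
    [MeasurableSpace E] [BorelSpace E] {p : ℝ} (hp : 1 < p)
    (G : Set (E × E))
    (hG : ∀ a ∈ G, ∀ b ∈ G, ‖a.1 - a.2‖ ^ p + ‖b.1 - b.2‖ ^ p ≤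
      ‖a.1 - b.2‖ ^ p + ‖b.1 - a.2‖ ^ p) :
    ∀ᵐ x ∂(volume : Measure (E)), ∀ y0 y1, (x, y0) ∈ G → (x, y1) ∈ G →
      y0 = y1 := by
  have hae : ∀ᵐ x ∂(volume : Measure E), ∀ U ∈ TopologicalSpace.countableBasis E, ∀ K : ℕ,
      x ∈ {x : E | ∃ y ∈ U, (x, y) ∈ G} →
      ∀ (e : E) (η : ℝ), 0 < η → ‖e‖ ≤ K * η →
        ∀ᶠ t in nhdsWithin (0 : ℝ) (Set.Ioi 0),
          ({x : E | ∃ y ∈ U, (x, y) ∈ G} ∩ Metric.closedBall (x + t • e) (η * t)).Nonempty := by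
    rw [ae_ball_iff (TopologicalSpace.countable_countableBasis E)]
    intro U _
    rw [ae_all_iff]
    intro K
    exact density_meet _ K
  filter_upwards [hae] with x hx y0 y1 h0 h1
  by_contra hne
  set h : E → ℝ := fun v => ‖v‖ ^ p with hh
  have hab : x - y0 ≠ x - y1 := fun hc => hne (sub_right_injective hc)
  have hpos := deriv_strict hp hab
  have cd : ContDiff ℝ 1 h := contDiff_norm_rpow hp
  have sd : ∀ v : E, HasStrictFDerivAt h (fderiv ℝ h v) v := fun v =>
    cd.contDiffAt.hasStrictFDerivAt one_ne_zero
  set La := fderiv ℝ h (x - y0) with hLa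
  set Lb := fderiv ℝ h (x - y1) with hLb
  set e : E := (x - y0) - (x - y1) with he
  set s : ℝ := (La - Lb) e with hs
  have hs0 : 0 < s := hpos
  -- choice of the opening `η` of the cone
  set η : ℝ := s / (2 * (‖La - Lb‖ + 1)) with hη
  have hη0 : 0 < η := by positivity
  have hηL : ‖La - Lb‖ * η ≤ s / 2 := by
    rw [hη, mul_div_assoc', div_le_div_iff₀ (by positivity) (by positivity)]
    nlinarith [norm_nonneg (La - Lb)]
  obtain ⟨K, hK⟩ := exists_nat_ge (‖e‖ / η)
  have hK' : ‖e‖ ≤ K * η := (div_le_iff₀ hη0).1 hK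
  set ε : ℝ := s / (8 * (‖e‖ + η)) with hε
  have hε0 : 0 < ε := by positivity
  have hεe : 2 * ε * (‖e‖ + η) = s / 4 := by
    rw [hε]; field_simp; ring
  have strict : ∀ v : E, ∃ r > 0, ∀ u w : E, dist u v < r → dist w v < r →
      |h u - h w - fderiv ℝ h v (u - w)| ≤ ε * ‖u - w‖ := by
    intro v
    have := (sd v).isLittleO.def hε0
    rw [Metric.eventually_nhds_iff] at this
    obtain ⟨r, hr, hr'⟩ := this
    refine ⟨r, hr, fun u w hu hw => ?_⟩
    have := @hr' (u, w) (by rw [Prod.dist_eq]; exact max_lt hu hw)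
    simpa using this
  obtain ⟨r0, hr0, H0⟩ := strict (x - y0)
  obtain ⟨r1, hr1, H1⟩ := strict (x - y1)
  obtain ⟨U, hU, hy0U, hUr⟩ := (TopologicalSpace.isBasis_countableBasis E).exists_subset_of_mem_open
    (Metric.mem_ball_self (half_pos hr0) : y0 ∈ Metric.ball y0 (r0 / 2)) Metric.isOpen_ball
  have ev := hx U hU K ⟨y0, hy0U, h0⟩ e η hη0 hK'
  have evsmall : ∀ᶠ t in nhdsWithin (0 : ℝ) (Set.Ioi 0),
      t * (‖e‖ + η) < min (r0 / 2) r1 := by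
    have : Filter.Tendsto (fun t : ℝ => t * (‖e‖ + η)) (nhds 0) (nhds (0 * (‖e‖ + η))) :=
      (continuous_id.mul continuous_const).tendsto 0
    rw [zero_mul] at this
    exact (this.eventually_lt_const (lt_min (half_pos hr0) hr1)).filter_mono nhdsWithin_le_nhds
  have evpos : ∀ᶠ t in nhdsWithin (0 : ℝ) (Set.Ioi 0), 0 < t := self_mem_nhdsWithin
  obtain ⟨t, ⟨⟨x', ⟨y', hy'U, hx'G⟩, hx'b⟩, hsm⟩, ht⟩ := ((ev.and evsmall).and evpos).exists
  rw [Metric.mem_closedBall, dist_eq_norm] at hx'b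
  have hy' : dist y' y0 < r0 / 2 := hUr hy'U
  set q := x' - (x + t • e) with hq
  have hxx : x' - x = t • e + q := by rw [hq]; abel
  have hnorm : ‖x' - x‖ ≤ t * (‖e‖ + η) := by
    rw [hxx]
    refine (norm_add_le _ _).trans ?_
    rw [norm_smul, Real.norm_eq_abs, abs_of_pos ht]
    nlinarith
  have hlt0 := lt_of_le_of_lt hnorm (lt_of_lt_of_le hsm (min_le_left _ _))
  have hlt1 := lt_of_le_of_lt hnorm (lt_of_lt_of_le hsm (min_le_right _ _))
  rw [dist_eq_norm] at hy'
  have A0 := H0 (x' - y') (x - y')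
    (by rw [dist_eq_norm, show x' - y' - (x - y0) = (x' - x) - (y' - y0) by abel]
        exact (norm_sub_le _ _).trans_lt (by linarith))
    (by rw [dist_eq_norm, show x - y' - (x - y0) = - (y' - y0) by abel, norm_neg]
        linarith)
  have A1 := H1 (x' - y1) (x - y1)
    (by rw [dist_eq_norm, show x' - y1 - (x - y1) = (x' - x) by abel]
        exact hlt1)
    (by simpa using hr1)
  rw [show x' - y' - (x - y') = x' - x by abel] at A0
  rw [show x' - y1 - (x - y1) = x' - x by abel] at A1
  have M := hG _ h1 _ hx'G
  simp only at M
  have B0 := (abs_le.1 A0).1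
  have B1 := (abs_le.1 A1).2
  have M' : h (x' - y') - h (x - y') ≤ h (x' - y1) - h (x - y1) := by
    simp only [hh]; linarith
  have hfin : (La - Lb) (x' - x) ≤ 2 * ε * ‖x' - x‖ := by
    rw [_root_.sub_apply]; linarith
  have hlow : t * s - ‖La - Lb‖ * (η * t) ≤ (La - Lb) (x' - x) := by
    rw [hxx, map_add, map_smul, smul_eq_mul, ← hs]
    have : |(La - Lb) q| ≤ ‖La - Lb‖ * ‖q‖ := by
      simpa using (La - Lb).le_opNorm q
    have h3 := (abs_le.1 this).1
    have h4 : ‖La - Lb‖ * ‖q‖ ≤ ‖La - Lb‖ * (η * t) :=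
      mul_le_mul_of_nonneg_left hx'b (norm_nonneg _)
    linarith
  have hup : 2 * ε * ‖x' - x‖ ≤ 2 * ε * (t * (‖e‖ + η)) :=
    mul_le_mul_of_nonneg_left hnorm (by positivity)
  have e1 : 2 * ε * (t * (‖e‖ + η)) = t * (s / 4) := by rw [← hεe]; ring
  have e2 : ‖La - Lb‖ * (η * t) ≤ t * (s / 2) := by nlinarith
  nlinarith [mul_pos ht hs0]

/-- Two measures concentrated on a common graph with the same first marginal agree. -/
lemma eq_of_graph {X : Type*} [MeasurableSpace X] [StandardBorelSpace X]
    (γ0 γ1 : Measure (X × X)) (G : Set (X × X)) (mG : MeasurableSet G)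
    (hinj : Set.InjOn Prod.fst G) (h0 : γ0 Gᶜ = 0) (h1 : γ1 Gᶜ = 0)
    (hm : γ0.map Prod.fst = γ1.map Prod.fst) : γ0 = γ1 := by
  have key : ∀ γ : Measure (X × X), γ Gᶜ = 0 → ∀ A, MeasurableSet A →
      γ A = γ.map Prod.fst (Prod.fst '' (A ∩ G)) := by
    intro γ hγ A mA
    have mI : MeasurableSet (Prod.fst '' (A ∩ G)) :=
      (mA.inter mG).image_of_measurable_injOn measurable_fst (hinj.mono Set.inter_subset_right)
    rw [Measure.map_apply measurable_fst mI]
    have hG' : ∀ᵐ z ∂γ, z ∈ G := by rw [ae_iff]; exact hγ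
    refine measure_congr ?_
    filter_upwards [hG'] with z hz
    refine propext ⟨fun hA => ⟨z, ⟨hA, hz⟩, rfl⟩, ?_⟩
    rintro ⟨w, ⟨hwA, hwG⟩, hw⟩
    have : w = z := hinj hwG hz hw
    exact this ▸ hwA
  refine Measure.ext fun A mA => ?_
  rw [key γ0 h0 A mA, key γ1 h1 A mA, hm]

section Existence

set_option linter.unusedSectionVars false

variable {E : Type*} [NormedAddCommGroup E] [InnerProductSpace ℝ E] [FiniteDimensional ℝ E]
    [MeasurableSpace E] [BorelSpace E]

lemma cost_continuous {p : ℝ} : Continuous (fun z : E × E => edist z.1 z.2 ^ p) :=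
  ENNReal.continuous_rpow_const.comp (continuous_fst.edist continuous_snd)

lemma cost_lsc {p : ℝ} (hp : 0 ≤ p) : LowerSemicontinuous
    (fun γ : ProbabilityMeasure (E × E) => ∫⁻ z, edist z.1 z.2 ^ p ∂(γ : Measure (E × E))) := by
  let f : ℕ → BoundedContinuousFunction (E × E) NNReal := fun n =>
    BoundedContinuousFunction.mkOfBound
      ⟨fun z => min (nndist z.1 z.2 ^ p) n, by
        refine Continuous.min ?_ continuous_const
        exact (NNReal.continuous_rpow_const hp).comp (continuous_fst.nndist continuous_snd)⟩ n
      (fun x y => by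
        rw [NNReal.dist_eq]
        simp only [ContinuousMap.coe_mk]
        have h1 : (((min (nndist x.1 x.2 ^ p) (n : NNReal) : NNReal)) : ℝ) ≤ n := by
          exact_mod_cast min_le_right _ _
        have h2 : (((min (nndist y.1 y.2 ^ p) (n : NNReal) : NNReal)) : ℝ) ≤ n := by
          exact_mod_cast min_le_right _ _
        have h3 := NNReal.coe_nonneg (min (nndist x.1 x.2 ^ p) (n : NNReal))
        have h4 := NNReal.coe_nonneg (min (nndist y.1 y.2 ^ p) (n : NNReal))
        rw [abs_le]
        constructor <;> linarith)
  have hf : ∀ n z, f n z = min (nndist z.1 z.2 ^ p) n := fun n z => rfl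
  have hsup : ∀ z : E × E, edist z.1 z.2 ^ p = ⨆ n, (f n z : ℝ≥0∞) := by
    intro z
    have hz : edist z.1 z.2 ^ p = ((nndist z.1 z.2 ^ p : NNReal) : ℝ≥0∞) := by
      rw [edist_nndist, ENNReal.coe_rpow_of_nonneg _ hp]
    rw [hz]
    refine le_antisymm ?_ (iSup_le fun n => ?_)
    · obtain ⟨n, hn⟩ := exists_nat_ge (nndist z.1 z.2 ^ p)
      refine le_trans ?_ (le_iSup _ n)
      rw [hf, min_eq_left hn]
    · rw [hf]
      exact ENNReal.coe_le_coe.2 (min_le_left _ _)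
  have heq : (fun γ : ProbabilityMeasure (E × E) =>
      ∫⁻ z, edist z.1 z.2 ^ p ∂(γ : Measure (E × E))) =
      fun γ : ProbabilityMeasure (E × E) => ⨆ n, ∫⁻ z, (f n z : ℝ≥0∞) ∂(γ : Measure (E × E)) := by
    funext γ
    simp_rw [hsup]
    rw [lintegral_iSup]
    · intro n
      exact (f n).continuous.measurable.coe_nnreal_ennreal
    · intro n m hnm z
      simp only [hf]
      exact ENNReal.coe_le_coe.2 (min_le_min_left _ (by exact_mod_cast hnm))
  rw [heq]
  refine lowerSemicontinuous_iSup fun n => Continuous.lowerSemicontinuous ?_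
  refine continuous_iff_continuousAt.2 fun γ => ?_
  exact (ProbabilityMeasure.tendsto_iff_forall_lintegral_tendsto.1 Filter.tendsto_id) (f n)

lemma tri_pow {p : ℝ} (hp : 1 < p) (x y z : E) :
    edist x z ^ p ≤ 2 ^ (p - 1) * (edist x y ^ p + edist y z ^ p) :=
  (ENNReal.rpow_le_rpow (edist_triangle x y z) (by linarith)).trans
    (ENNReal.rpow_add_le_mul_rpow_add_rpow _ _ hp.le)

lemma two_pow_ne_top {p : ℝ} (hp : 1 < p) : (2 : ℝ≥0∞) ^ (p - 1) ≠ ∞ :=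
  ENNReal.rpow_ne_top_of_nonneg (by linarith) (by simp)

lemma snd_moment {p : ℝ} (hp : 1 < p) (γ : Measure (E × E)) :
    ∫⁻ z, edist 0 z.2 ^ p ∂γ ≤
      2 ^ (p - 1) * (∫⁻ x, edist 0 x ^ p ∂(γ.map Prod.fst) + ∫⁻ z, edist z.1 z.2 ^ p ∂γ) := by
  have m1 : Measurable (fun x : E => edist 0 x ^ p) := by fun_prop
  rw [lintegral_map m1 measurable_fst, ← lintegral_add_left (by fun_prop),
    ← lintegral_const_mul' _ _ (two_pow_ne_top hp)]
  exact lintegral_mono fun z => tri_pow hp 0 z.1 z.2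

lemma tight_sublevel {p : ℝ} (hp : 1 < p) (μ : Measure E) (hμ : FiniteMoment p (0 : E) μ)
    (M : ℝ≥0∞) (hM : M ≠ ∞) :
    IsCompact (closure {γ : ProbabilityMeasure (E × E) |
      (γ : Measure (E × E)).map Prod.fst = μ ∧
        ∫⁻ z, edist z.1 z.2 ^ p ∂(γ : Measure (E × E)) ≤ M}) := by
  have hp0 : 0 < p := by linarith
  refine isCompact_closure_of_isTightMeasureSet ?_
  refine isTightMeasureSet_of_tendsto_measure_norm_gt ?_
  set A := ∫⁻ x, edist 0 x ^ p ∂μ with hA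
  have hAtop : A ≠ ∞ := hμ
  set C : ℝ≥0∞ := A + 2 ^ (p - 1) * (A + M) with hC
  have hCtop : C ≠ ∞ := ENNReal.add_ne_top.2 ⟨hAtop,
    ENNReal.mul_ne_top (two_pow_ne_top hp) (ENNReal.add_ne_top.2 ⟨hAtop, hM⟩)⟩
  have hlim : Filter.Tendsto (fun r : ℝ => C / ENNReal.ofReal r ^ p) Filter.atTop (nhds 0) := by
    have h1 : Filter.Tendsto (fun r : ℝ => ENNReal.ofReal r ^ p) Filter.atTop (nhds ∞) := by
      have := (ENNReal.continuous_rpow_const (y := p)).tendsto ∞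
      rw [ENNReal.top_rpow_of_pos hp0] at this
      exact this.comp ENNReal.tendsto_ofReal_atTop
    have := ENNReal.Tendsto.const_div h1 (a := C) (Or.inr hCtop)
    rwa [ENNReal.div_top] at this
  refine tendsto_of_tendsto_of_tendsto_of_le_of_le' tendsto_const_nhds hlim
    (Filter.Eventually.of_forall fun _ => zero_le) ?_
  filter_upwards [Filter.eventually_gt_atTop 0] with r hr
  refine iSup₂_le ?_
  rintro _ ⟨γ, ⟨hγ1, hγ2⟩, rfl⟩
  have hint : ∫⁻ z, (edist 0 z.1 ^ p + edist 0 z.2 ^ p) ∂(γ : Measure (E × E)) ≤ C := by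
    rw [lintegral_add_left (by fun_prop), hC]
    have m1 : Measurable (fun x : E => edist 0 x ^ p) := by fun_prop
    have e1 : ∫⁻ z, edist 0 z.1 ^ p ∂(γ : Measure (E × E)) = A := by
      rw [hA, ← hγ1, lintegral_map m1 measurable_fst]
    rw [e1]
    gcongr
    refine (snd_moment hp _).trans ?_
    rw [hγ1]
    gcongr
  have hpos : ENNReal.ofReal r ^ p ≠ 0 := by
    have : 0 < ENNReal.ofReal r := ENNReal.ofReal_pos.2 hr
    exact (ENNReal.rpow_pos this ENNReal.ofReal_ne_top).ne'
  have htop : ENNReal.ofReal r ^ p ≠ ∞ :=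
    ENNReal.rpow_ne_top_of_nonneg hp0.le ENNReal.ofReal_ne_top
  have hmk := meas_ge_le_lintegral_div (μ := (γ : Measure (E × E)))
    (f := fun z : E × E => edist 0 z.1 ^ p + edist 0 z.2 ^ p) (by fun_prop) hpos htop
  refine (measure_mono ?_).trans (hmk.trans (ENNReal.div_le_div_right hint _))
  intro z hz
  have hz' : r < max ‖z.1‖ ‖z.2‖ := hz
  change ENNReal.ofReal r ^ p ≤ edist 0 z.1 ^ p + edist 0 z.2 ^ p
  rw [edist_dist, edist_dist, dist_zero_left, dist_zero_left]
  rcases lt_max_iff.1 hz' with h | h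
  · exact (ENNReal.rpow_le_rpow (ENNReal.ofReal_le_ofReal h.le) hp0.le).trans le_self_add
  · exact (ENNReal.rpow_le_rpow (ENNReal.ofReal_le_ofReal h.le) hp0.le).trans le_add_self

lemma exists_min {ι : Type*} [Fintype ι] {p : ℝ} (hp : 1 < p) (w : ι → ℝ) (hw : ∀ i, 0 < w i)
    (μ : ι → Measure E) (hμ : ∀ i, FiniteMoment p (0 : E) (μ i))
    (C : Set (ι → ProbabilityMeasure (E × E))) (hC : IsClosed C)
    (hCμ : ∀ g ∈ C, ∀ i, (g i : Measure (E × E)).map Prod.fst = μ i)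
    (g0 : ι → ProbabilityMeasure (E × E)) (hg0 : g0 ∈ C)
    (hfin : ∑ i, ENNReal.ofReal (w i) * ∫⁻ z, edist z.1 z.2 ^ p ∂(g0 i : Measure (E × E)) ≠ ∞) :
    ∃ g ∈ C, ∀ g' ∈ C,
      ∑ i, ENNReal.ofReal (w i) * ∫⁻ z, edist z.1 z.2 ^ p ∂(g i : Measure (E × E)) ≤
      ∑ i, ENNReal.ofReal (w i) * ∫⁻ z, edist z.1 z.2 ^ p ∂(g' i : Measure (E × E)) := by
  have hp0 : 0 ≤ p := by linarith
  set F : (ι → ProbabilityMeasure (E × E)) → ℝ≥0∞ := fun g =>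
    ∑ i, ENNReal.ofReal (w i) * ∫⁻ z, edist z.1 z.2 ^ p ∂(g i : Measure (E × E)) with hF
  have lscF : LowerSemicontinuous F := by
    refine lowerSemicontinuous_sum fun i _ => ?_
    have h1 : LowerSemicontinuous (fun g : ι → ProbabilityMeasure (E × E) =>
        ∫⁻ z, edist z.1 z.2 ^ p ∂(g i : Measure (E × E))) :=
      fun g y hy => (continuous_apply i).continuousAt.eventually (cost_lsc hp0 (g i) y hy)
    exact (ENNReal.continuous_const_mul ENNReal.ofReal_ne_top).comp_lowerSemicontinuous h1
      (fun a b hab => mul_le_mul_right hab _)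
  set S := C ∩ F ⁻¹' Set.Iic (F g0) with hS
  have clS : IsClosed S := hC.inter (lscF.isClosed_preimage _)
  have w0 : ∀ i, ENNReal.ofReal (w i) ≠ 0 := fun i => (ENNReal.ofReal_pos.2 (hw i)).ne'
  have sub : S ⊆ Set.pi Set.univ fun i => closure {γ : ProbabilityMeasure (E × E) |
      (γ : Measure (E × E)).map Prod.fst = μ i ∧
        ∫⁻ z, edist z.1 z.2 ^ p ∂(γ : Measure (E × E)) ≤ F g0 / ENNReal.ofReal (w i)} := by
    rintro g ⟨hgC, hgF⟩ i -
    refine subset_closure ⟨hCμ g hgC i, ?_⟩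
    rw [ENNReal.le_div_iff_mul_le (Or.inl (w0 i)) (Or.inl ENNReal.ofReal_ne_top), mul_comm]
    refine le_trans ?_ hgF
    exact Finset.single_le_sum (f := fun i => ENNReal.ofReal (w i) *
      ∫⁻ z, edist z.1 z.2 ^ p ∂(g i : Measure (E × E))) (fun _ _ => zero_le) (Finset.mem_univ i)
  have cpt : IsCompact S := by
    refine IsCompact.of_isClosed_subset (isCompact_univ_pi fun i => ?_) clS sub
    exact tight_sublevel hp (μ i) (hμ i) _ (ENNReal.div_ne_top hfin (w0 i))
  obtain ⟨g, hgS, hmin⟩ := LowerSemicontinuousOn.exists_isMinOn (f := F)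
    (⟨g0, hg0, le_refl (F g0)⟩ : S.Nonempty) cpt
    (lscF.lowerSemicontinuousOn S)
  refine ⟨g, hgS.1, fun g' hg' => ?_⟩
  rcases le_total (F g') (F g0) with h | h
  · exact hmin ⟨hg', h⟩
  · exact le_trans hgS.2 h

lemma mk_pow_le {p : ℝ} (hp : 0 < p) {μ ν : Measure E} {γ : Measure (E × E)}
    (h1 : γ.map Prod.fst = μ) (h2 : γ.map Prod.snd = ν) :
    MK p μ ν ^ p ≤ ∫⁻ z, edist z.1 z.2 ^ p ∂γ := by
  have h : MK p μ ν ≤ (∫⁻ z, edist z.1 z.2 ^ p ∂γ) ^ (1 / p) := iInf₂_le γ ⟨h1, h2⟩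
  have h' := ENNReal.rpow_le_rpow h hp.le
  rwa [← ENNReal.rpow_mul, one_div, inv_mul_cancel₀ hp.ne', ENNReal.rpow_one] at h'

lemma mk_pow_eq {p : ℝ} (hp : 0 < p) {μ ν : Measure E} {γ : Measure (E × E)}
    (h1 : γ.map Prod.fst = μ) (h2 : γ.map Prod.snd = ν)
    (hopt : ∀ γ' : Measure (E × E), γ'.map Prod.fst = μ → γ'.map Prod.snd = ν →
      ∫⁻ z, edist z.1 z.2 ^ p ∂γ ≤ ∫⁻ z, edist z.1 z.2 ^ p ∂γ') :
    MK p μ ν ^ p = ∫⁻ z, edist z.1 z.2 ^ p ∂γ := by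
  refine le_antisymm (mk_pow_le hp h1 h2) ?_
  have h : (∫⁻ z, edist z.1 z.2 ^ p ∂γ) ^ (1 / p) ≤ MK p μ ν :=
    le_iInf₂ fun γ' hγ' => ENNReal.rpow_le_rpow (hopt γ' hγ'.1 hγ'.2) (by positivity)
  have h' := ENNReal.rpow_le_rpow h hp.le
  rwa [← ENNReal.rpow_mul, one_div, inv_mul_cancel₀ hp.ne', ENNReal.rpow_one] at h'

lemma isProb_of_map {X : Type*} [MeasurableSpace X] {μ : Measure X} [hμ : IsProbabilityMeasure μ]
    {γ : Measure (X × X)} (h1 : γ.map Prod.fst = μ) : IsProbabilityMeasure γ := by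
  refine ⟨?_⟩
  have := hμ.measure_univ
  rw [← h1, Measure.map_apply measurable_fst MeasurableSet.univ] at this
  simpa using this

lemma prod_cost_fin {p : ℝ} (hp : 1 < p) (μ ν : Measure E) [IsProbabilityMeasure μ]
    [IsProbabilityMeasure ν] (hμ : FiniteMoment p (0 : E) μ) (hν : FiniteMoment p (0 : E) ν) :
    ∫⁻ z, edist z.1 z.2 ^ p ∂(μ.prod ν) ≠ ∞ := by
  have m1 : Measurable (fun x : E => edist 0 x ^ p) := by fun_prop
  have e1 : ∫⁻ z, edist 0 z.1 ^ p ∂(μ.prod ν) = ∫⁻ x, edist 0 x ^ p ∂μ := by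
    have : (μ.prod ν).map Prod.fst = μ := by simp
    conv_rhs => rw [← this]
    rw [lintegral_map m1 measurable_fst]
  have e2 : ∫⁻ z, edist 0 z.2 ^ p ∂(μ.prod ν) = ∫⁻ x, edist 0 x ^ p ∂ν := by
    have : (μ.prod ν).map Prod.snd = ν := by simp
    conv_rhs => rw [← this]
    rw [lintegral_map m1 measurable_snd]
  have : ∫⁻ z, edist z.1 z.2 ^ p ∂(μ.prod ν) ≤
      2 ^ (p - 1) * (∫⁻ x, edist 0 x ^ p ∂μ + ∫⁻ x, edist 0 x ^ p ∂ν) := by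
    rw [← e1, ← e2, ← lintegral_add_left (by fun_prop),
      ← lintegral_const_mul' _ _ (two_pow_ne_top hp)]
    refine lintegral_mono fun z => ?_
    have := tri_pow hp z.1 0 z.2
    rwa [edist_comm z.1 0] at this
  refine ne_top_of_le_ne_top ?_ this
  exact ENNReal.mul_ne_top (two_pow_ne_top hp) (ENNReal.add_ne_top.2 ⟨hμ, hν⟩)

lemma closed_fst (ν : Measure E) [IsProbabilityMeasure ν] :
    IsClosed {γ : ProbabilityMeasure (E × E) | (γ : Measure (E × E)).map Prod.fst = ν} := by
  have : {γ : ProbabilityMeasure (E × E) | (γ : Measure (E × E)).map Prod.fst = ν} =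
      (fun γ : ProbabilityMeasure (E × E) => γ.map continuous_fst.measurable.aemeasurable) ⁻¹'
        {(⟨ν, inferInstance⟩ : ProbabilityMeasure E)} := by
    ext γ
    exact ⟨fun h => ProbabilityMeasure.toMeasure_injective h,
      fun h => congrArg (fun m : ProbabilityMeasure E => (m : Measure E)) h⟩
  rw [this]
  exact isClosed_singleton.preimage (ProbabilityMeasure.continuous_map continuous_fst)

lemma closed_snd (ν : Measure E) [IsProbabilityMeasure ν] :
    IsClosed {γ : ProbabilityMeasure (E × E) | (γ : Measure (E × E)).map Prod.snd = ν} := by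
  have : {γ : ProbabilityMeasure (E × E) | (γ : Measure (E × E)).map Prod.snd = ν} =
      (fun γ : ProbabilityMeasure (E × E) => γ.map continuous_snd.measurable.aemeasurable) ⁻¹'
        {(⟨ν, inferInstance⟩ : ProbabilityMeasure E)} := by
    ext γ
    exact ⟨fun h => ProbabilityMeasure.toMeasure_injective h,
      fun h => congrArg (fun m : ProbabilityMeasure E => (m : Measure E)) h⟩
  rw [this]
  exact isClosed_singleton.preimage (ProbabilityMeasure.continuous_map continuous_snd)

lemma closed_snd_eq {ι : Type*} (i j : ι) :
    IsClosed {g : ι → ProbabilityMeasure (E × E) |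
      (g i : Measure (E × E)).map Prod.snd = (g j : Measure (E × E)).map Prod.snd} := by
  have : {g : ι → ProbabilityMeasure (E × E) |
      (g i : Measure (E × E)).map Prod.snd = (g j : Measure (E × E)).map Prod.snd} =
      {g : ι → ProbabilityMeasure (E × E) |
        (g i).map (continuous_snd (X := E) (Y := E)).measurable.aemeasurable =
        (g j).map (continuous_snd (X := E) (Y := E)).measurable.aemeasurable} := by
    ext g
    exact ⟨fun h => ProbabilityMeasure.toMeasure_injective h,
      fun h => congrArg (fun m : ProbabilityMeasure E => (m : Measure E)) h⟩
  rw [this]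
  exact isClosed_eq
    ((ProbabilityMeasure.continuous_map continuous_snd).comp (continuous_apply i))
    ((ProbabilityMeasure.continuous_map continuous_snd).comp (continuous_apply j))

/-- Existence of optimal plans. -/
lemma exists_opt {p : ℝ} (hp : 1 < p) (μ ν : Measure E) [IsProbabilityMeasure μ]
    [IsProbabilityMeasure ν] (hμ : FiniteMoment p (0 : E) μ) (hν : FiniteMoment p (0 : E) ν) :
    ∃ γ : Measure (E × E), IsProbabilityMeasure γ ∧ γ.map Prod.fst = μ ∧ γ.map Prod.snd = ν ∧
      MK p μ ν ^ p = ∫⁻ z, edist z.1 z.2 ^ p ∂γ ∧ ∫⁻ z, edist z.1 z.2 ^ p ∂γ ≠ ∞ := by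
  have hfin := prod_cost_fin hp μ ν hμ hν
  have hf : (μ.prod ν).map Prod.fst = μ := by simp
  have hs : (μ.prod ν).map Prod.snd = ν := by simp
  obtain ⟨g, hg, hmin⟩ := exists_min (ι := Unit) hp (fun _ => 1) (fun _ => one_pos) (fun _ => μ)
    (fun _ => hμ)
    ((fun g => g ()) ⁻¹' {γ : ProbabilityMeasure (E × E) | (γ : Measure (E × E)).map Prod.fst = μ} ∩
      (fun g => g ()) ⁻¹' {γ : ProbabilityMeasure (E × E) | (γ : Measure (E × E)).map Prod.snd = ν})
    (((closed_fst μ).preimage (continuous_apply ())).inter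
      ((closed_snd ν).preimage (continuous_apply ())))
    (fun g hg _ => hg.1) (fun _ => ⟨μ.prod ν, inferInstance⟩)
    ⟨hf, hs⟩ (by simpa using hfin)
  simp only [Finset.univ_unique, Finset.sum_singleton, ENNReal.ofReal_one, one_mul] at hmin
  have hopt : ∀ γ' : Measure (E × E), γ'.map Prod.fst = μ → γ'.map Prod.snd = ν →
      ∫⁻ z, edist z.1 z.2 ^ p ∂(g () : Measure (E × E)) ≤ ∫⁻ z, edist z.1 z.2 ^ p ∂γ' := by
    intro γ' h1 h2
    exact hmin (fun _ => ⟨γ', isProb_of_map h1⟩) ⟨h1, h2⟩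
  refine ⟨g (), inferInstance, hg.1, hg.2, mk_pow_eq (by linarith) hg.1 hg.2 hopt, ?_⟩
  exact ne_top_of_le_ne_top hfin (hopt _ (by simp) (by simp))

end Existence

/-- An optimal plan with absolutely continuous first marginal is concentrated on a graph. -/
lemma opt_graph {E : Type*} [NormedAddCommGroup E] [InnerProductSpace ℝ E] [FiniteDimensional ℝ E]
    [MeasurableSpace E] [BorelSpace E] {p : ℝ} (hp : 1 < p) (γ : Measure (E × E))
    [IsProbabilityMeasure γ] (hfin : ∫⁻ z, edist z.1 z.2 ^ p ∂γ ≠ ∞)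
    (hopt : ∀ γ' : Measure (E × E), γ'.map Prod.fst = γ.map Prod.fst →
      γ'.map Prod.snd = γ.map Prod.snd →
      ∫⁻ z, edist z.1 z.2 ^ p ∂γ ≤ ∫⁻ z, edist z.1 z.2 ^ p ∂γ')
    (hac : γ.map Prod.fst ≪ (volume : Measure E)) :
    ∃ G : Set (E × E), MeasurableSet G ∧ Set.InjOn Prod.fst G ∧ γ Gᶜ = 0 := by
  have hp0 : 0 ≤ p := by linarith
  have hcost : ∀ x y : E, edist x y ^ p = ENNReal.ofReal (‖x - y‖ ^ p) := by
    intro x y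
    rw [edist_dist, ENNReal.ofReal_rpow_of_nonneg dist_nonneg hp0, dist_eq_norm]
  have hmono : ∀ a ∈ γ.support, ∀ b ∈ γ.support, ‖a.1 - a.2‖ ^ p + ‖b.1 - b.2‖ ^ p ≤
      ‖a.1 - b.2‖ ^ p + ‖b.1 - a.2‖ ^ p := by
    intro a ha b hb
    have h := support_monotone γ (fun z => edist z.1 z.2 ^ p) cost_continuous hfin hopt a b ha hb
    simp only [hcost] at h
    rw [← ENNReal.ofReal_add (by positivity) (by positivity),
      ← ENNReal.ofReal_add (by positivity) (by positivity)] at h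
    exact (ENNReal.ofReal_le_ofReal_iff (by positivity)).1 h
  have hgr := graph_ae hp γ.support hmono
  set N : Set E := toMeasurable volume
    {x : E | ¬ ∀ y0 y1, (x, y0) ∈ γ.support → (x, y1) ∈ γ.support → y0 = y1} with hN
  have hN0 : (volume : Measure E) N = 0 := by
    rw [hN, measure_toMeasurable]; exact ae_iff.1 hgr
  have mN : MeasurableSet N := measurableSet_toMeasurable _ _
  refine ⟨γ.support ∩ Prod.fst ⁻¹' Nᶜ,
    Measure.isClosed_support.measurableSet.inter (measurable_fst mN.compl), ?_, ?_⟩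
  · rintro ⟨x, y⟩ ⟨h1, h2⟩ ⟨x', y'⟩ ⟨h1', h2'⟩ heq
    have hx : x = x' := heq
    subst hx
    have hxN : x ∉ N := h2
    by_contra hne
    refine hxN (subset_toMeasurable _ _ ?_)
    intro hall
    exact hne (by rw [hall y y' h1 h1'])
  · rw [Set.compl_inter]
    refine measure_union_null Measure.measure_compl_support ?_
    rw [← Set.preimage_compl, compl_compl, ← Measure.map_apply measurable_fst mN]
    exact hac hN0

/-- **Uniqueness (and existence) of Monge–Kantorovich barycenters in Euclidean space.**
For `1 < p < ∞`, weights `λ_k ∈ (0,1)` summing to `1`, and `μ_1, …, μ_K ∈ 𝒫_p(ℝ^d)` with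
`μ_{k0}` absolutely continuous with respect to Lebesgue measure for some `k0`, the function
`ν ↦ ∑ k λ_k MK_p(μ_k, ν)^p` has exactly one minimizer in `𝒫_p(ℝ^d)`. -/
theorem euclidean_barycenter_uniqueness (d : ℕ) (hd : 1 ≤ d)
    (p : ℝ) (hp : 1 < p) (K : ℕ) (hK : 2 ≤ K)
    (lam : Fin K → ℝ) (hlam : ∀ k, lam k ∈ Set.Ioo (0 : ℝ) 1) (hsum : ∑ k, lam k = 1)
    (μ : Fin K → Measure (EuclideanSpace ℝ (Fin d)))
    (hprob : ∀ k, IsProbabilityMeasure (μ k))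
    (hmom : ∀ k, FiniteMoment p (0 : EuclideanSpace ℝ (Fin d)) (μ k))
    (k0 : Fin K) (hac : μ k0 ≪ (volume : Measure (EuclideanSpace ℝ (Fin d)))) :
    ∃! ν : Measure (EuclideanSpace ℝ (Fin d)),
      IsProbabilityMeasure ν ∧ FiniteMoment p (0 : EuclideanSpace ℝ (Fin d)) ν ∧
        ∀ ν' : Measure (EuclideanSpace ℝ (Fin d)),
          IsProbabilityMeasure ν' → FiniteMoment p (0 : EuclideanSpace ℝ (Fin d)) ν' →
            ∑ k, ENNReal.ofReal (lam k) * MK p (μ k) ν ^ p ≤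
              ∑ k, ENNReal.ofReal (lam k) * MK p (μ k) ν' ^ p := by
  have hp0 : 0 < p := by linarith
  have hlpos : ∀ k, 0 < lam k := fun k => (hlam k).1
  refine existsUnique_of_exists_of_unique ?_ ?_
  · -- existence
    have hdir : FiniteMoment p (0 : EuclideanSpace ℝ (Fin d)) (Measure.dirac 0) := by
      unfold FiniteMoment
      rw [lintegral_dirac]
      simp [hp0]
    have e1 : ∀ k, ((μ k).prod (Measure.dirac (0 : EuclideanSpace ℝ (Fin d)))).map Prod.fst
        = μ k := fun k => by simp
    have e2 : ∀ k, ((μ k).prod (Measure.dirac (0 : EuclideanSpace ℝ (Fin d)))).map Prod.snd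
        = Measure.dirac 0 := fun k => by simp
    have hfin : ∑ k, ENNReal.ofReal (lam k) * ∫⁻ z, edist z.1 z.2 ^ p
        ∂((μ k).prod (Measure.dirac (0 : EuclideanSpace ℝ (Fin d)))) ≠ ∞ :=
      ENNReal.sum_ne_top.2 fun k _ => ENNReal.mul_ne_top ENNReal.ofReal_ne_top
        (prod_cost_fin hp _ _ (hmom k) hdir)
    obtain ⟨g, hg, hmin⟩ := exists_min hp lam hlpos μ hmom
      ((⋂ k, (fun g => g k) ⁻¹' {γ : ProbabilityMeasure
          (EuclideanSpace ℝ (Fin d) × EuclideanSpace ℝ (Fin d)) |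
          (γ : Measure (EuclideanSpace ℝ (Fin d) × EuclideanSpace ℝ (Fin d))).map Prod.fst = μ k}) ∩
        ⋂ i, {g : Fin K → ProbabilityMeasure
          (EuclideanSpace ℝ (Fin d) × EuclideanSpace ℝ (Fin d)) |
          (g i : Measure (EuclideanSpace ℝ (Fin d) × EuclideanSpace ℝ (Fin d))).map Prod.snd =
          (g k0 : Measure (EuclideanSpace ℝ (Fin d) × EuclideanSpace ℝ (Fin d))).map Prod.snd})
      ((isClosed_iInter fun k => (closed_fst (μ k)).preimage (continuous_apply k)).inter
        (isClosed_iInter fun i => closed_snd_eq i k0))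
      (fun g hg k => Set.mem_iInter.1 hg.1 k)
      (fun k => ⟨(μ k).prod (Measure.dirac 0), inferInstance⟩)
      ⟨Set.mem_iInter.2 fun k => e1 k, Set.mem_iInter.2 fun i => (e2 i).trans (e2 k0).symm⟩
      hfin
    have hg1 := fun k => Set.mem_iInter.1 hg.1 k
    have hg2 := fun k => Set.mem_iInter.1 hg.2 k
    set ν := (g k0 : Measure (EuclideanSpace ℝ (Fin d) × EuclideanSpace ℝ (Fin d))).map Prod.snd
      with hν
    refine ⟨ν, Measure.isProbabilityMeasure_map measurable_snd.aemeasurable, ?_, ?_⟩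
    · have hF := ne_top_of_le_ne_top hfin (hmin
        (fun k => ⟨(μ k).prod (Measure.dirac 0), inferInstance⟩)
        ⟨Set.mem_iInter.2 fun k => e1 k, Set.mem_iInter.2 fun i => (e2 i).trans (e2 k0).symm⟩)
      have h3 := ENNReal.sum_ne_top.1 hF k0 (Finset.mem_univ _)
      have h4 := fun htop => h3
        (ENNReal.mul_eq_top.2 (Or.inl ⟨(ENNReal.ofReal_pos.2 (hlpos k0)).ne', htop⟩))
      unfold FiniteMoment
      have m1 : Measurable (fun x : EuclideanSpace ℝ (Fin d) => edist 0 x ^ p) := by fun_prop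
      rw [hν, lintegral_map m1 measurable_snd]
      refine ne_top_of_le_ne_top ?_ (snd_moment hp _)
      have h5 : (g k0 : Measure (EuclideanSpace ℝ (Fin d) × EuclideanSpace ℝ (Fin d))).map
        Prod.fst = μ k0 := hg1 k0
      rw [h5]
      exact ENNReal.mul_ne_top (two_pow_ne_top hp) (ENNReal.add_ne_top.2 ⟨hmom k0, h4⟩)
    · intro ν' hν' hm'
      choose γ hγp hγ1 hγ2 hγ3 _ using fun k => exists_opt hp (μ k) ν' (hmom k) hm'
      have h1 := hmin (fun k => ⟨γ k, hγp k⟩)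
        ⟨Set.mem_iInter.2 fun k => hγ1 k, Set.mem_iInter.2 fun i => (hγ2 i).trans (hγ2 k0).symm⟩
      calc ∑ k, ENNReal.ofReal (lam k) * MK p (μ k) ν ^ p
          ≤ ∑ k, ENNReal.ofReal (lam k) * ∫⁻ z, edist z.1 z.2 ^ p
            ∂(g k : Measure (EuclideanSpace ℝ (Fin d) × EuclideanSpace ℝ (Fin d))) :=
            Finset.sum_le_sum fun k _ => mul_le_mul_right (mk_pow_le hp0 (hg1 k) (hg2 k)) _
        _ ≤ ∑ k, ENNReal.ofReal (lam k) * ∫⁻ z, edist z.1 z.2 ^ p ∂(γ k) := h1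
        _ = ∑ k, ENNReal.ofReal (lam k) * MK p (μ k) ν' ^ p :=
            Finset.sum_congr rfl fun k _ => by rw [hγ3 k]
  · -- uniqueness
    rintro ν0 ν1 ⟨hP0, hM0, hmin0⟩ ⟨hP1, hM1, hmin1⟩
    have hhalf : (2⁻¹ : ℝ≥0∞) + 2⁻¹ = 1 := ENNReal.inv_two_add_inv_two
    set νh : Measure (EuclideanSpace ℝ (Fin d)) := (2⁻¹ : ℝ≥0∞) • ν0 + (2⁻¹ : ℝ≥0∞) • ν1 with hνh
    have hPh : IsProbabilityMeasure νh := ⟨by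
      simp [hνh, hhalf]⟩
    have hMh : FiniteMoment p (0 : EuclideanSpace ℝ (Fin d)) νh := by
      unfold FiniteMoment
      rw [hνh, lintegral_add_measure, lintegral_smul_measure, lintegral_smul_measure]
      exact ENNReal.add_ne_top.2 ⟨ENNReal.mul_ne_top (by simp) hM0,
        ENNReal.mul_ne_top (by simp) hM1⟩
    choose γ0 hγp0 hγf0 hγs0 hγc0 hγt0 using fun k => exists_opt hp (μ k) ν0 (hmom k) hM0
    choose γ1 hγp1 hγf1 hγs1 hγc1 hγt1 using fun k => exists_opt hp (μ k) ν1 (hmom k) hM1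
    set γh : Fin K → Measure (EuclideanSpace ℝ (Fin d) × EuclideanSpace ℝ (Fin d)) := fun k =>
      (2⁻¹ : ℝ≥0∞) • γ0 k + (2⁻¹ : ℝ≥0∞) • γ1 k with hγh
    have hf : ∀ k, (γh k).map Prod.fst = μ k := fun k => by
      simp only [hγh]
      rw [Measure.map_add _ _ measurable_fst, Measure.map_smul, Measure.map_smul, hγf0, hγf1,
        ← add_smul, hhalf, one_smul]
    have hs : ∀ k, (γh k).map Prod.snd = νh := fun k => by
      simp only [hγh]
      rw [Measure.map_add _ _ measurable_snd, Measure.map_smul, Measure.map_smul, hγs0, hγs1]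
    have hc : ∀ k, ∫⁻ z, edist z.1 z.2 ^ p ∂(γh k) =
        2⁻¹ * MK p (μ k) ν0 ^ p + 2⁻¹ * MK p (μ k) ν1 ^ p := fun k => by
      simp only [hγh]
      rw [lintegral_add_measure, lintegral_smul_measure, lintegral_smul_measure, hγc0, hγc1]
      simp only [smul_eq_mul]
    have hct : ∀ k, ∫⁻ z, edist z.1 z.2 ^ p ∂(γh k) ≠ ∞ := fun k => by
      rw [hc, hγc0, hγc1]
      exact ENNReal.add_ne_top.2 ⟨ENNReal.mul_ne_top (by simp) (hγt0 k),
        ENNReal.mul_ne_top (by simp) (hγt1 k)⟩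
    have hV : ∑ k, ENNReal.ofReal (lam k) * MK p (μ k) ν1 ^ p =
        ∑ k, ENNReal.ofReal (lam k) * MK p (μ k) ν0 ^ p :=
      le_antisymm (hmin1 ν0 hP0 hM0) (hmin0 ν1 hP1 hM1)
    have htot : ∑ k, ENNReal.ofReal (lam k) * ∫⁻ z, edist z.1 z.2 ^ p ∂(γh k) =
        ∑ k, ENNReal.ofReal (lam k) * MK p (μ k) ν0 ^ p := by
      have : ∀ k, ENNReal.ofReal (lam k) * ∫⁻ z, edist z.1 z.2 ^ p ∂(γh k) =
          2⁻¹ * (ENNReal.ofReal (lam k) * MK p (μ k) ν0 ^ p) +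
          2⁻¹ * (ENNReal.ofReal (lam k) * MK p (μ k) ν1 ^ p) := fun k => by
        rw [hc]; ring
      rw [Finset.sum_congr rfl fun k _ => this k, Finset.sum_add_distrib, ← Finset.mul_sum,
        ← Finset.mul_sum, hV, ← add_mul, hhalf, one_mul]
    have hle : ∑ k, ENNReal.ofReal (lam k) * ∫⁻ z, edist z.1 z.2 ^ p ∂(γh k) ≤
        ∑ k, ENNReal.ofReal (lam k) * MK p (μ k) νh ^ p := by
      rw [htot]; exact hmin0 νh hPh hMh
    have hkey : ∫⁻ z, edist z.1 z.2 ^ p ∂(γh k0) ≤ MK p (μ k0) νh ^ p := by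
      rw [← Finset.add_sum_erase _ _ (Finset.mem_univ k0),
        ← Finset.add_sum_erase (a := k0)
          (f := fun k => ENNReal.ofReal (lam k) * MK p (μ k) νh ^ p) _
          (Finset.mem_univ k0)] at hle
      have hrest : ∑ k ∈ Finset.univ.erase k0, ENNReal.ofReal (lam k) * MK p (μ k) νh ^ p ≤
          ∑ k ∈ Finset.univ.erase k0,
            ENNReal.ofReal (lam k) * ∫⁻ z, edist z.1 z.2 ^ p ∂(γh k) :=
        Finset.sum_le_sum fun k _ => mul_le_mul_right (mk_pow_le hp0 (hf k) (hs k)) _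
      have hrt : ∑ k ∈ Finset.univ.erase k0,
            ENNReal.ofReal (lam k) * ∫⁻ z, edist z.1 z.2 ^ p ∂(γh k) ≠ ∞ :=
        ENNReal.sum_ne_top.2 fun k _ => ENNReal.mul_ne_top ENNReal.ofReal_ne_top (hct k)
      have h1 := (ENNReal.add_le_add_iff_right hrt).1 (hle.trans (add_le_add_right hrest _))
      exact (ENNReal.mul_le_mul_iff_right (ENNReal.ofReal_pos.2 (hlpos k0)).ne'
        ENNReal.ofReal_ne_top).1 h1
    have hPγ : IsProbabilityMeasure (γh k0) := isProb_of_map (hf k0)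
    obtain ⟨G, mG, hinj, hG0⟩ := opt_graph hp (γh k0) (hct k0)
      (fun γ' h1 h2 => hkey.trans (mk_pow_le hp0 (h1.trans (hf k0)) (h2.trans (hs k0))))
      (by rw [hf k0]; exact hac)
    have hG0' : 2⁻¹ * γ0 k0 Gᶜ + 2⁻¹ * γ1 k0 Gᶜ = 0 := by
      simpa [hγh] using hG0
    rw [add_eq_zero] at hG0'
    have z0 : γ0 k0 Gᶜ = 0 := by simpa using hG0'.1
    have z1 : γ1 k0 Gᶜ = 0 := by simpa using hG0'.2
    have := eq_of_graph (γ0 k0) (γ1 k0) G mG hinj z0 z1 ((hγf0 k0).trans (hγf1 k0).symm)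
    rw [← hγs0 k0, ← hγs1 k0, this]
end

section
/- Let (Y,d) be a proper metric space (every closed bounded subset is compact), let K ⊆ Y be compact, and let r > 0. Then there exists N ∈ ℕ, depending only on K and r, such that for every y ∈ K there is a finite set S ⊆ closedBall(y, 5r/4) ∖ ball(y, 3r/4) with card S ≤ N such that the topological frontier of the open ball ball(y,r) is contained in ⋃_{z ∈ S} ball(z, r/2). -/
open Metric

/-- **Covering lemma for boundaries of balls.**
In a proper metric space, for every compact set `K` and `r > 0` there is `N ∈ ℕ`
(depending only on `K` and `r`) such that for every `y ∈ K` the frontier of the open ball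
`ball y r` can be covered by at most `N` balls of radius `r/2` whose centers lie in the
annulus `closedBall y (5r/4) \ ball y (3r/4)`. -/
theorem boundary_covering {Y : Type*} [MetricSpace Y] [ProperSpace Y]
    (K : Set Y) (hK : IsCompact K) (r : ℝ) (hr : 0 < r) :
    ∃ N : ℕ, ∀ y ∈ K, ∃ S : Finset Y,
      (↑S : Set Y) ⊆ closedBall y (5 * r / 4) \ ball y (3 * r / 4) ∧
      S.card ≤ N ∧
      frontier (ball y r) ⊆ ⋃ z ∈ S, ball z (r / 2) := by
  classical
  obtain ⟨t, -, htf, ht⟩ :=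
    finite_cover_balls_of_compact (hK.cthickening (r := r)) (show 0 < r / 4 by linarith)
  refine ⟨htf.toFinset.card, fun y hy => ⟨htf.toFinset.filter
    (fun z => z ∈ closedBall y (5 * r / 4) \ ball y (3 * r / 4)), ?_,
    Finset.card_filter_le _ _, ?_⟩⟩
  · intro z hz
    exact (Finset.mem_filter.1 (Finset.mem_coe.1 hz)).2
  · intro x hx
    have hxy : dist x y = r := frontier_ball_subset_sphere hx
    have hxc := ht (mem_cthickening_of_dist_le x y r K hy hxy.le)
    simp only [Set.mem_iUnion, mem_ball, exists_prop] at hxc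
    obtain ⟨z, hz, hxz⟩ := hxc
    have h1 := dist_triangle x z y
    have h2 := dist_triangle z x y
    rw [dist_comm z x] at h2
    simp only [Set.mem_iUnion, mem_ball, exists_prop, Finset.mem_filter, Set.mem_sdiff,
      mem_closedBall, Set.Finite.mem_toFinset, not_lt]
    exact ⟨z, ⟨hz, by linarith, by linarith⟩, by linarith⟩
end

section
/- Fix d ≥ 1, 1 ≤ p < ∞, λ ∈ (0,1], R > 0, y0 ∈ ℝ^d, and constants C0, C1, C2 > 0. For m ∈ ℕ let g_m : ℝ^d → (−∞,∞] and set f_m(t) := sup_{s ∈ ℝ^d} ( −λ‖t−s‖^p − g_m(s) ); assume |f_m(t)| ≤ C0 for all t in the closed Euclidean ball closedBall(y0,R) and all m. Let (M_ℓ)_{ℓ∈ℕ} be an increasing sequence of positive integers and λ_{ℓ,m} ≥ 0 for ℓ ∈ ℕ, 1 ≤ m ≤ M_ℓ, such that (1/M_ℓ) Σ_{m=1}^{M_ℓ} λ_{ℓ,m} ≤ C1 for all ℓ, and sup_{t ∈ closedBall(y0,R)} (1/M_ℓ) Σ_{m=1}^{M_ℓ} λ_{ℓ,m} |f_m(t)|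 ≤ C2 for all ℓ. Then there exists L ≥ 0 such that for every ℓ the function t ↦ (1/M_ℓ) Σ_{m=1}^{M_ℓ} λ_{ℓ,m} f_m(t) is L-Lipschitz on closedBall(y0, R/4). -/
open Metric

/-- The `λ‖·‖^p`-transform of a function `g : ℝ^d → (-∞,∞]` (encoded as an `EReal`-valued
function): `t ↦ sup_s ( -λ‖t-s‖^p - g(s) )`, with values in the extended reals. -/
noncomputable def eTransform {d : ℕ} (lam p : ℝ) (g : EuclideanSpace ℝ (Fin d) → EReal)
    (t : EuclideanSpace ℝ (Fin d)) : EReal :=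
  ⨆ s : EuclideanSpace ℝ (Fin d), (((-(lam * ‖t - s‖ ^ p)) : ℝ) : EReal) - g s

lemma aux_rpow {p a b B δ : ℝ} (hp : 1 ≤ p) (ha : 0 ≤ a) (hb : 0 ≤ b) (hB : b ≤ B)
    (hδ : 0 ≤ δ) (h : b ≤ a + δ) : b ^ p - a ^ p ≤ p * B ^ (p - 1) * δ := by
  have hB0 : 0 ≤ B := hb.trans hB
  have hr : 0 ≤ p * B ^ (p - 1) := by positivity
  rcases le_total b a with hba | hab
  · have := Real.rpow_le_rpow hb hba (by linarith : 0 ≤ p)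
    have := mul_nonneg hr hδ
    linarith
  · rcases hb.eq_or_lt with h0 | h0
    · have : a = 0 := by linarith
      subst this; subst h0
      have := mul_nonneg hr hδ
      linarith
    · have h1 := one_add_mul_self_le_rpow_one_add (s := a / b - 1)
        (by have := div_nonneg ha hb; linarith) hp
      have e : 1 + (a / b - 1) = a / b := by ring
      rw [e, Real.div_rpow ha hb, le_div_iff₀ (by positivity)] at h1
      have e2 : b ^ p = b ^ (p - 1) * b := by
        rw [← Real.rpow_add_one h0.ne']; congr 1; ring
      have e3 : (1 + p * (a / b - 1)) * b ^ p = b ^ p - p * b ^ (p - 1) * (b - a) := by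
        rw [e2]; field_simp; ring
      rw [e3] at h1
      have h2 : b ^ (p - 1) ≤ B ^ (p - 1) := Real.rpow_le_rpow hb hB (by linarith)
      have h3 : p * b ^ (p - 1) * (b - a) ≤ p * B ^ (p - 1) * δ := by
        apply mul_le_mul _ (by linarith) (by linarith) hr
        exact mul_le_mul_of_nonneg_left h2 (by linarith)
      linarith

lemma aux_rpow2 {p r a : ℝ} (hp : 1 ≤ p) (ha : 0 < a) (hr : a ≤ r) :
    a * r ^ (p - 1) ≤ r ^ p - (r - a) ^ p := by
  have h0 : 0 < r := by linarith
  have e2 : ∀ x : ℝ, 0 ≤ x → x ^ p = x ^ (p - 1) * x := by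
    intro x hx
    rw [← Real.rpow_add_one' hx (by linarith)]; congr 1; ring
  rw [e2 r h0.le, e2 (r - a) (by linarith)]
  have : (r - a) ^ (p - 1) ≤ r ^ (p - 1) :=
    Real.rpow_le_rpow (by linarith) (by linarith) (by linarith)
  have := mul_le_mul_of_nonneg_right this (by linarith : 0 ≤ r - a)
  nlinarith

lemma aux_coe {x : EReal} {C : ℝ} (h1 : -(C : EReal) ≤ x) (h2 : x ≤ (C : EReal)) :
    ((x.toReal : ℝ) : EReal) = x ∧ |x.toReal| ≤ C := by
  induction x using EReal.rec with
  | bot => exact absurd h1 (by rw [← EReal.coe_neg]; simp)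
  | top => exact absurd h2 (by simp)
  | coe x =>
    rw [← EReal.coe_neg] at h1
    refine ⟨by simp, ?_⟩
    rw [EReal.toReal_coe, abs_le]
    exact ⟨by exact_mod_cast h1, by exact_mod_cast h2⟩

lemma aux_ub {d : ℕ} {lam p F c : ℝ} {g : EuclideanSpace ℝ (Fin d) → EReal}
    {t s : EuclideanSpace ℝ (Fin d)} (hF : (F : EReal) = eTransform lam p g t)
    (hs : g s = (c : EReal)) : -(lam * ‖t - s‖ ^ p) - c ≤ F := by
  have h : (((-(lam * ‖t - s‖ ^ p)) : ℝ) : EReal) - g s ≤ eTransform lam p g t :=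
    le_iSup (fun s => (((-(lam * ‖t - s‖ ^ p)) : ℝ) : EReal) - g s) s
  rw [← hF, hs, ← EReal.coe_sub] at h
  exact_mod_cast h

lemma aux_ex {d : ℕ} {lam p F ε : ℝ} {g : EuclideanSpace ℝ (Fin d) → EReal}
    {t : EuclideanSpace ℝ (Fin d)} (hF : (F : EReal) = eTransform lam p g t) (hε : 0 < ε) :
    ∃ s, ∃ c : ℝ, g s = (c : EReal) ∧ F - ε < -(lam * ‖t - s‖ ^ p) - c := by
  have h : ((F - ε : ℝ) : EReal) < eTransform lam p g t := by
    rw [← hF]; exact_mod_cast (by linarith : F - ε < F)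
  obtain ⟨s, hs⟩ := lt_iSup_iff.1 h
  have hle : (((-(lam * ‖t - s‖ ^ p)) : ℝ) : EReal) - g s ≤ eTransform lam p g t :=
    le_iSup (fun s => (((-(lam * ‖t - s‖ ^ p)) : ℝ) : EReal) - g s) s
  rw [← hF] at hle
  refine ⟨s, ?_⟩
  generalize g s = x at hs hle
  induction x using EReal.rec with
  | bot => exact absurd hle (by rw [EReal.coe_sub_bot]; simp)
  | top => exact absurd hs (by rw [EReal.sub_top]; simp)
  | coe c =>
    refine ⟨c, rfl, ?_⟩
    rw [← EReal.coe_sub] at hs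
    exact_mod_cast hs

lemma aux_lip {d : ℕ} {lam p R C0 : ℝ} (hp : 1 ≤ p) (hl : 0 < lam) (hl1 : lam ≤ 1) (hR : 0 < R)
    (hC0 : 0 < C0) (y0 : EuclideanSpace ℝ (Fin d)) (g : EuclideanSpace ℝ (Fin d) → EReal)
    (hbd : ∀ t ∈ closedBall y0 R,
      -(C0 : EReal) ≤ eTransform lam p g t ∧ eTransform lam p g t ≤ (C0 : EReal))
    (t1 : EuclideanSpace ℝ (Fin d)) (ht1 : t1 ∈ closedBall y0 (R / 4))
    (t2 : EuclideanSpace ℝ (Fin d)) (ht2 : t2 ∈ closedBall y0 (R / 4)) :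
    (eTransform lam p g t1).toReal - (eTransform lam p g t2).toReal ≤
      p * (R ^ (p - 1) + 2 ^ (p - 1) * ((2 * C0 + 1) / (lam * (R / 2)))) * dist t1 t2 := by
  have sub : closedBall y0 (R / 4) ⊆ closedBall y0 R := closedBall_subset_closedBall (by linarith)
  have key : ∀ t ∈ closedBall y0 R, _ := fun t ht => aux_coe (hbd t ht).1 (hbd t ht).2
  have hd12 : dist t1 t2 ≤ R / 2 := by
    have := dist_triangle_right t1 t2 y0
    rw [mem_closedBall] at ht1 ht2
    linarith
  set K0 := (2 * C0 + 1) / (lam * (R / 2)) with hK0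
  have hK0p : 0 < K0 := by positivity
  apply le_of_forall_pos_le_add
  intro ε hε
  obtain ⟨s, c, hs, hlt⟩ := aux_ex (key t1 (sub ht1)).1 (lt_min hε one_pos)
  have hm1 := min_le_left ε 1
  have hm2 := min_le_right ε 1
  have hub := aux_ub (key t2 (sub ht2)).1 hs
  have htri : ‖t2 - s‖ ≤ ‖t1 - s‖ + dist t1 t2 := by
    rw [← dist_eq_norm, ← dist_eq_norm]
    have := dist_triangle t2 t1 s
    rw [dist_comm t2 t1] at this
    linarith
  have hBound : ‖t2 - s‖ ^ p - ‖t1 - s‖ ^ p ≤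
      p * (R ^ (p - 1) + 2 ^ (p - 1) * K0) * dist t1 t2 := by
    have hp0 : 0 ≤ p := by linarith
    have hR1 : 0 ≤ R ^ (p - 1) := by positivity
    have hR2 : 0 ≤ (2:ℝ) ^ (p - 1) * K0 := by positivity
    rcases le_total ‖t1 - s‖ (R / 2) with hr | hr
    · refine (aux_rpow hp (norm_nonneg _) (norm_nonneg _) (B := R) (by linarith)
        dist_nonneg htri).trans ?_
      gcongr
      linarith
    · refine (aux_rpow hp (norm_nonneg _) (norm_nonneg _) (B := 2 * ‖t1 - s‖) (by linarith)
        dist_nonneg htri).trans ?_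
      rw [Real.mul_rpow (by norm_num) (norm_nonneg _)]
      have hrK : ‖t1 - s‖ ^ (p - 1) ≤ K0 := by
        have hr0 : 0 < ‖t1 - s‖ := by linarith
        set r := ‖t1 - s‖ with hrdef
        set t' := t1 - ((R / 2) / r) • (t1 - s) with ht'
        have hn : ‖((R / 2) / r) • (t1 - s)‖ = R / 2 := by
          rw [norm_smul, Real.norm_of_nonneg (by positivity), ← hrdef]
          field_simp
        have hmem : t' ∈ closedBall y0 R := by
          rw [mem_closedBall] at ht1 ⊢
          have h1 : dist t' t1 = R / 2 := by
            rw [dist_comm, dist_eq_norm, ht', sub_sub_cancel, hn]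
          have := dist_triangle t' t1 y0
          linarith
        have hnorm : ‖t' - s‖ = r - R / 2 := by
          have : t' - s = (1 - (R / 2) / r) • (t1 - s) := by
            rw [ht', sub_smul, one_smul]; abel
          rw [this, norm_smul, Real.norm_of_nonneg, ← hrdef]
          · field_simp
          · rw [sub_nonneg, div_le_one hr0]; exact hr
        have hub' := aux_ub (key t' hmem).1 hs
        rw [hnorm] at hub'
        have b1 := (abs_le.1 (key t' hmem).2).2
        have b2 := (abs_le.1 (key t1 (sub ht1)).2).1
        have h2 := mul_le_mul_of_nonneg_left (aux_rpow2 hp (by linarith : 0 < R / 2) hr) hl.le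
        rw [hK0, le_div_iff₀ (by positivity)]
        linarith
      gcongr
      have : (2:ℝ) ^ (p - 1) * ‖t1 - s‖ ^ (p - 1) ≤ 2 ^ (p - 1) * K0 := by gcongr
      linarith
  have hQ : 0 ≤ p * (R ^ (p - 1) + 2 ^ (p - 1) * K0) * dist t1 t2 := by positivity
  have h5 : lam * (‖t2 - s‖ ^ p - ‖t1 - s‖ ^ p) ≤
      p * (R ^ (p - 1) + 2 ^ (p - 1) * K0) * dist t1 t2 :=
    (mul_le_mul_of_nonneg_left hBound hl.le).trans (mul_le_of_le_one_left hQ hl1)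
  linarith

/-- **Uniform Lipschitz bound for averages of `λ d^p`-transforms.**
If the transforms `f_m = g_m^{λ‖·‖^p}` are uniformly bounded on `closedBall y0 R` and the
weighted averages `(1/M_ℓ) ∑_{m<M_ℓ} λ_{ℓ,m} |f_m|` are uniformly bounded there, with
`(1/M_ℓ) ∑_{m<M_ℓ} λ_{ℓ,m} ≤ C1`, then the averages `(1/M_ℓ) ∑_{m<M_ℓ} λ_{ℓ,m} f_m` are
uniformly Lipschitz on `closedBall y0 (R/4)`. -/
theorem avg_transform_lipschitz (d : ℕ) (hd : 1 ≤ d) (p : ℝ) (hp : 1 ≤ p)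
    (lam : ℝ) (hlam : lam ∈ Set.Ioc (0 : ℝ) 1) (R : ℝ) (hR : 0 < R)
    (y0 : EuclideanSpace ℝ (Fin d)) (C0 C1 C2 : ℝ) (hC0 : 0 < C0) (hC1 : 0 < C1)
    (hC2 : 0 < C2)
    (g : ℕ → EuclideanSpace ℝ (Fin d) → EReal)
    (hbd : ∀ m, ∀ t ∈ closedBall y0 R,
      -(C0 : EReal) ≤ eTransform lam p (g m) t ∧ eTransform lam p (g m) t ≤ (C0 : EReal))
    (M : ℕ → ℕ) (hM : StrictMono M) (hMpos : ∀ ℓ, 0 < M ℓ)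
    (w : ℕ → ℕ → ℝ) (hw : ∀ ℓ m, 0 ≤ w ℓ m)
    (hsum : ∀ ℓ, (1 / (M ℓ : ℝ)) * ∑ m ∈ Finset.range (M ℓ), w ℓ m ≤ C1)
    (havg : ∀ ℓ, ∀ t ∈ closedBall y0 R,
      (1 / (M ℓ : ℝ)) * ∑ m ∈ Finset.range (M ℓ),
        w ℓ m * |(eTransform lam p (g m) t).toReal| ≤ C2) :
    ∃ L : ℝ, 0 ≤ L ∧ ∀ ℓ, ∀ t1 ∈ closedBall y0 (R / 4), ∀ t2 ∈ closedBall y0 (R / 4),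
      |(1 / (M ℓ : ℝ)) * ∑ m ∈ Finset.range (M ℓ), w ℓ m * (eTransform lam p (g m) t1).toReal -
        (1 / (M ℓ : ℝ)) * ∑ m ∈ Finset.range (M ℓ), w ℓ m * (eTransform lam p (g m) t2).toReal|
        ≤ L * dist t1 t2 := by
  obtain ⟨hl, hl1⟩ := hlam
  set K := p * (R ^ (p - 1) + 2 ^ (p - 1) * ((2 * C0 + 1) / (lam * (R / 2)))) with hK
  have hK0 : 0 ≤ K := by positivity
  refine ⟨C1 * K, by positivity, fun ℓ t1 ht1 t2 ht2 => ?_⟩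
  have hM0 : 0 ≤ 1 / (M ℓ : ℝ) := by positivity
  rw [← mul_sub, ← Finset.sum_sub_distrib, abs_mul, abs_of_nonneg hM0]
  have h1 : |∑ m ∈ Finset.range (M ℓ), (w ℓ m * (eTransform lam p (g m) t1).toReal -
      w ℓ m * (eTransform lam p (g m) t2).toReal)| ≤
      ∑ m ∈ Finset.range (M ℓ), w ℓ m * (K * dist t1 t2) := by
    refine (Finset.abs_sum_le_sum_abs _ _).trans (Finset.sum_le_sum fun m _ => ?_)
    rw [← mul_sub, abs_mul, abs_of_nonneg (hw ℓ m)]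
    refine mul_le_mul_of_nonneg_left (abs_sub_le_iff.2 ⟨?_, ?_⟩) (hw ℓ m)
    · exact aux_lip hp hl hl1 hR hC0 y0 (g m) (hbd m) t1 ht1 t2 ht2
    · rw [dist_comm]
      exact aux_lip hp hl hl1 hR hC0 y0 (g m) (hbd m) t2 ht2 t1 ht1
  refine (mul_le_mul_of_nonneg_left h1 hM0).trans ?_
  rw [← Finset.sum_mul, ← mul_assoc, mul_assoc C1]
  exact mul_le_mul_of_nonneg_right (hsum ℓ) (by positivity)
end

section
/- Fix d ≥ 1, 1 ≤ p < ∞, λ ∈ (0,1], R > 0, and y0 ∈ ℝ^d. Let g : ℝ^d → (−∞,∞] and define f(t) := sup_{s ∈ ℝ^d} ( −λ‖t−s‖^p − g(s) ). If f is bounded (in absolute value) on the closed Euclidean ball closedBall(y0,R), then f is Lipschitz continuous on closedBall(y0, R/4). -/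
open Metric

lemma rpow_upper (p r δ : ℝ) (hp : 1 ≤ p) (hr : 0 ≤ r) (hδ : 0 < δ) :
    (r + δ) ^ p - r ^ p ≤ p * δ * (r + δ) ^ (p - 1) := by
  have hu : 0 < r + δ := by positivity
  have h1 : -1 ≤ -(δ / (r + δ)) := by
    rw [neg_le_neg_iff, div_le_one hu]; linarith
  have h := one_add_mul_self_le_rpow_one_add h1 hp
  have h2 : 1 + -(δ / (r + δ)) = r / (r + δ) := by field_simp; ring
  rw [h2, Real.div_rpow hr hu.le, le_div_iff₀ (by positivity)] at h
  have h3 : (r + δ) ^ p = (r + δ) ^ (p - 1) * (r + δ) := by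
    rw [← Real.rpow_add_one hu.ne']; congr 1; ring
  have h4 : (1 + p * -(δ / (r + δ))) * (r + δ) ^ p
      = (r + δ) ^ p - p * δ * (r + δ) ^ (p - 1) := by
    rw [h3]; field_simp; ring
  linarith

lemma rpow_lower (p r h : ℝ) (hp : 1 ≤ p) (hh : 0 < h) (hr : h ≤ r) :
    h * r ^ (p - 1) ≤ r ^ p - (r - h) ^ p := by
  have hr0 : 0 < r := by linarith
  have e : ∀ x : ℝ, 0 ≤ x → x ^ p = x ^ (p - 1) * x := by
    intro x hx
    have := Real.rpow_add_one' hx (y := p - 1) (by linarith)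
    rw [← this]; congr 1; ring
  rw [e r hr0.le, e (r - h) (by linarith)]
  have : (r - h) ^ (p - 1) ≤ r ^ (p - 1) :=
    Real.rpow_le_rpow (by linarith) (by linarith) (by linarith)
  nlinarith [mul_le_mul_of_nonneg_right this (show 0 ≤ r - h by linarith)]

/-- **A `λ d^p`-transform bounded on a ball is Lipschitz on a smaller ball.**
If `f = g^{λ‖·‖^p}` is bounded in absolute value on `closedBall y0 R`, then `f` is
Lipschitz continuous on `closedBall y0 (R/4)`. -/
theorem transform_bounded_is_lipschitz (d : ℕ) (hd : 1 ≤ d) (p : ℝ) (hp : 1 ≤ p)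
    (lam : ℝ) (hlam : lam ∈ Set.Ioc (0 : ℝ) 1) (R : ℝ) (hR : 0 < R)
    (y0 : EuclideanSpace ℝ (Fin d)) (g : EuclideanSpace ℝ (Fin d) → EReal)
    (hbd : ∃ C : ℝ, ∀ t ∈ closedBall y0 R,
      -(C : EReal) ≤ eTransform lam p g t ∧ eTransform lam p g t ≤ (C : EReal)) :
    ∃ L : ℝ, 0 ≤ L ∧ ∀ t1 ∈ closedBall y0 (R / 4), ∀ t2 ∈ closedBall y0 (R / 4),
      |(eTransform lam p g t1).toReal - (eTransform lam p g t2).toReal| ≤ L * dist t1 t2 := by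
  obtain ⟨C, hC⟩ := hbd
  obtain ⟨hl0, hl1⟩ := hlam
  have hreal : ∀ t ∈ closedBall y0 R, ((eTransform lam p g t).toReal : EReal) = eTransform lam p g t := by
    intro t ht
    obtain ⟨h1, h2⟩ := hC t ht
    apply EReal.coe_toReal
    · intro h; rw [h] at h2; exact absurd h2 (by simp)
    · intro h; rw [h] at h1; rw [← EReal.coe_neg] at h1; exact absurd h1 (by simp)
  have hbnd : ∀ t ∈ closedBall y0 R, -C ≤ (eTransform lam p g t).toReal ∧
      (eTransform lam p g t).toReal ≤ C := by
    intro t ht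
    have h := hC t ht
    rw [← hreal t ht] at h
    exact_mod_cast h
  have hle : ∀ t ∈ closedBall y0 R, ∀ s, ∀ x : ℝ, g s = x →
      -(lam * ‖t - s‖ ^ p) - x ≤ (eTransform lam p g t).toReal := by
    intro t ht s x hx
    have h : (((-(lam * ‖t - s‖ ^ p)) : ℝ) : EReal) - g s ≤ eTransform lam p g t :=
      le_iSup (fun s => (((-(lam * ‖t - s‖ ^ p)) : ℝ) : EReal) - g s) s
    rw [hx, ← hreal t ht] at h
    exact_mod_cast h
  have hex : ∀ t ∈ closedBall y0 R, ∀ ε : ℝ, 0 < ε → ∃ s, ∃ x : ℝ, g s = x ∧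
      (eTransform lam p g t).toReal - ε < -(lam * ‖t - s‖ ^ p) - x := by
    intro t ht ε hε
    have h : (((eTransform lam p g t).toReal - ε : ℝ) : EReal) < eTransform lam p g t := by
      conv_rhs => rw [← hreal t ht]
      exact_mod_cast (by linarith)
    obtain ⟨s, hs⟩ := lt_iSup_iff.1 h
    have hs2 : (((-(lam * ‖t - s‖ ^ p)) : ℝ) : EReal) - g s ≤ eTransform lam p g t :=
      le_iSup (fun s => (((-(lam * ‖t - s‖ ^ p)) : ℝ) : EReal) - g s) s
    rw [← hreal t ht] at hs2
    cases hg : g s with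
    | bot => rw [hg, EReal.coe_sub_bot] at hs2; exact absurd hs2 (by simp)
    | top => rw [hg] at hs; exact absurd hs (by simp)
    | coe x =>
      refine ⟨s, x, hg, ?_⟩
      rw [hg] at hs
      exact_mod_cast hs
  have hC0 : 0 ≤ C := by
    have := hbnd y0 (mem_closedBall_self hR.le)
    linarith
  set h : ℝ := R / 2 with hh
  have hh0 : 0 < h := by positivity
  set K : ℝ := (2 * C + 1) / h + h ^ (p - 1) with hK
  have hK0 : 0 ≤ K := by positivity
  set L : ℝ := p * 2 ^ (p - 1) * K with hL
  have hL0 : 0 ≤ L := by positivity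
  have hsub : ∀ t ∈ closedBall y0 (R / 4), t ∈ closedBall y0 R := fun t ht =>
    closedBall_subset_closedBall (by linarith) ht
  have key : ∀ t1 ∈ closedBall y0 (R / 4), ∀ t2 ∈ closedBall y0 (R / 4),
      (eTransform lam p g t1).toReal ≤ (eTransform lam p g t2).toReal + L * dist t1 t2 := by
    intro t1 ht1 t2 ht2
    rcases eq_or_ne t1 t2 with rfl | hne
    · simp
    have hδ : 0 < dist t1 t2 := dist_pos.2 hne
    have hδh : dist t1 t2 ≤ h := by
      have := dist_triangle_right t1 t2 y0
      rw [mem_closedBall] at ht1 ht2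
      linarith
    apply le_of_forall_pos_le_add
    intro ε' hε'
    obtain ⟨s, x, hx, hs⟩ := hex t1 (hsub t1 ht1) (min ε' 1) (by positivity)
    have hm1 := min_le_left ε' 1
    have hm2 := min_le_right ε' 1
    have h2 := hle t2 (hsub t2 ht2) s x hx
    set r := ‖t1 - s‖ with hr
    have hr0 : 0 ≤ r := norm_nonneg _
    set δ := dist t1 t2 with hδd
    have htri : ‖t2 - s‖ ≤ r + δ := by
      have := dist_triangle t2 t1 s
      rw [dist_comm t2 t1, dist_eq_norm t2 s, dist_eq_norm t1 s] at this
      linarith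
    have hM : lam * (max r h) ^ (p - 1) ≤ K := by
      have hA : 0 ≤ (2 * C + 1) / h := by positivity
      have hB : 0 ≤ h ^ (p - 1) := by positivity
      rcases le_total r h with hrh | hrh
      · rw [max_eq_right hrh]
        nlinarith
      · rw [max_eq_left hrh]
        have hrpos : 0 < r := by linarith
        set t' := t1 - (h / r) • (t1 - s) with ht'
        have ht'mem : t' ∈ closedBall y0 R := by
          rw [mem_closedBall] at ht1 ⊢
          have h1 : dist t' t1 = h := by
            rw [dist_eq_norm, ht', sub_sub_cancel_left, norm_neg, norm_smul, ← hr,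
              Real.norm_of_nonneg (by positivity)]
            field_simp
          have := dist_triangle t' t1 y0
          linarith
        have hn : ‖t' - s‖ = r - h := by
          have : t' - s = (1 - h / r) • (t1 - s) := by
            rw [ht', sub_smul, one_smul]; abel
          rw [this, norm_smul, ← hr, Real.norm_of_nonneg]
          · field_simp
          · rw [sub_nonneg, div_le_one hrpos]; exact hrh
        have h3 := hle t' ht'mem s x hx
        rw [hn] at h3
        have h4 := (hbnd t' ht'mem).2
        have h5 := (hbnd t1 (hsub t1 ht1)).1
        have h6 := mul_le_mul_of_nonneg_left (rpow_lower p r h hp hh0 hrh) hl0.le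
        have h7 : lam * r ^ (p - 1) ≤ (2 * C + 1) / h := by
          rw [le_div_iff₀ hh0]
          linarith
        linarith
    have hup : ‖t2 - s‖ ^ p ≤ (r + δ) ^ p :=
      Real.rpow_le_rpow (norm_nonneg _) htri (by linarith)
    have hup2 := rpow_upper p r δ hp hr0 hδ
    have hup3 : (r + δ) ^ (p - 1) ≤ 2 ^ (p - 1) * (max r h) ^ (p - 1) := by
      rw [← Real.mul_rpow (by norm_num) (by positivity)]
      apply Real.rpow_le_rpow (by positivity) _ (by linarith)
      have := le_max_left r h
      have := le_max_right r h
      linarith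
    have hfin : lam * (‖t2 - s‖ ^ p - r ^ p) ≤ L * δ := by
      calc lam * (‖t2 - s‖ ^ p - r ^ p) ≤ lam * (p * δ * (2 ^ (p - 1) * (max r h) ^ (p - 1))) := by
            apply mul_le_mul_of_nonneg_left _ hl0.le
            have := mul_le_mul_of_nonneg_left hup3 (show 0 ≤ p * δ by positivity)
            linarith
        _ = (p * 2 ^ (p - 1) * δ) * (lam * (max r h) ^ (p - 1)) := by ring
        _ ≤ (p * 2 ^ (p - 1) * δ) * K := mul_le_mul_of_nonneg_left hM (by positivity)
        _ = L * δ := by rw [hL]; ring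
    linarith
  refine ⟨L, hL0, fun t1 ht1 t2 ht2 => ?_⟩
  have a := key t1 ht1 t2 ht2
  have b := key t2 ht2 t1 ht1
  rw [dist_comm t2 t1] at b
  rw [abs_le]
  constructor <;> linarith
end

section
/- Let K ≥ 2 be an even integer, let ν0 be the restriction of one-dimensional Lebesgue measure to the interval [−2,−1] and ν1 its restriction to [1,2] (both Borel probability measures on ℝ belonging to 𝒫_1(ℝ)). For 1 ≤ k ≤ K set μ_k := ν0 if k is even and μ_k := ν1 if k is odd. Then for every ν ∈ 𝒫_1(ℝ) one has (1/K) Σ_{k=1}^K MK_1(μ_k, ν) ≥ 3/2, and equality holds both for ν = ν0 and for ν = ν1. In particular both ν0 and ν1 minimize ν ↦ (1/K) Σ_{k=1}^K MK_1(μ_k, ν) over 𝒫_1(ℝ), so MK_1-barycenters with equal weights need not be unique. -/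
open MeasureTheory ENNReal

lemma aux_sum (a b : ℝ≥0∞) (m : ℕ) :
    ∑ k ∈ Finset.Icc 1 (m + m), (if Even k then a else b) = m * (a + b) := by
  induction m with
  | zero => simp
  | succ n ih =>
    have h : n + 1 + (n + 1) = (n + n + 1) + 1 := by ring
    rw [h, Finset.sum_Icc_succ_top (by omega), Finset.sum_Icc_succ_top (by omega), ih]
    have h1 : ¬ Even (n + n + 1) := by
      rw [Nat.even_add_one]; simp
    have h2 : Even (n + n + 1 + 1) := by
      rw [Nat.even_add_one]; exact h1
    rw [if_neg h1, if_pos h2]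
    push_cast
    ring

lemma aux_avg (K : ℕ) (hK : 2 ≤ K) (hKeven : Even K) (a b : ℝ≥0∞) :
    (K : ℝ≥0∞)⁻¹ * ∑ k ∈ Finset.Icc 1 K, (if Even k then a else b) = (a + b) / 2 := by
  obtain ⟨m, rfl⟩ := hKeven
  rw [aux_sum]
  have hm : (m : ℝ≥0∞) ≠ 0 := by
    have : m ≠ 0 := by omega
    exact_mod_cast this
  have hm' : (m : ℝ≥0∞) ≠ ∞ := ENNReal.natCast_ne_top m
  have h2 : ((m + m : ℕ) : ℝ≥0∞) = m * 2 := by push_cast; ring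
  rw [h2, ENNReal.mul_inv (Or.inl hm) (Or.inl hm'), div_eq_mul_inv]
  calc (m : ℝ≥0∞)⁻¹ * 2⁻¹ * (m * (a + b)) = ((m : ℝ≥0∞)⁻¹ * m) * ((a + b) * 2⁻¹) := by ring
    _ = _ := by rw [ENNReal.inv_mul_cancel hm hm', one_mul]

lemma aux_upper (μ ν : Measure ℝ) [IsProbabilityMeasure μ] (T : ℝ → ℝ) (hT : Measurable T)
    (c : ℝ≥0∞) (hν : μ.map T = ν) (hc : ∀ x, edist x (T x) ≤ c) : MK 1 μ ν ≤ c := by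
  have hp : Measurable (fun x => (x, T x)) := measurable_id.prodMk hT
  refine (iInf₂_le (μ.map (fun x => (x, T x))) ⟨?_, ?_⟩).trans ?_
  · simp only [ENNReal.rpow_one, div_one]
    rw [lintegral_map (by fun_prop) hp]
    calc ∫⁻ x, edist x (T x) ∂μ ≤ ∫⁻ _, c ∂μ := lintegral_mono hc
      _ = c := by simp
  · rw [Measure.map_map measurable_fst hp]
    exact Measure.map_id
  · rw [Measure.map_map measurable_snd hp]
    exact hν

lemma aux_lower (μ ν : Measure ℝ) (f g h : ℝ → ℝ≥0∞) (hf : Measurable f)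
    (hg : Measurable g) (hh : Measurable h)
    (H : ∀ᵐ x ∂μ, ∀ y, f x + g y ≤ edist x y + h y) :
    ∫⁻ x, f x ∂μ + ∫⁻ y, g y ∂ν ≤ MK 1 μ ν + ∫⁻ y, h y ∂ν := by
  unfold MK
  simp only [ENNReal.rpow_one, div_one]
  rw [ENNReal.iInf_add]
  refine le_iInf fun γ => ?_
  rw [ENNReal.iInf_add]
  refine le_iInf fun hγ => ?_
  obtain ⟨h1, h2⟩ := hγ
  subst h1 h2
  rw [lintegral_map hf measurable_fst, lintegral_map hg measurable_snd,
    lintegral_map hh measurable_snd, ← lintegral_add_left (by fun_prop),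
    ← lintegral_add_left (by fun_prop)]
  refine lintegral_mono_ae ?_
  filter_upwards [ae_of_ae_map measurable_fst.aemeasurable H] with z hz
  exact hz z.2

lemma aux_mean1 : ∫⁻ x in Set.Icc (1 : ℝ) 2, ENNReal.ofReal x = 3 / 2 := by
  rw [← ofReal_integral_eq_lintegral_ofReal]
  · rw [integral_Icc_eq_integral_Ioc, ← intervalIntegral.integral_of_le (by norm_num),
      integral_id]
    rw [show ((2 : ℝ) ^ 2 - 1 ^ 2) / 2 = 3 / 2 by norm_num,
      ENNReal.ofReal_div_of_pos (by norm_num)]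
    norm_num
  · exact continuous_id.integrableOn_Icc
  · filter_upwards [ae_restrict_mem measurableSet_Icc] with x hx
    exact le_trans zero_le_one hx.1

lemma aux_mean0 : ∫⁻ x in Set.Icc (-2 : ℝ) (-1), ENNReal.ofReal (-x) = 3 / 2 := by
  rw [← ofReal_integral_eq_lintegral_ofReal]
  · rw [integral_Icc_eq_integral_Ioc, ← intervalIntegral.integral_of_le (by norm_num),
      intervalIntegral.integral_neg, integral_id]
    rw [show -(((-1 : ℝ) ^ 2 - (-2) ^ 2) / 2) = 3 / 2 by norm_num,
      ENNReal.ofReal_div_of_pos (by norm_num)]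
    norm_num
  · exact continuous_neg.integrableOn_Icc
  · filter_upwards [ae_restrict_mem measurableSet_Icc] with x hx
    have := hx.2
    simp only [Pi.zero_apply]
    linarith

lemma aux_pt1 (x y : ℝ) (hx : 0 ≤ x) :
    ENNReal.ofReal x + ENNReal.ofReal (-y) ≤ edist x y + ENNReal.ofReal y := by
  rw [edist_dist, Real.dist_eq]
  rcases le_total 0 y with h | h
  · rw [ENNReal.ofReal_of_nonpos (by linarith : -y ≤ 0), add_zero,
      ← ENNReal.ofReal_add (abs_nonneg _) h]
    exact ENNReal.ofReal_le_ofReal (by linarith [le_abs_self (x - y)])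
  · rw [ENNReal.ofReal_of_nonpos h, add_zero, ← ENNReal.ofReal_add hx (by linarith)]
    exact ENNReal.ofReal_le_ofReal (by linarith [le_abs_self (x - y)])

lemma aux_pt0 (x y : ℝ) (hx : x ≤ 0) :
    ENNReal.ofReal (-x) + ENNReal.ofReal y ≤ edist x y + ENNReal.ofReal (-y) := by
  have h := aux_pt1 (-x) (-y) (by linarith)
  rwa [neg_neg, edist_neg_neg] at h

lemma aux_main (ν : Measure ℝ) (hν : FiniteMoment 1 (0 : ℝ) ν) :
    3 ≤ MK 1 ((volume : Measure ℝ).restrict (Set.Icc (-2 : ℝ) (-1))) ν +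
      MK 1 ((volume : Measure ℝ).restrict (Set.Icc (1 : ℝ) 2)) ν := by
  have fin : ∀ f : ℝ → ℝ, (∀ y, f y ≤ |y|) → ∫⁻ y, ENNReal.ofReal (f y) ∂ν ≠ ∞ := by
    intro f hf
    refine ne_top_of_le_ne_top hν (lintegral_mono fun y => ?_)
    rw [ENNReal.rpow_one, edist_dist, Real.dist_eq, zero_sub, abs_neg]
    exact ENNReal.ofReal_le_ofReal (hf y)
  have hP := fin (fun y => y) le_abs_self
  have hN := fin (fun y => -y) neg_le_abs
  have e1 := aux_lower ((volume : Measure ℝ).restrict (Set.Icc (1 : ℝ) 2)) ν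
    (fun x => ENNReal.ofReal x) (fun y => ENNReal.ofReal (-y)) (fun y => ENNReal.ofReal y)
    (by fun_prop) (by fun_prop) (by fun_prop) (by
      filter_upwards [ae_restrict_mem measurableSet_Icc] with x hx y
      exact aux_pt1 x y (le_trans zero_le_one hx.1))
  have e0 := aux_lower ((volume : Measure ℝ).restrict (Set.Icc (-2 : ℝ) (-1))) ν
    (fun x => ENNReal.ofReal (-x)) (fun y => ENNReal.ofReal y) (fun y => ENNReal.ofReal (-y))
    (by fun_prop) (by fun_prop) (by fun_prop) (by
      filter_upwards [ae_restrict_mem measurableSet_Icc] with x hx y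
      have := hx.2
      exact aux_pt0 x y (by linarith))
  rw [aux_mean1] at e1
  rw [aux_mean0] at e0
  have e := add_le_add e0 e1
  generalize (∫⁻ y, ENNReal.ofReal y ∂ν) = P at *
  generalize (∫⁻ y, ENNReal.ofReal (-y) ∂ν) = N at *
  have h3 : (3 / 2 + 3 / 2 : ℝ≥0∞) = 3 := ENNReal.add_halves 3
  refine (ENNReal.add_le_add_iff_right (ENNReal.add_ne_top.2 ⟨hP, hN⟩)).1 ?_
  calc 3 + (P + N) = 3 / 2 + P + (3 / 2 + N) := by
        rw [add_add_add_comm, h3]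
    _ ≤ _ := e
    _ = _ := by ring

lemma aux_moment (a b c : ℝ) (h : ∀ x ∈ Set.Icc a b, |x| ≤ c) :
    FiniteMoment 1 (0 : ℝ) ((volume : Measure ℝ).restrict (Set.Icc a b)) := by
  have h' : ∫⁻ x in Set.Icc a b, edist (0 : ℝ) x ^ (1 : ℝ) ≤
      ∫⁻ _ in Set.Icc a b, ENNReal.ofReal c := by
    refine setLIntegral_mono' measurableSet_Icc fun x hx => ?_
    rw [ENNReal.rpow_one, edist_dist, Real.dist_eq, zero_sub, abs_neg]
    exact ENNReal.ofReal_le_ofReal (h x hx)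
  refine ne_top_of_le_ne_top ?_ h'
  rw [setLIntegral_const, Real.volume_Icc]
  exact ENNReal.mul_ne_top ENNReal.ofReal_ne_top ENNReal.ofReal_ne_top

lemma aux_map (a b c : ℝ) :
    ((volume : Measure ℝ).restrict (Set.Icc a b)).map (fun x => x + c) =
      (volume : Measure ℝ).restrict (Set.Icc (a + c) (b + c)) := by
  have h := ((measurePreserving_add_right (volume : Measure ℝ) c).restrict_preimage
    (measurableSet_Icc (a := a + c) (b := b + c))).map_eq
  simpa using h

/-- **Non-uniqueness of `MK_1`-barycenters with equal weights.**
Let `K ≥ 2` be even, `ν0` Lebesgue measure restricted to `[-2,-1]`, `ν1` Lebesgue measure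
restricted to `[1,2]`, and `μ_k = ν0` for even `k`, `μ_k = ν1` for odd `k` (`1 ≤ k ≤ K`).
Then `(1/K) ∑_k MK_1(μ_k, ν) ≥ 3/2` for every `ν ∈ 𝒫_1(ℝ)`, with equality both at
`ν = ν0` and at `ν = ν1`; hence both `ν0` and `ν1` are `MK_1`-barycenters. -/
theorem mk_one_barycenter_nonunique (K : ℕ) (hK : 2 ≤ K) (hKeven : Even K)
    (ν0 ν1 : Measure ℝ)
    (hν0 : ν0 = (volume : Measure ℝ).restrict (Set.Icc (-2 : ℝ) (-1)))
    (hν1 : ν1 = (volume : Measure ℝ).restrict (Set.Icc (1 : ℝ) 2))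
    (μ : ℕ → Measure ℝ) (hμ : ∀ k, μ k = if Even k then ν0 else ν1) :
    (∀ ν : Measure ℝ, IsProbabilityMeasure ν → FiniteMoment 1 (0 : ℝ) ν →
        (3 / 2 : ℝ≥0∞) ≤ (K : ℝ≥0∞)⁻¹ * ∑ k ∈ Finset.Icc 1 K, MK 1 (μ k) ν) ∧
      (K : ℝ≥0∞)⁻¹ * ∑ k ∈ Finset.Icc 1 K, MK 1 (μ k) ν0 = 3 / 2 ∧
      (K : ℝ≥0∞)⁻¹ * ∑ k ∈ Finset.Icc 1 K, MK 1 (μ k) ν1 = 3 / 2 := by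
  have p0 : IsProbabilityMeasure ν0 := ⟨by rw [hν0]; simp; norm_num⟩
  have p1 : IsProbabilityMeasure ν1 := ⟨by rw [hν1]; simp; norm_num⟩
  have key : ∀ ν : Measure ℝ, (K : ℝ≥0∞)⁻¹ * ∑ k ∈ Finset.Icc 1 K, MK 1 (μ k) ν =
      (MK 1 ν0 ν + MK 1 ν1 ν) / 2 := by
    intro ν
    rw [← aux_avg K hK hKeven]
    congr 1
    refine Finset.sum_congr rfl fun k _ => ?_
    rw [hμ k]
    split_ifs <;> rfl
  have low : ∀ ν : Measure ℝ, FiniteMoment 1 (0 : ℝ) ν → 3 ≤ MK 1 ν0 ν + MK 1 ν1 ν := by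
    intro ν h
    rw [hν0, hν1]
    exact aux_main ν h
  have self : ∀ ν : Measure ℝ, IsProbabilityMeasure ν → MK 1 ν ν = 0 := by
    intro ν _
    refine le_antisymm (aux_upper ν ν id measurable_id 0 Measure.map_id fun x => ?_) bot_le
    simp
  have u01 : MK 1 ν0 ν1 ≤ 3 := by
    refine aux_upper ν0 ν1 (fun x => x + 3) (by fun_prop) 3 ?_ fun x => ?_
    · rw [hν0, hν1, aux_map]; norm_num
    · rw [edist_dist, Real.dist_eq]; norm_num
  have u10 : MK 1 ν1 ν0 ≤ 3 := by
    refine aux_upper ν1 ν0 (fun x => x + (-3)) (by fun_prop) 3 ?_ fun x => ?_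
    · rw [hν0, hν1, aux_map]; norm_num
    · rw [edist_dist, Real.dist_eq]; norm_num
  have m0 : FiniteMoment 1 (0 : ℝ) ν0 := by
    rw [hν0]
    refine aux_moment _ _ 2 fun x hx => abs_le.2 ⟨hx.1, ?_⟩
    have := hx.2
    linarith
  have m1 : FiniteMoment 1 (0 : ℝ) ν1 := by
    rw [hν1]
    refine aux_moment _ _ 2 fun x hx => abs_le.2 ⟨?_, hx.2⟩
    have := hx.1
    linarith
  refine ⟨fun ν _ h => ?_, ?_, ?_⟩
  · rw [key]
    exact ENNReal.div_le_div_right (low ν h) 2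
  · rw [key]
    congr 1
    refine le_antisymm ?_ (low ν0 m0)
    rw [self ν0 p0, zero_add]; exact u10
  · rw [key]
    congr 1
    refine le_antisymm ?_ (low ν1 m1)
    rw [self ν1 p1, add_zero]; exact u01
end

section
/- Let (Ω,d_Ω) be a complete, separable, locally compact metric space, let (Y,d_Y) be a complete, separable metric space satisfying the Heine–Borel property (every closed bounded subset is compact), let σ be a Borel probability measure on Ω, and fix y0 ∈ Y. Fix 1 ≤ p < ∞, p ≤ q ≤ ∞, κ > 0, an integer K ≥ 2, weights λ_1,…,λ_K ∈ (0,1) with Σ_k λ_k = 1, and m_1,…,m_K ∈ 𝒫^σ_{p,q}(Ω×Y). Then the function n ↦ Σ_{k=1}^K λ_k scrMK_{p,q}(m_k, n)^κ attains its infimum over 𝒫^σ_{p,q}(Ω×Y). -/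
open MeasureTheory ProbabilityTheory ENNReal

/-- The disintegrated `(p,q)`-Monge–Kantorovich distance on the trivial bundle `Ω × Y`,
expressed in terms of the fiberwise disintegrations (Markov kernels) `κ`, `η` of the two
measures: the `L^q(σ)`-norm of `ω ↦ MK_p(κ ω, η ω)`. -/
noncomputable def scrMK {Ω Y : Type*} [MeasurableSpace Ω] [PseudoEMetricSpace Y]
    [MeasurableSpace Y] (p : ℝ) (q : ℝ≥0∞) (σ : Measure Ω) (κ η : Kernel Ω Y) : ℝ≥0∞ :=
  if q = ∞ then essSup (fun ω => MK p (κ ω) (η ω)) σ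
  else (∫⁻ ω, MK p (κ ω) (η ω) ^ q.toReal ∂σ) ^ (1 / q.toReal)

/-- Membership in `𝒫^σ_{p,q}(Ω × Y)`, with a measure on `Ω × Y` with first marginal `σ`
encoded by its disintegration: a Markov kernel `κ : Ω → 𝒫(Y)` such that the disintegrated
`(p,q)`-distance to the fiberwise Dirac measure `σ ⊗ δ_{y0}` is finite. -/
def MemP {Ω Y : Type*} [MeasurableSpace Ω] [PseudoEMetricSpace Y] [MeasurableSpace Y]
    (p : ℝ) (q : ℝ≥0∞) (σ : Measure Ω) (y0 : Y) (κ : Kernel Ω Y) : Prop :=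
  IsMarkovKernel κ ∧ scrMK p q σ (Kernel.const Ω (Measure.dirac y0)) κ ≠ ∞


open Filter Topology
open scoped NNReal BoundedContinuousFunction

/-- A countable family of bounded continuous functions determining weak convergence. -/
theorem exists_conv_family (Y : Type*) [MetricSpace Y] [SecondCountableTopology Y]
    [MeasurableSpace Y] [BorelSpace Y] :
    ∃ f : ℕ → (Y →ᵇ ℝ≥0), (∀ i y, f i y ≤ 1) ∧
      ∀ {ι : Type _} (L : Filter ι) [L.IsCountablyGenerated] (μs : ι → ProbabilityMeasure Y)
        (μ : ProbabilityMeasure Y),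
        (∀ i, Tendsto (fun n => ∫⁻ y, (f i y : ℝ≥0∞) ∂(μs n : Measure Y)) L
          (𝓝 (∫⁻ y, (f i y : ℝ≥0∞) ∂(μ : Measure Y)))) → Tendsto μs L (𝓝 μ) := by
  classical
  obtain ⟨B, hBo, hB⟩ : ∃ B : ℕ → Set Y, (∀ n, IsOpen (B n)) ∧
      ∀ (U : Set Y), IsOpen U → ∀ y ∈ U, ∃ n, y ∈ B n ∧ B n ⊆ U := by
    have hb := TopologicalSpace.isBasis_countableBasis Y
    have hc : (insert ∅ (TopologicalSpace.countableBasis Y)).Countable :=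
      (TopologicalSpace.countable_countableBasis Y).insert _
    obtain ⟨B, hB⟩ := hc.exists_eq_range (Set.insert_nonempty _ _)
    refine ⟨B, fun n => ?_, fun U hU y hy => ?_⟩
    · have : B n ∈ insert ∅ (TopologicalSpace.countableBasis Y) := hB ▸ Set.mem_range_self n
      rcases this with h | h
      · rw [h]; exact isOpen_empty
      · exact hb.isOpen h
    · obtain ⟨V, hV, hyV, hVU⟩ := hb.exists_subset_of_mem_open hy hU
      have : V ∈ Set.range B := hB ▸ Set.mem_insert_of_mem _ hV
      obtain ⟨n, rfl⟩ := this
      exact ⟨n, hyV, hVU⟩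
  let C : Finset ℕ → Set Y := fun s => (⋃ j ∈ s, B j)ᶜ
  have hC : ∀ s, IsClosed (C s) := fun s =>
    (isOpen_biUnion fun j _ => hBo j).isClosed_compl
  let g : Finset ℕ × ℕ → (Y →ᵇ ℝ≥0) := fun a => (hC a.1).apprSeq a.2
  obtain ⟨e⟩ : Nonempty (ℕ ≃ Finset ℕ × ℕ) := ⟨(Denumerable.eqv _).symm⟩
  refine ⟨fun i => g (e i), fun i y => HasOuterApproxClosed.apprSeq_apply_le_one _ _ _, ?_⟩
  intro ι L _ μs μ h
  have h' : ∀ a, Tendsto (fun n => ∫⁻ y, (g a y : ℝ≥0∞) ∂(μs n : Measure Y)) L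
          (𝓝 (∫⁻ y, (g a y : ℝ≥0∞) ∂(μ : Measure Y))) := by
    intro a; simpa using h (e.symm a)
  rcases L.eq_or_neBot with rfl | hne
  · exact tendsto_bot
  apply tendsto_of_forall_isClosed_limsup_le'
  intro F hF
  have key : ∀ s, F ⊆ C s →
      limsup (fun i ↦ (μs i : Measure Y) F) L ≤ (μ : Measure Y) (C s) := by
    intro s hs
    refine ge_of_tendsto' (HasOuterApproxClosed.tendsto_lintegral_apprSeq (hC s) (μ : Measure Y)) ?_
    intro m
    rw [← (h' (s, m)).limsup_eq]
    refine limsup_le_limsup (Eventually.of_forall fun i => ?_)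
    exact (measure_mono hs).trans (HasOuterApproxClosed.measure_le_lintegral (hC s) _ m)
  let s : ℕ → Finset ℕ := fun N => (Finset.range N).filter (fun j => B j ⊆ Fᶜ)
  have hs : ∀ N, F ⊆ C (s N) := by
    intro N y hy
    simp only [C, s, Set.mem_compl_iff, Set.mem_iUnion, Finset.mem_filter, not_exists]
    rintro j ⟨_, hj⟩ hyj
    exact hj hyj hy
  have hanti : Antitone (fun N => C (s N)) := by
    intro N M hNM
    apply Set.compl_subset_compl.2
    apply Set.biUnion_subset_biUnion_left
    intro j hj
    simp only [s, Finset.coe_filter, Finset.mem_range, Set.mem_ofPred_eq] at hj ⊢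
    exact ⟨hj.1.trans_le hNM, hj.2⟩
  have hint : ⋂ N, C (s N) = F := by
    apply Set.Subset.antisymm _ (Set.subset_iInter hs)
    intro y hy
    by_contra hyF
    obtain ⟨n, hyn, hn⟩ := hB Fᶜ hF.isOpen_compl y hyF
    have := Set.mem_iInter.1 hy (n+1)
    apply this
    simp only [Set.mem_iUnion]
    exact ⟨n, by simp [s, hn], hyn⟩
  have := tendsto_measure_iInter_atTop (μ := (μ : Measure Y))
    (fun N => (hC (s N)).measurableSet.nullMeasurableSet) hanti ⟨0, measure_ne_top _ _⟩
  rw [hint] at this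
  exact ge_of_tendsto' this fun N => key _ (hs N)

/-- Evaluation of a probability measure on a family of test functions. -/
noncomputable def evalMap {Y : Type*} [TopologicalSpace Y] [MeasurableSpace Y]
    (f : ℕ → (Y →ᵇ ℝ≥0)) (μ : ProbabilityMeasure Y) : ℕ → ℝ≥0∞ :=
  fun i => ∫⁻ y, (f i y : ℝ≥0∞) ∂(μ : Measure Y)

theorem exists_embedding (Y : Type*) [MetricSpace Y] [SecondCountableTopology Y]
    [MeasurableSpace Y] [BorelSpace Y] :
    ∃ f : ℕ → (Y →ᵇ ℝ≥0), (∀ i y, f i y ≤ 1) ∧ IsEmbedding (evalMap f) := by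
  obtain ⟨f, hf1, hf⟩ := exists_conv_family Y
  have hcont : Continuous (evalMap f) := continuous_pi fun i =>
    ProbabilityMeasure.continuous_iff_forall_continuous_lintegral.1 continuous_id (f i)
  have hind : IsInducing (evalMap f) := by
    rw [isInducing_iff_nhds]
    intro μ
    apply le_antisymm
    · exact hcont.continuousAt.le_comap
    · have := hf (comap (evalMap f) (𝓝 (evalMap f μ))) id μ (fun i => by
        have h1 : Tendsto (evalMap f) (comap (evalMap f) (𝓝 (evalMap f μ))) (𝓝 (evalMap f μ)) :=
          tendsto_comap
        exact (tendsto_pi_nhds.1 h1) i)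
      simpa [Tendsto] using this
  exact ⟨f, hf1, hind.isEmbedding⟩

theorem secondCountable_prob (Y : Type*) [MetricSpace Y] [SecondCountableTopology Y]
    [MeasurableSpace Y] [BorelSpace Y] : SecondCountableTopology (ProbabilityMeasure Y) := by
  obtain ⟨f, hf1, hf⟩ := exists_embedding Y
  exact hf.isInducing.secondCountableTopology

theorem measurable_evalMap {Y : Type*} [MetricSpace Y] [SecondCountableTopology Y]
    [MeasurableSpace Y] [BorelSpace Y] (f : ℕ → (Y →ᵇ ℝ≥0)) : Measurable (evalMap f) := by
  refine measurable_pi_lambda _ fun i => ?_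
  have : Measurable (fun μ : Measure Y => ∫⁻ y, (f i y : ℝ≥0∞) ∂μ) :=
    Measure.measurable_lintegral (by fun_prop)
  exact this.comp measurable_subtype_coe

theorem borelSpace_prob (Y : Type*) [MetricSpace Y] [SecondCountableTopology Y]
    [MeasurableSpace Y] [BorelSpace Y] : BorelSpace (ProbabilityMeasure Y) := by
  obtain ⟨f, hf1, hf⟩ := exists_embedding Y
  constructor
  apply le_antisymm
  · have key : Measurable[borel (ProbabilityMeasure Y)]
        (fun μ : ProbabilityMeasure Y => (μ : Measure Y)) := by
      let _ : MeasurableSpace (ProbabilityMeasure Y) := borel _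
      have : BorelSpace (ProbabilityMeasure Y) := ⟨rfl⟩
      refine Measurable.measure_of_isPiSystem_of_isProbabilityMeasure
        (S := {s | IsClosed s}) ?_ isPiSystem_isClosed ?_
      · rw [BorelSpace.measurable_eq (α := Y), borel_eq_generateFrom_isClosed]
      · intro F hF
        refine measurable_of_tendsto_metrizable (f := fun n (μ : ProbabilityMeasure Y) =>
          ∫⁻ y, (IsClosed.apprSeq hF n y : ℝ≥0∞) ∂(μ : Measure Y)) (fun n => ?_) ?_
        · exact (ProbabilityMeasure.continuous_iff_forall_continuous_lintegral.1 continuous_id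
            (IsClosed.apprSeq hF n)).measurable
        · rw [tendsto_pi_nhds]
          intro μ
          exact HasOuterApproxClosed.tendsto_lintegral_apprSeq hF _
    exact measurable_iff_comap_le.1 key
  · have h1 : Measurable (evalMap f) := measurable_evalMap f
    have h2 := borel_comap (f := evalMap f) (t := inferInstance)
    rw [← hf.isInducing.eq_induced, ← BorelSpace.measurable_eq (α := ℕ → ℝ≥0∞)] at h2
    rw [h2]
    exact measurable_iff_comap_le.1 h1

theorem MK_lt_iff {X : Type*} [PseudoEMetricSpace X] [MeasurableSpace X] {p : ℝ}
    (hp : 0 < p) {μ ν : Measure X} {c : ℝ≥0∞} (h : MK p μ ν < c) :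
    ∃ γ : Measure (X × X), γ.map Prod.fst = μ ∧ γ.map Prod.snd = ν ∧
      ∫⁻ z, edist z.1 z.2 ^ p ∂γ < c ^ p := by
  unfold MK at h
  simp only [iInf_lt_iff] at h
  obtain ⟨γ, ⟨h1, h2⟩, h3⟩ := h
  refine ⟨γ, h1, h2, ?_⟩
  have := ENNReal.rpow_lt_rpow h3 hp
  rwa [← ENNReal.rpow_mul, one_div, inv_mul_cancel₀ hp.ne', ENNReal.rpow_one] at this

theorem MK_le_of_coupling {X : Type*} [PseudoEMetricSpace X] [MeasurableSpace X] {p : ℝ}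
    {μ ν : Measure X} (γ : Measure (X × X)) (h1 : γ.map Prod.fst = μ)
    (h2 : γ.map Prod.snd = ν) :
    MK p μ ν ≤ (∫⁻ z, edist z.1 z.2 ^ p ∂γ) ^ (1 / p) :=
  iInf₂_le γ ⟨h1, h2⟩

theorem isProbabilityMeasure_of_fst {X : Type*} [MeasurableSpace X] {γ : Measure (X × X)}
    {μ : Measure X} [IsProbabilityMeasure μ] (h : γ.map Prod.fst = μ) :
    IsProbabilityMeasure γ := by
  constructor
  have : (γ.map Prod.fst) Set.univ = 1 := by rw [h]; exact measure_univ
  rwa [Measure.map_apply measurable_fst MeasurableSet.univ, Set.preimage_univ] at this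

theorem edist_rpow_eq {Y : Type*} [MetricSpace Y] {p : ℝ} (hp : 0 < p) (z : Y × Y) :
    edist z.1 z.2 ^ p = ENNReal.ofReal (dist z.1 z.2 ^ p) := by
  rw [edist_dist, ENNReal.ofReal_rpow_of_nonneg dist_nonneg hp.le]

/-- Compactness and lower semicontinuity of the Monge-Kantorovich distance. -/
theorem MK_compactness {Y : Type*} [MetricSpace Y] [CompleteSpace Y] [SecondCountableTopology Y]
    [ProperSpace Y] [MeasurableSpace Y] [BorelSpace Y] {p : ℝ} (hp : 0 < p)
    {μs νs : ℕ → ProbabilityMeasure Y} {μ : ProbabilityMeasure Y} (hμ : Tendsto μs atTop (𝓝 μ))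
    {c : ℝ≥0∞} (hc : c ≠ ∞)
    (h : ∀ n, MK p (μs n : Measure Y) (νs n : Measure Y) < c) :
    ∃ (ν : ProbabilityMeasure Y) (φ : ℕ → ℕ), StrictMono φ ∧
      Tendsto (fun n => νs (φ n)) atTop (𝓝 ν) ∧ MK p (μ : Measure Y) (ν : Measure Y) ≤ c := by
  choose γ hγ1 hγ2 hγ3 using fun n => MK_lt_iff hp (h n)
  have hγp : ∀ n, IsProbabilityMeasure (γ n) := fun n => isProbabilityMeasure_of_fst (hγ1 n)
  let Γ : ℕ → ProbabilityMeasure (Y × Y) := fun n => ⟨γ n, hγp n⟩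
  have hcp : c ^ p ≠ ∞ := ENNReal.rpow_ne_top_of_nonneg hp.le hc
  have htight1 : IsTightMeasureSet
      {((μ : ProbabilityMeasure Y) : Measure Y) | μ ∈ Set.range μs} := by
    apply isTightMeasureSet_of_isCompact_closure
    have hk := hμ.isCompact_insert_range
    exact hk.of_isClosed_subset isClosed_closure
      (closure_minimal (Set.subset_insert _ _) hk.isClosed)
  have htight : IsTightMeasureSet
      {((μ : ProbabilityMeasure (Y × Y)) : Measure (Y × Y)) | μ ∈ Set.range Γ} := by
    rw [isTightMeasureSet_iff_exists_isCompact_measure_compl_le] at htight1 ⊢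
    intro ε hε
    obtain ⟨K, hK, hKε⟩ := htight1 (ε / 2) (ENNReal.half_pos hε.ne')
    obtain ⟨R, hR0, hR⟩ : ∃ R : ℝ≥0, 0 < R ∧ c ^ p / ((R : ℝ≥0∞) ^ p) ≤ ε / 2 := by
      have ht : Tendsto (fun R : ℝ≥0 => c ^ p / ((R : ℝ≥0∞) ^ p)) atTop (𝓝 0) := by
        apply ENNReal.Tendsto.const_div _ (Or.inr hcp) |>.trans_eq _
        · exact ∞
        · have h1 : Tendsto (fun R : ℝ≥0 => (R : ℝ≥0∞)) atTop (𝓝 ∞) :=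
            ENNReal.tendsto_coe_nhds_top.2 tendsto_id
          have h2 := (ENNReal.continuous_rpow_const (y := p)).tendsto ∞
          rw [ENNReal.top_rpow_of_pos hp] at h2
          exact h2.comp h1
        · simp
      have := (ht.eventually_le_const (ENNReal.half_pos hε.ne')).and (eventually_gt_atTop 0)
      obtain ⟨R, h1, h2⟩ := this.exists
      exact ⟨R, h2, h1⟩
    refine ⟨K ×ˢ Metric.cthickening R K, hK.prod hK.cthickening, ?_⟩
    rintro _ ⟨_, ⟨n, rfl⟩, rfl⟩
    change γ n _ ≤ ε
    have hsub : (K ×ˢ Metric.cthickening R K)ᶜ ⊆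
        (Prod.fst ⁻¹' Kᶜ) ∪ {z : Y × Y | (R : ℝ≥0∞) ^ p ≤ edist z.1 z.2 ^ p} := by
      intro z hz
      by_cases h1 : z.1 ∈ K
      · right
        have h2 : z.2 ∉ Metric.cthickening R K := fun h2 => hz ⟨h1, h2⟩
        rw [Metric.mem_cthickening_iff, not_le] at h2
        have h3 := h2.trans_le (Metric.infEDist_le_edist_of_mem h1)
        rw [ENNReal.ofReal_coe_nnreal, edist_comm] at h3
        exact ENNReal.rpow_le_rpow h3.le hp.le
      · left; exact h1
    have hA : γ n (Prod.fst ⁻¹' Kᶜ) ≤ ε / 2 := by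
      rw [← Measure.map_apply measurable_fst hK.measurableSet.compl, hγ1]
      exact hKε _ ⟨μs n, ⟨n, rfl⟩, rfl⟩
    have hB : γ n {z : Y × Y | (R : ℝ≥0∞) ^ p ≤ edist z.1 z.2 ^ p} ≤ ε / 2 := by
      refine le_trans (meas_ge_le_lintegral_div (f := fun z : Y × Y => edist z.1 z.2 ^ p)
        (by fun_prop) ?_ ?_) (le_trans ?_ hR)
      · simp [ENNReal.rpow_eq_zero_iff, hR0.ne']
      · exact ENNReal.rpow_ne_top_of_nonneg hp.le ENNReal.coe_ne_top
      · exact ENNReal.div_le_div_right (hγ3 n).le _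
    calc γ n _ ≤ _ := measure_mono hsub
      _ ≤ _ := measure_union_le _ _
      _ ≤ ε / 2 + ε / 2 := add_le_add hA hB
      _ = ε := ENNReal.add_halves ε
  have hcomp := isCompact_closure_of_isTightMeasureSet htight
  obtain ⟨G, -, φ, hφ, hG⟩ := hcomp.tendsto_subseq
    (x := Γ) (fun n => subset_closure (Set.mem_range_self n))
  have hfst := ProbabilityMeasure.tendsto_map_of_tendsto_of_continuous _ _ hG
    (continuous_fst (X := Y) (Y := Y))
  have hsnd := ProbabilityMeasure.tendsto_map_of_tendsto_of_continuous _ _ hG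
    (continuous_snd (X := Y) (Y := Y))
  have e1 : ∀ n, ((Γ ∘ φ) n).map continuous_fst.measurable.aemeasurable = μs (φ n) := fun n =>
    Subtype.ext (hγ1 (φ n))
  have e2 : ∀ n, ((Γ ∘ φ) n).map continuous_snd.measurable.aemeasurable = νs (φ n) := fun n =>
    Subtype.ext (hγ2 (φ n))
  simp only [e1, e2] at hfst hsnd
  have e3 := tendsto_nhds_unique hfst (hμ.comp hφ.tendsto_atTop)
  refine ⟨_, φ, hφ, hsnd, ?_⟩
  refine (MK_le_of_coupling (G : Measure (Y × Y)) (by rw [← e3]; rfl) rfl).trans ?_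
  have hlsc := lintegral_le_liminf_lintegral_of_forall_isOpen_measure_le_liminf_measure
    (μ := (G : Measure (Y × Y))) (μs := fun n => γ (φ n)) (f := fun z => dist z.1 z.2 ^ p)
    (by
      have : Continuous fun z : Y × Y => dist z.1 z.2 := continuous_dist
      exact this.rpow_const (fun _ => Or.inr hp.le))
    (fun z => Real.rpow_nonneg dist_nonneg _)
    (fun U hU => ProbabilityMeasure.le_liminf_measure_open_of_tendsto hG hU)
  simp only [← edist_rpow_eq hp] at hlsc
  have h4 : ∫⁻ z, edist z.1 z.2 ^ p ∂(G : Measure (Y × Y)) ≤ c ^ p := by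
    refine hlsc.trans ?_
    refine (liminf_le_liminf (Eventually.of_forall fun n => (hγ3 (φ n)).le)).trans ?_
    simp
  calc _ ≤ (c ^ p) ^ (1 / p) := ENNReal.rpow_le_rpow h4 (by positivity)
    _ = c := by rw [← ENNReal.rpow_mul, mul_one_div_cancel hp.ne', ENNReal.rpow_one]

theorem MK_lsc {Y : Type*} [MetricSpace Y] [CompleteSpace Y] [SecondCountableTopology Y]
    [ProperSpace Y] [MeasurableSpace Y] [BorelSpace Y] {p : ℝ} (hp : 0 < p) :
    LowerSemicontinuous (fun z : ProbabilityMeasure Y × ProbabilityMeasure Y =>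
      MK p (z.1 : Measure Y) (z.2 : Measure Y)) := by
  have := secondCountable_prob Y
  rw [lowerSemicontinuous_iff_isClosed_preimage]
  intro c
  apply IsSeqClosed.isClosed
  intro z z0 hz hz0
  by_cases hc : c = ∞
  · simp [hc]
  apply ENNReal.le_of_forall_pos_le_add
  intro ε hε _
  have h1 : Tendsto (fun n => (z n).1) atTop (𝓝 z0.1) := (continuous_fst.tendsto _).comp hz0
  have h2 : Tendsto (fun n => (z n).2) atTop (𝓝 z0.2) := (continuous_snd.tendsto _).comp hz0
  have hz' : ∀ n, MK p ((z n).1 : Measure Y) ((z n).2 : Measure Y) ≤ c := hz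
  obtain ⟨ν, φ, hφ, hν, hle⟩ := MK_compactness hp h1 (νs := fun n => (z n).2) (c := c + ε)
    (by simp [hc]) (fun n => (hz' n).trans_lt
      (ENNReal.lt_add_right hc (by exact_mod_cast hε.ne')))
  have := tendsto_nhds_unique hν (h2.comp hφ.tendsto_atTop)
  rw [this] at hle; exact hle

theorem measurable_MK {Ω Y : Type*} [MeasurableSpace Ω]
    [MetricSpace Y] [CompleteSpace Y] [SecondCountableTopology Y]
    [ProperSpace Y] [MeasurableSpace Y] [BorelSpace Y] {p : ℝ} (hp : 0 < p)
    (κ η : Kernel Ω Y) [IsMarkovKernel κ] [IsMarkovKernel η] :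
    Measurable (fun ω => MK p (κ ω) (η ω)) := by
  have := secondCountable_prob Y
  have := borelSpace_prob Y
  have h1 := (MK_lsc (Y := Y) hp).measurable
  let g : Ω → ProbabilityMeasure Y × ProbabilityMeasure Y := fun ω =>
    (⟨κ ω, inferInstance⟩, ⟨η ω, inferInstance⟩)
  have h2 : Measurable g :=
    (Measurable.subtype_mk κ.measurable).prodMk (Measurable.subtype_mk η.measurable)
  exact h1.comp h2

theorem MK_mid_aux {X : Type*} [PseudoEMetricSpace X] [MeasurableSpace X] {p : ℝ}
    (hp : 0 < p) {μ ν ν' : Measure X} {a b : ℝ≥0∞} (ha : MK p μ ν < a) (hb : MK p μ ν' < b) :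
    MK p μ ((2⁻¹ : ℝ≥0∞) • ν + (2⁻¹ : ℝ≥0∞) • ν') ^ p ≤ 2⁻¹ * a ^ p + 2⁻¹ * b ^ p := by
  obtain ⟨γ, h1, h2, h3⟩ := MK_lt_iff hp ha
  obtain ⟨γ', h1', h2', h3'⟩ := MK_lt_iff hp hb
  have hle := MK_le_of_coupling (p := p) (μ := μ)
    (ν := (2⁻¹ : ℝ≥0∞) • ν + (2⁻¹ : ℝ≥0∞) • ν') ((2⁻¹ : ℝ≥0∞) • γ + (2⁻¹ : ℝ≥0∞) • γ')
    (by
      rw [Measure.map_add _ _ measurable_fst, Measure.map_smul, Measure.map_smul, h1, h1',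
        ← add_smul, ENNReal.inv_two_add_inv_two, one_smul])
    (by
      rw [Measure.map_add _ _ measurable_snd, Measure.map_smul, Measure.map_smul, h2, h2'])
  have h4 := ENNReal.rpow_le_rpow hle hp.le
  rw [← ENNReal.rpow_mul, one_div, inv_mul_cancel₀ hp.ne', ENNReal.rpow_one,
    lintegral_add_measure, lintegral_smul_measure, lintegral_smul_measure] at h4
  refine h4.trans ?_
  simp only [smul_eq_mul]
  gcongr

theorem MK_mid {X : Type*} [PseudoEMetricSpace X] [MeasurableSpace X] {p : ℝ}
    (hp : 0 < p) (μ ν ν' : Measure X) :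
    MK p μ ((2⁻¹ : ℝ≥0∞) • ν + (2⁻¹ : ℝ≥0∞) • ν') ^ p ≤
      2⁻¹ * MK p μ ν ^ p + 2⁻¹ * MK p μ ν' ^ p := by
  by_cases hA : MK p μ ν = ∞
  · simp [hA, ENNReal.top_rpow_of_pos hp, ENNReal.mul_top]
  by_cases hB : MK p μ ν' = ∞
  · simp [hB, ENNReal.top_rpow_of_pos hp, ENNReal.mul_top]
  have hcont : Tendsto (fun n : ℕ => 2⁻¹ * (MK p μ ν + (n : ℝ≥0∞)⁻¹) ^ p
      + 2⁻¹ * (MK p μ ν' + (n : ℝ≥0∞)⁻¹) ^ p) atTop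
      (𝓝 (2⁻¹ * (MK p μ ν + 0) ^ p + 2⁻¹ * (MK p μ ν' + 0) ^ p)) := by
    have h0 := ENNReal.tendsto_inv_nat_nhds_zero
    have hc : ∀ A : ℝ≥0∞, Tendsto (fun n : ℕ => 2⁻¹ * (A + (n : ℝ≥0∞)⁻¹) ^ p) atTop
        (𝓝 (2⁻¹ * (A + 0) ^ p)) := fun A =>
      ENNReal.Tendsto.const_mul (((ENNReal.continuous_rpow_const (y := p)).tendsto _).comp
        (tendsto_const_nhds.add h0)) (Or.inr (by simp))
    exact (hc _).add (hc _)
  rw [add_zero, add_zero] at hcont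
  refine ge_of_tendsto' hcont fun n => ?_
  exact MK_mid_aux hp (ENNReal.lt_add_right hA (by simp)) (ENNReal.lt_add_right hB (by simp))

/-- The midpoint of two kernels. -/
noncomputable def midK {Ω Y : Type*} [MeasurableSpace Ω] [MeasurableSpace Y]
    (κ η : Kernel Ω Y) : Kernel Ω Y where
  toFun ω := (2⁻¹ : ℝ≥0∞) • κ ω + (2⁻¹ : ℝ≥0∞) • η ω
  measurable' := by
    refine Measure.measurable_of_measurable_coe _ fun s hs => ?_
    simp only [Measure.coe_add, Measure.coe_smul, Pi.add_apply, Pi.smul_apply, smul_eq_mul]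
    exact ((κ.measurable_coe hs).const_mul _).add ((η.measurable_coe hs).const_mul _)

theorem midK_apply {Ω Y : Type*} [MeasurableSpace Ω] [MeasurableSpace Y]
    (κ η : Kernel Ω Y) (ω : Ω) :
    midK κ η ω = (2⁻¹ : ℝ≥0∞) • κ ω + (2⁻¹ : ℝ≥0∞) • η ω := rfl

theorem isMarkovKernel_midK {Ω Y : Type*} [MeasurableSpace Ω] [MeasurableSpace Y]
    (κ η : Kernel Ω Y) [IsMarkovKernel κ] [IsMarkovKernel η] : IsMarkovKernel (midK κ η) := by
  refine ⟨fun ω => ⟨?_⟩⟩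
  rw [midK_apply]
  simp [ENNReal.inv_two_add_inv_two]

theorem scrMK_mid_le {Ω Y : Type*} [MeasurableSpace Ω]
    [MetricSpace Y] [CompleteSpace Y] [SecondCountableTopology Y]
    [ProperSpace Y] [MeasurableSpace Y] [BorelSpace Y] {p : ℝ} (hp : 1 ≤ p) {q : ℝ≥0∞}
    (hpq : ENNReal.ofReal p ≤ q) (σ : Measure Ω) (m κ η : Kernel Ω Y)
    [IsMarkovKernel m] [IsMarkovKernel κ] [IsMarkovKernel η] {b : ℝ≥0∞}
    (h1 : scrMK p q σ m κ ≤ b) (h2 : scrMK p q σ m η ≤ b) :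
    scrMK p q σ m (midK κ η) ≤ b := by
  have hp0 : 0 < p := by linarith
  unfold scrMK at *
  split_ifs at * with hq
  · have e1 := ENNReal.ae_le_essSup (μ := σ) (fun ω => MK p (m ω) (κ ω))
    have e2 := ENNReal.ae_le_essSup (μ := σ) (fun ω => MK p (m ω) (η ω))
    refine essSup_le_of_ae_le _ ?_
    filter_upwards [e1, e2] with ω h3 h4
    rw [← ENNReal.rpow_le_rpow_iff hp0, midK_apply]
    refine (MK_mid hp0 _ _ _).trans ?_
    calc _ ≤ 2⁻¹ * b ^ p + 2⁻¹ * b ^ p := by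
          gcongr
          · exact h3.trans h1
          · exact h4.trans h2
      _ = b ^ p := by rw [← add_mul, ENNReal.inv_two_add_inv_two, one_mul]
  · have hpr : p ≤ q.toReal := (ENNReal.ofReal_le_iff_le_toReal hq).1 hpq
    have hq0 : 0 < q.toReal := by linarith
    rw [one_div, ENNReal.rpow_inv_le_iff hq0] at *
    have hpt : ∀ ω, MK p (m ω) (midK κ η ω) ^ q.toReal ≤
        2⁻¹ * MK p (m ω) (κ ω) ^ q.toReal + 2⁻¹ * MK p (m ω) (η ω) ^ q.toReal := by
      intro ω
      have h3 := ENNReal.rpow_le_rpow (z := q.toReal / p) (MK_mid hp0 (m ω) (κ ω) (η ω))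
        (by positivity)
      have h4 := h3.trans (ENNReal.rpow_arith_mean_le_arith_mean2_rpow _ _ _ _
        ENNReal.inv_two_add_inv_two ((one_le_div hp0).2 hpr))
      simp only [← ENNReal.rpow_mul, mul_div_cancel₀ _ hp0.ne'] at h4
      exact h4
    have mκ := measurable_MK hp0 m κ
    have mη := measurable_MK hp0 m η
    calc _ ≤ ∫⁻ ω, 2⁻¹ * MK p (m ω) (κ ω) ^ q.toReal + 2⁻¹ * MK p (m ω) (η ω) ^ q.toReal ∂σ :=
          lintegral_mono hpt
      _ = 2⁻¹ * ∫⁻ ω, MK p (m ω) (κ ω) ^ q.toReal ∂σ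
          + 2⁻¹ * ∫⁻ ω, MK p (m ω) (η ω) ^ q.toReal ∂σ := by
          rw [lintegral_add_left (by fun_prop), lintegral_const_mul _ (by fun_prop),
            lintegral_const_mul _ (by fun_prop)]
      _ ≤ 2⁻¹ * b ^ q.toReal + 2⁻¹ * b ^ q.toReal := by gcongr
      _ = _ := by rw [← add_mul, ENNReal.inv_two_add_inv_two, one_mul]

theorem MK_dirac {Y : Type*} [MetricSpace Y] [SecondCountableTopology Y]
    [MeasurableSpace Y] [BorelSpace Y] {p : ℝ} (y0 : Y) (ν : Measure Y)
    [IsProbabilityMeasure ν] :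
    MK p (Measure.dirac y0) ν = (∫⁻ y, edist y0 y ^ p ∂ν) ^ (1 / p) := by
  apply le_antisymm
  · refine (MK_le_of_coupling ((Measure.dirac y0).prod ν) (by simp) (by simp)).trans_eq ?_
    rw [Measure.dirac_prod, lintegral_map (by fun_prop) (by fun_prop)]
  · refine le_iInf₂ fun γ hγ => ?_
    apply le_of_eq
    congr 1
    have h1 : ∀ᵐ z ∂γ, z.1 = y0 := by
      have : ∀ᵐ y ∂(γ.map Prod.fst), y = y0 := by
        rw [hγ.1, ae_dirac_eq]; simp
      exact ae_of_ae_map measurable_fst.aemeasurable this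
    rw [← hγ.2, lintegral_map (by fun_prop) measurable_snd]
    apply lintegral_congr_ae
    filter_upwards [h1] with z hz
    rw [hz]

theorem MK_triangle₁ {Y : Type*} [MetricSpace Y] [SecondCountableTopology Y]
    [MeasurableSpace Y] [BorelSpace Y] {p : ℝ} (hp : 1 ≤ p) (y0 : Y) (μ ν : Measure Y)
    [IsProbabilityMeasure μ] [IsProbabilityMeasure ν] :
    MK p (Measure.dirac y0) ν ≤ MK p (Measure.dirac y0) μ + MK p μ ν := by
  have hp0 : 0 < p := by linarith
  rw [MK_dirac, MK_dirac]
  unfold MK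
  simp only [ENNReal.add_iInf]
  refine le_iInf₂ fun γ hγ => ?_
  rw [← hγ.1, ← hγ.2, lintegral_map (by fun_prop) measurable_fst,
    lintegral_map (by fun_prop) measurable_snd]
  refine le_trans ?_ (lintegral_Lp_add_le (μ := γ) (f := fun z : Y × Y => edist y0 z.1)
    (g := fun z : Y × Y => edist z.1 z.2) (by fun_prop) (by fun_prop) hp)
  gcongr with z
  exact edist_triangle _ _ _

theorem MK_triangle₂ {Y : Type*} [MetricSpace Y] [SecondCountableTopology Y]
    [MeasurableSpace Y] [BorelSpace Y] {p : ℝ} (hp : 1 ≤ p) (y0 : Y) (μ ν : Measure Y)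
    [IsProbabilityMeasure μ] [IsProbabilityMeasure ν] :
    MK p μ ν ≤ MK p (Measure.dirac y0) μ + MK p (Measure.dirac y0) ν := by
  have hp0 : 0 < p := by linarith
  rw [MK_dirac, MK_dirac]
  have hf : (μ.prod ν).map Prod.fst = μ := by simp
  have hs : (μ.prod ν).map Prod.snd = ν := by simp
  refine (MK_le_of_coupling (μ.prod ν) hf hs).trans ?_
  have e1 : ∫⁻ y, edist y0 y ^ p ∂μ = ∫⁻ z, edist y0 z.1 ^ p ∂(μ.prod ν) := by
    conv_lhs => rw [← hf]
    rw [lintegral_map (by fun_prop) measurable_fst]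
  have e2 : ∫⁻ y, edist y0 y ^ p ∂ν = ∫⁻ z, edist y0 z.2 ^ p ∂(μ.prod ν) := by
    conv_lhs => rw [← hs]
    rw [lintegral_map (by fun_prop) measurable_snd]
  rw [e1, e2]
  refine le_trans ?_ (lintegral_Lp_add_le (μ := μ.prod ν) (f := fun z : Y × Y => edist y0 z.1)
    (g := fun z : Y × Y => edist y0 z.2) (by fun_prop) (by fun_prop) hp)
  gcongr with z
  exact edist_triangle_left _ _ _

theorem scrMK_eq_eLpNorm {Ω Y : Type*} [MeasurableSpace Ω] [PseudoEMetricSpace Y]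
    [MeasurableSpace Y] (p : ℝ) {q : ℝ≥0∞} (hq : q ≠ 0) (σ : Measure Ω) (κ η : Kernel Ω Y) :
    scrMK p q σ κ η = eLpNorm (fun ω => MK p (κ ω) (η ω)) q σ := by
  unfold scrMK
  split_ifs with h
  · subst h
    simp [eLpNorm_exponent_top, eLpNormEssSup]
  · rw [eLpNorm_eq_lintegral_rpow_enorm_toReal hq h]
    simp

theorem scrMK_le_add {Ω Y : Type*} [MeasurableSpace Ω]
    [MetricSpace Y] [CompleteSpace Y] [SecondCountableTopology Y]
    [ProperSpace Y] [MeasurableSpace Y] [BorelSpace Y] {p : ℝ} (hp : 1 ≤ p) {q : ℝ≥0∞}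
    (hq : 1 ≤ q) (σ : Measure Ω) (a₁ a₂ b₁ b₂ c₁ c₂ : Kernel Ω Y)
    [IsMarkovKernel b₁] [IsMarkovKernel b₂] [IsMarkovKernel c₁] [IsMarkovKernel c₂]
    (h : ∀ ω, MK p (a₁ ω) (a₂ ω) ≤ MK p (b₁ ω) (b₂ ω) + MK p (c₁ ω) (c₂ ω)) :
    scrMK p q σ a₁ a₂ ≤ scrMK p q σ b₁ b₂ + scrMK p q σ c₁ c₂ := by
  have hq0 : q ≠ 0 := (zero_lt_one.trans_le hq).ne'
  have hp0 : 0 < p := by linarith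
  simp only [scrMK_eq_eLpNorm p hq0]
  refine le_trans (eLpNorm_mono_enorm fun ω => ?_) (eLpNorm_add_le
    (measurable_MK hp0 b₁ b₂).aestronglyMeasurable
    (measurable_MK hp0 c₁ c₂).aestronglyMeasurable hq)
  simpa using h ω

theorem eLpNorm_liminf_le_aux {Ω : Type*} [MeasurableSpace Ω] {σ : Measure Ω} {q : ℝ≥0∞}
    (hq : q ≠ 0) {g : ℕ → Ω → ℝ≥0∞} (hg : ∀ n, Measurable (g n)) {b : ℕ → ℝ≥0∞} {a : ℝ≥0∞}
    (hb : Tendsto b atTop (𝓝 a)) (h : ∀ n, eLpNorm (g n) q σ ≤ b n) :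
    eLpNorm (fun ω => liminf (fun n => g n ω) atTop) q σ ≤ a := by
  by_cases hqt : q = ∞
  · subst hqt
    simp only [eLpNorm_exponent_top, eLpNormEssSup, enorm_eq_self] at *
    refine essSup_le_of_ae_le _ ?_
    have : ∀ᵐ ω ∂σ, ∀ n, g n ω ≤ b n := by
      rw [ae_all_iff]
      intro n
      filter_upwards [ENNReal.ae_le_essSup (μ := σ) (g n)] with ω hω
      exact hω.trans (h n)
    filter_upwards [this] with ω hω
    rw [← hb.liminf_eq]
    exact liminf_le_liminf (Eventually.of_forall hω)
  · have hq0 : 0 < q.toReal := ENNReal.toReal_pos hq hqt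
    simp only [eLpNorm_eq_lintegral_rpow_enorm_toReal hq hqt, enorm_eq_self, one_div,
      ENNReal.rpow_inv_le_iff hq0] at *
    have e : ∀ ω, (liminf (fun n => g n ω) atTop) ^ q.toReal =
        liminf (fun n => g n ω ^ q.toReal) atTop := by
      intro ω
      exact (ENNReal.monotone_rpow_of_nonneg hq0.le).map_liminf_of_continuousAt _
        ENNReal.continuous_rpow_const.continuousAt
    simp only [e]
    refine (lintegral_liminf_le fun n => by fun_prop).trans ?_
    refine (liminf_le_liminf (Eventually.of_forall h)).trans ?_
    exact (((ENNReal.continuous_rpow_const (y := q.toReal)).tendsto a).comp hb).liminf_eq.le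

theorem ae_ne_top_of_eLpNorm {Ω : Type*} [MeasurableSpace Ω] {σ : Measure Ω} {q : ℝ≥0∞}
    (hq : q ≠ 0) {g : Ω → ℝ≥0∞} (hg : Measurable g) (h : eLpNorm g q σ ≠ ∞) :
    ∀ᵐ ω ∂σ, g ω ≠ ∞ := by
  by_cases hqt : q = ∞
  · subst hqt
    simp only [eLpNorm_exponent_top, eLpNormEssSup, enorm_eq_self] at h
    filter_upwards [ENNReal.ae_le_essSup (μ := σ) g] with ω hω
    exact (hω.trans_lt (lt_top_iff_ne_top.2 h)).ne
  · have hq0 : 0 < q.toReal := ENNReal.toReal_pos hq hqt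
    rw [eLpNorm_eq_lintegral_rpow_enorm_toReal hq hqt] at h
    simp only [enorm_eq_self, one_div] at h
    have h2 : ∫⁻ ω, g ω ^ q.toReal ∂σ ≠ ∞ := by
      intro h3; apply h; rw [h3, ENNReal.top_rpow_of_pos (by positivity)]
    filter_upwards [ae_lt_top (by fun_prop) h2] with ω hω h4
    rw [h4, ENNReal.top_rpow_of_pos hq0] at hω
    exact lt_irrefl _ hω

theorem hilbert_cauchy {E : Type*} [NormedAddCommGroup E] [InnerProductSpace ℝ E]
    (C : ℕ → Set E) (hanti : Antitone C) (hne : ∀ n, (C n).Nonempty)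
    (hmid : ∀ n, ∀ x ∈ C n, ∀ y ∈ C n, (2⁻¹ : ℝ) • (x + y) ∈ C n) (M : ℝ)
    (hM : ∀ x ∈ C 0, ‖x‖ ≤ M) : ∃ u : ℕ → E, (∀ n, u n ∈ C n) ∧ CauchySeq u := by
  set d : ℕ → ℝ := fun n => sInf ((fun x : E => ‖x‖ ^ 2) '' C n) with hd
  have hbdd : ∀ n, BddBelow ((fun x : E => ‖x‖ ^ 2) '' C n) := fun n =>
    ⟨0, by rintro _ ⟨x, _, rfl⟩; positivity⟩
  have hle : ∀ n, ∀ x ∈ C n, d n ≤ ‖x‖ ^ 2 := fun n x hx =>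
    csInf_le (hbdd n) ⟨x, hx, rfl⟩
  have hmono : Monotone d := fun n m hnm =>
    csInf_le_csInf (hbdd n) ((hne m).image _) (Set.image_mono (hanti hnm))
  have hex : ∀ n : ℕ, ∃ x ∈ C n, ‖x‖ ^ 2 < d n + 1 / ((n : ℝ) + 1) := by
    intro n
    have hpos : (0 : ℝ) < 1 / ((n : ℝ) + 1) := by positivity
    obtain ⟨_, ⟨x, hx, rfl⟩, h⟩ := exists_lt_of_csInf_lt ((hne n).image (fun x : E => ‖x‖ ^ 2))
      (show sInf ((fun x : E => ‖x‖ ^ 2) '' C n) < d n + 1 / ((n : ℝ) + 1) by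
        change d n < _; linarith)
    exact ⟨x, hx, h⟩
  choose u hu hu2 using hex
  have hub : ∀ n, d n ≤ M ^ 2 := by
    intro n
    refine (hle n _ (hu n)).trans ?_
    have := hM _ (hanti (Nat.zero_le n) (hu n))
    gcongr
  have hba : BddAbove (Set.range d) := ⟨M ^ 2, by rintro _ ⟨n, rfl⟩; exact hub n⟩
  have htd : Tendsto d atTop (𝓝 (⨆ n, d n)) := tendsto_atTop_ciSup hmono hba
  refine ⟨u, hu, ?_⟩
  refine cauchySeq_of_le_tendsto_0'
    (fun n => Real.sqrt (2 * ((⨆ n, d n) - d n) + 4 * (1 / ((n : ℝ) + 1)))) ?_ ?_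
  · intro n m hnm
    rw [dist_eq_norm]
    refine Real.le_sqrt_of_sq_le ?_
    have hpar := parallelogram_law_with_norm ℝ (u n) (u m)
    have h1 := hle n _ (hmid n _ (hu n) _ (hanti hnm (hu m)))
    rw [norm_smul, mul_pow] at h1
    norm_num at h1
    have h2 := hu2 n
    have h3 := hu2 m
    have h4 : d m ≤ ⨆ n, d n := le_ciSup hba m
    have h5 : 1 / ((m : ℝ) + 1) ≤ 1 / ((n : ℝ) + 1) := by
      have : (n : ℝ) ≤ m := by exact_mod_cast hnm
      gcongr
    nlinarith
  · have h0 : Tendsto (fun n : ℕ => 2 * ((⨆ n, d n) - d n) + 4 * (1 / ((n : ℝ) + 1))) atTop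
        (𝓝 (2 * ((⨆ n, d n) - ⨆ n, d n) + 4 * 0)) :=
      ((tendsto_const_nhds.sub htd).const_mul _).add
        (tendsto_one_div_add_atTop_nhds_zero_nat.const_mul _)
    have := (Real.continuous_sqrt.tendsto _).comp h0
    simpa [Function.comp_def] using this

noncomputable def tauN : Measure ℕ := (Measure.count : Measure ℕ).toFinite

instance : IsFiniteMeasure tauN := by unfold tauN; infer_instance

noncomputable def UK {Ω Y : Type*} [MeasurableSpace Ω] [TopologicalSpace Y] [MeasurableSpace Y]
    (f : ℕ → Y →ᵇ ℝ≥0) (κ : Kernel Ω Y) (z : Ω × ℕ) : ℝ :=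
  (∫⁻ y, (f z.2 y : ℝ≥0∞) ∂(κ z.1)).toReal

theorem lint_le_one {Ω Y : Type*} [MeasurableSpace Ω] [TopologicalSpace Y] [MeasurableSpace Y]
    (f : ℕ → Y →ᵇ ℝ≥0) (hf : ∀ i y, f i y ≤ 1) (κ : Kernel Ω Y) [IsMarkovKernel κ]
    (ω : Ω) (i : ℕ) : ∫⁻ y, (f i y : ℝ≥0∞) ∂(κ ω) ≤ 1 := by
  calc _ ≤ ∫⁻ y, 1 ∂(κ ω) := lintegral_mono fun y => by simpa using hf i y
    _ = 1 := by simp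

theorem measurable_UK {Ω Y : Type*} [MeasurableSpace Ω] [TopologicalSpace Y] [MeasurableSpace Y]
    [OpensMeasurableSpace Y]
    (f : ℕ → Y →ᵇ ℝ≥0) (κ : Kernel Ω Y) : Measurable (UK f κ) := by
  refine measurable_from_prod_countable_left fun i => ?_
  refine Measurable.ennreal_toReal ?_
  exact Measurable.lintegral_kernel (f := fun y => (f i y : ℝ≥0∞))
    (measurable_coe_nnreal_ennreal.comp (f i).continuous.measurable)

theorem UK_bound {Ω Y : Type*} [MeasurableSpace Ω] [TopologicalSpace Y] [MeasurableSpace Y]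
    (f : ℕ → Y →ᵇ ℝ≥0) (hf : ∀ i y, f i y ≤ 1) (κ : Kernel Ω Y) [IsMarkovKernel κ]
    (z : Ω × ℕ) : ‖UK f κ z‖ ≤ 1 := by
  unfold UK
  rw [Real.norm_of_nonneg ENNReal.toReal_nonneg]
  exact ENNReal.toReal_le_of_le_ofReal zero_le_one (by simpa using lint_le_one f hf κ z.1 z.2)

theorem UK_mid {Ω Y : Type*} [MeasurableSpace Ω] [TopologicalSpace Y] [MeasurableSpace Y]
    (f : ℕ → Y →ᵇ ℝ≥0) (hf : ∀ i y, f i y ≤ 1) (κ η : Kernel Ω Y) [IsMarkovKernel κ]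
    [IsMarkovKernel η] (z : Ω × ℕ) : UK f (midK κ η) z = 2⁻¹ * (UK f κ z + UK f η z) := by
  unfold UK
  have h1 := ne_top_of_le_ne_top one_ne_top (lint_le_one f hf κ z.1 z.2)
  have h2 := ne_top_of_le_ne_top one_ne_top (lint_le_one f hf η z.1 z.2)
  rw [midK_apply, lintegral_add_measure, lintegral_smul_measure, lintegral_smul_measure,
    smul_eq_mul, smul_eq_mul, ← mul_add, ENNReal.toReal_mul, ENNReal.toReal_add h1 h2]
  simp

theorem exists_ae_conv {Ω Y : Type*} [MeasurableSpace Ω] [TopologicalSpace Y]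
    [MeasurableSpace Y] [OpensMeasurableSpace Y] (σ : Measure Ω) [IsProbabilityMeasure σ]
    (f : ℕ → Y →ᵇ ℝ≥0) (hf : ∀ i y, f i y ≤ 1) (S : ℕ → Set (Kernel Ω Y))
    (hM : ∀ n, ∀ κ ∈ S n, IsMarkovKernel κ) (hanti : Antitone S) (hne : ∀ n, (S n).Nonempty)
    (hmid : ∀ n, ∀ κ ∈ S n, ∀ η ∈ S n, midK κ η ∈ S n) :
    ∃ v : ℕ → Kernel Ω Y, (∀ n, v n ∈ S n) ∧ ∀ᵐ ω ∂σ, ∀ i, ∃ l : ℝ≥0∞,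
      Tendsto (fun n => ∫⁻ y, (f i y : ℝ≥0∞) ∂(v n ω)) atTop (𝓝 l) := by
  have hmem : ∀ κ : Kernel Ω Y, IsMarkovKernel κ → MemLp (UK f κ) 2 (σ.prod tauN) :=
    fun κ hκ => MemLp.of_bound (measurable_UK f κ).aestronglyMeasurable 1
      (Eventually.of_forall fun z => UK_bound f hf κ z)
  let C : ℕ → Set (Lp ℝ 2 (σ.prod tauN)) := fun n =>
    {x | ∃ κ ∈ S n, ⇑x =ᵐ[σ.prod tauN] UK f κ}
  obtain ⟨u, hu, huc⟩ := hilbert_cauchy C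
    (fun n m hnm x ⟨κ, hκ, hx⟩ => ⟨κ, hanti hnm hκ, hx⟩)
    (fun n => by
      obtain ⟨κ, hκ⟩ := hne n
      exact ⟨(hmem κ (hM n κ hκ)).toLp, κ, hκ, MemLp.coeFn_toLp _⟩)
    (by
      rintro n x ⟨κ, hκ, hx⟩ y ⟨η, hη, hy⟩
      have := hM n κ hκ
      have := hM n η hη
      refine ⟨midK κ η, hmid n κ hκ η hη, ?_⟩
      filter_upwards [hx, hy, Lp.coeFn_smul (2⁻¹ : ℝ) (x + y), Lp.coeFn_add x y]
        with z h1 h2 h3 h4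
      rw [h3, Pi.smul_apply, h4, Pi.add_apply, h1, h2, UK_mid f hf, smul_eq_mul])
    _ (by
      rintro x ⟨κ, hκ, hx⟩
      have := hM 0 κ hκ
      refine Lp.norm_le_of_ae_bound zero_le_one ?_
      filter_upwards [hx] with z hz
      rw [hz]
      exact UK_bound f hf κ z)
  obtain ⟨L, hL⟩ := cauchySeq_tendsto_of_complete huc
  obtain ⟨ns, hns, hae⟩ := (tendstoInMeasure_of_tendsto_Lp hL).exists_seq_tendsto_ae
  choose v hv huv using hu
  have hv' : ∀ᵐ z ∂(σ.prod tauN), ∀ n, u n z = UK f (v n) z := ae_all_iff.2 fun n => huv n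
  refine ⟨fun n => v (ns n), fun n => hanti hns.le_apply (hv (ns n)), ?_⟩
  have h3 : ∀ᵐ z ∂(σ.prod tauN), ∃ l : ℝ, Tendsto (fun n => UK f (v (ns n)) z) atTop (𝓝 l) := by
    filter_upwards [hae, hv'] with z h1 h2
    refine ⟨L z, ?_⟩
    simpa only [h2] using h1
  filter_upwards [Measure.ae_ae_of_ae_prod h3] with ω hω
  have hω' : ∀ i, ∃ l : ℝ, Tendsto (fun n => UK f (v (ns n)) (ω, i)) atTop (𝓝 l) := by
    rw [tauN, ae_toFinite, Measure.ae_count_iff] at hω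
    exact hω
  intro i
  obtain ⟨l, hl⟩ := hω' i
  refine ⟨ENNReal.ofReal l, (ENNReal.tendsto_ofReal hl).congr fun n => ?_⟩
  have := hM _ _ (hv (ns n))
  exact ENNReal.ofReal_toReal
    (ne_top_of_le_ne_top one_ne_top (lint_le_one f hf (v (ns n)) ω i))

theorem pt_limit {Y : Type*} [MetricSpace Y] [CompleteSpace Y] [SecondCountableTopology Y]
    [ProperSpace Y] [MeasurableSpace Y] [BorelSpace Y] {p : ℝ} (hp : 0 < p)
    (f : ℕ → Y →ᵇ ℝ≥0) (hfe : IsEmbedding (evalMap f)) (μ : ProbabilityMeasure Y)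
    (νs : ℕ → ProbabilityMeasure Y) (L : ℕ → ℝ≥0∞)
    (hL : Tendsto (fun n => evalMap f (νs n)) atTop (𝓝 L))
    (h : liminf (fun n => MK p (μ : Measure Y) (νs n : Measure Y)) atTop ≠ ∞) :
    ∃ ν : ProbabilityMeasure Y, evalMap f ν = L ∧
      MK p (μ : Measure Y) (ν : Measure Y) ≤
        liminf (fun n => MK p (μ : Measure Y) (νs n : Measure Y)) atTop := by
  have key : ∀ c : ℝ≥0∞, liminf (fun n => MK p (μ : Measure Y) (νs n : Measure Y)) atTop < c →
      c ≠ ∞ → ∃ ν : ProbabilityMeasure Y, evalMap f ν = L ∧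
        MK p (μ : Measure Y) (ν : Measure Y) ≤ c := by
    intro c hc hct
    obtain ⟨ψ, hψ, hlt⟩ := extraction_of_frequently_atTop (frequently_lt_of_liminf_lt (by isBoundedDefault) hc)
    obtain ⟨ν, φ, hφ, hν, hle⟩ := MK_compactness hp (μs := fun _ => μ)
      (νs := fun n => νs (ψ n)) tendsto_const_nhds hct hlt
    refine ⟨ν, ?_, hle⟩
    refine tendsto_nhds_unique ((hfe.continuous.tendsto ν).comp hν) ?_
    exact hL.comp (hψ.comp hφ).tendsto_atTop
  obtain ⟨c, hc, hct⟩ := exists_between (lt_top_iff_ne_top.2 h)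
  obtain ⟨ν, hν, -⟩ := key c hc hct.ne
  refine ⟨ν, hν, ?_⟩
  refine le_of_forall_gt_imp_ge_of_dense fun a ha => ?_
  by_cases hat : a = ∞
  · simp [hat]
  obtain ⟨ν', hν', hle⟩ := key a ha hat
  rwa [hfe.injective (hν.trans hν'.symm)]

theorem exists_kernel_limit {Ω Y ι : Type*} [MeasurableSpace Ω] [Countable ι] [Nonempty ι]
    [MetricSpace Y] [CompleteSpace Y] [SecondCountableTopology Y]
    [ProperSpace Y] [MeasurableSpace Y] [BorelSpace Y] {p : ℝ} (hp : 0 < p) (y0 : Y)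
    (σ : Measure Ω)
    (f : ℕ → Y →ᵇ ℝ≥0) (hfe : IsEmbedding (evalMap f)) (m : ι → Kernel Ω Y)
    (hm : ∀ k, IsMarkovKernel (m k)) (v : ℕ → Kernel Ω Y) (hv : ∀ n, IsMarkovKernel (v n))
    (hconv : ∀ᵐ ω ∂σ, ∀ i, ∃ l : ℝ≥0∞,
      Tendsto (fun n => ∫⁻ y, (f i y : ℝ≥0∞) ∂(v n ω)) atTop (𝓝 l))
    (hfin : ∀ k, ∀ᵐ ω ∂σ, liminf (fun n => MK p (m k ω) (v n ω)) atTop ≠ ∞) :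
    ∃ η : Kernel Ω Y, IsMarkovKernel η ∧ ∀ k, ∀ᵐ ω ∂σ,
      MK p (m k ω) (η ω) ≤ liminf (fun n => MK p (m k ω) (v n ω)) atTop := by
  classical
  let vP : ℕ → Ω → ProbabilityMeasure Y := fun n ω => ⟨v n ω, inferInstance⟩
  let mP : ι → Ω → ProbabilityMeasure Y := fun k ω => ⟨m k ω, inferInstance⟩
  have hvP : ∀ n, Measurable (vP n) := fun n => (v n).measurable.subtype_mk
  let Good : Ω → Prop := fun ω => ∃ ν : ProbabilityMeasure Y,
    Tendsto (fun n => evalMap f (vP n ω)) atTop (𝓝 (evalMap f ν)) ∧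
    ∀ k, MK p (m k ω) (ν : Measure Y) ≤ liminf (fun n => MK p (m k ω) (v n ω)) atTop
  have hgood : ∀ᵐ ω ∂σ, Good ω := by
    filter_upwards [hconv, ae_all_iff.2 hfin] with ω h1 h2
    choose L hL using h1
    have hL' : Tendsto (fun n => evalMap f (vP n ω)) atTop (𝓝 L) := tendsto_pi_nhds.2 hL
    have h3 : ∀ k, _ := fun k => pt_limit hp f hfe (mP k ω) (fun n => vP n ω) L hL' (h2 k)
    choose ν hν hle using h3
    obtain ⟨k0⟩ := ‹Nonempty ι›
    refine ⟨ν k0, by rwa [hν k0], fun k => ?_⟩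
    rw [hfe.injective ((hν k0).trans (hν k).symm)]
    exact hle k
  obtain ⟨A, hAsub, hA, hA0⟩ : ∃ A : Set Ω, (∀ ω ∈ A, Good ω) ∧ MeasurableSet A ∧ σ Aᶜ = 0 := by
    refine ⟨(toMeasurable σ {ω | ¬ Good ω})ᶜ, fun ω hω => ?_,
      (measurableSet_toMeasurable _ _).compl, ?_⟩
    · by_contra hc
      exact hω (subset_toMeasurable _ _ hc)
    · rw [compl_compl, measure_toMeasurable]
      exact hgood
  have hAae : ∀ᵐ ω ∂σ, ω ∈ A := hA0
  choose ν hν1 hν2 using hAsub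
  let δ : ProbabilityMeasure Y := ⟨Measure.dirac y0, inferInstance⟩
  let h : Ω → ProbabilityMeasure Y := fun ω => if hω : ω ∈ A then ν ω hω else δ
  have hmeasE : Measurable (fun ω => evalMap f (h ω)) := by
    refine measurable_of_tendsto_metrizable
      (f := fun n ω => if ω ∈ A then evalMap f (vP n ω) else evalMap f δ) (fun n => ?_) ?_
    · exact Measurable.ite hA ((measurable_evalMap f).comp (hvP n)) measurable_const
    · rw [tendsto_pi_nhds]
      intro ω
      by_cases hω : ω ∈ A
      · simpa [h, hω] using hν1 ω hω
      · simp [h, hω]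
  have hmeas : Measurable h := by
    have := borelSpace_prob Y
    refine measurable_of_isOpen fun U hU => ?_
    obtain ⟨V, hV, rfl⟩ := hfe.isInducing.isOpen_iff.1 hU
    exact hmeasE hV.measurableSet
  refine ⟨⟨fun ω => (h ω : Measure Y), measurable_subtype_coe.comp hmeas⟩, ⟨fun ω => ?_⟩, ?_⟩
  · change IsProbabilityMeasure (h ω : Measure Y)
    infer_instance
  · intro k
    filter_upwards [hAae] with ω hω
    change MK p (m k ω) (h ω : Measure Y) ≤ _
    have : h ω = ν ω hω := by simp [h, hω]
    rw [this]
    exact hν2 ω hω k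

theorem exists_limit_point {Ω Y ι : Type*} [MeasurableSpace Ω] [Countable ι] [Nonempty ι]
    [MetricSpace Y] [CompleteSpace Y] [SecondCountableTopology Y]
    [ProperSpace Y] [MeasurableSpace Y] [BorelSpace Y] {p : ℝ} (hp : 1 ≤ p) {q : ℝ≥0∞}
    (hpq : ENNReal.ofReal p ≤ q) (y0 : Y) (σ : Measure Ω) [IsProbabilityMeasure σ]
    (m : ι → Kernel Ω Y) (hm : ∀ k, IsMarkovKernel (m k)) (a : ι → ℝ≥0∞) (ha : ∀ k, a k ≠ ∞)
    (hne : ∀ n : ℕ, ∃ κ : Kernel Ω Y, IsMarkovKernel κ ∧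
      ∀ k, scrMK p q σ (m k) κ ≤ a k + ((n : ℝ≥0∞) + 1)⁻¹) :
    ∃ η : Kernel Ω Y, IsMarkovKernel η ∧ ∀ k, scrMK p q σ (m k) η ≤ a k := by
  have hp0 : 0 < p := by linarith
  have hq1 : 1 ≤ q := le_trans (by simpa using hp) hpq
  have hq0 : q ≠ 0 := (zero_lt_one.trans_le hq1).ne'
  obtain ⟨f, hf1, hfe⟩ := exists_embedding Y
  let S : ℕ → Set (Kernel Ω Y) := fun n => {κ | IsMarkovKernel κ ∧
      ∀ k, scrMK p q σ (m k) κ ≤ a k + ((n : ℝ≥0∞) + 1)⁻¹}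
  obtain ⟨v, hv, hconv⟩ := exists_ae_conv σ f hf1 S (fun n κ hκ => hκ.1)
    (fun n n' hn κ hκ => ⟨hκ.1, fun k => (hκ.2 k).trans (by gcongr)⟩) hne
    (by
      rintro n κ ⟨h1, h2⟩ η ⟨h3, h4⟩
      exact ⟨isMarkovKernel_midK κ η, fun k =>
        scrMK_mid_le hp hpq σ (m k) κ η (h2 k) (h4 k)⟩)
  have hvM : ∀ n, IsMarkovKernel (v n) := fun n => (hv n).1
  have hmeas : ∀ k n, Measurable (fun ω => MK p (m k ω) (v n ω)) :=
    fun k n => measurable_MK hp0 (m k) (v n)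
  have hlim : ∀ k, Tendsto (fun n : ℕ => a k + ((n : ℝ≥0∞) + 1)⁻¹) atTop (𝓝 (a k)) := by
    intro k
    have h0 : Tendsto (fun n : ℕ => ((n : ℝ≥0∞) + 1)⁻¹) atTop (𝓝 0) := by
      have := (tendsto_add_atTop_iff_nat 1).2 ENNReal.tendsto_inv_nat_nhds_zero
      simpa using this
    simpa using tendsto_const_nhds.add h0
  have hlimle : ∀ k, eLpNorm (fun ω => liminf (fun n => MK p (m k ω) (v n ω)) atTop) q σ ≤ a k := by
    intro k
    refine eLpNorm_liminf_le_aux hq0 (hmeas k) (hlim k) fun n => ?_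
    rw [← scrMK_eq_eLpNorm p hq0]
    exact (hv n).2 k
  obtain ⟨η, hη, hle⟩ := exists_kernel_limit hp0 y0 σ f hfe m hm v hvM hconv fun k =>
    ae_ne_top_of_eLpNorm hq0 (Measurable.liminf (hmeas k))
      (ne_top_of_le_ne_top (ha k) (hlimle k))
  refine ⟨η, hη, fun k => ?_⟩
  rw [scrMK_eq_eLpNorm p hq0]
  refine le_trans (eLpNorm_mono_enorm_ae ?_) (hlimle k)
  filter_upwards [hle k] with ω hω
  simpa using hω

/-- **Existence of disintegrated Monge–Kantorovich barycenters** on the trivial bundle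
`Ω × Y`, with `Ω` complete, separable and locally compact and `Y` complete, separable and
satisfying the Heine–Borel property (proper): for `1 ≤ p < ∞`, `p ≤ q ≤ ∞`, `κ0 > 0`,
weights `λ_k ∈ (0,1)` summing to `1` and `m_1, …, m_K ∈ 𝒫^σ_{p,q}(Ω × Y)`, the function
`n ↦ ∑ k λ_k scrMK_{p,q}(m_k, n)^{κ0}` attains its infimum over `𝒫^σ_{p,q}(Ω × Y)`. -/
theorem disintegrated_barycenter_existence
    {Ω : Type*} [MetricSpace Ω] [CompleteSpace Ω] [SecondCountableTopology Ω]
    [LocallyCompactSpace Ω] [MeasurableSpace Ω] [BorelSpace Ω]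
    {Y : Type*} [MetricSpace Y] [CompleteSpace Y] [SecondCountableTopology Y] [ProperSpace Y]
    [MeasurableSpace Y] [BorelSpace Y]
    (σ : Measure Ω) [IsProbabilityMeasure σ] (y0 : Y)
    (p : ℝ) (hp : 1 ≤ p) (q : ℝ≥0∞) (hpq : ENNReal.ofReal p ≤ q)
    (κ0 : ℝ) (hκ0 : 0 < κ0)
    (K : ℕ) (hK : 2 ≤ K)
    (lam : Fin K → ℝ) (hlam : ∀ k, lam k ∈ Set.Ioo (0 : ℝ) 1) (hsum : ∑ k, lam k = 1)
    (m : Fin K → Kernel Ω Y) (hm : ∀ k, MemP p q σ y0 (m k)) :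
    ∃ η : Kernel Ω Y, MemP p q σ y0 η ∧
      ∀ η' : Kernel Ω Y, MemP p q σ y0 η' →
        ∑ k, ENNReal.ofReal (lam k) * scrMK p q σ (m k) η ^ κ0 ≤
          ∑ k, ENNReal.ofReal (lam k) * scrMK p q σ (m k) η' ^ κ0 := by
  have hp0 : 0 < p := by linarith
  have hq1 : 1 ≤ q := le_trans (by simpa using hp) hpq
  have hmM : ∀ k, IsMarkovKernel (m k) := fun k => (hm k).1
  have k0 : Fin K := ⟨0, by omega⟩
  have : Nonempty (Fin K) := ⟨k0⟩
  have hfin : ∀ k, ∀ η' : Kernel Ω Y, MemP p q σ y0 η' → scrMK p q σ (m k) η' ≠ ∞ := by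
    intro k η' h
    have := h.1
    refine ne_top_of_le_ne_top (ENNReal.add_ne_top.2 ⟨(hm k).2, h.2⟩)
      (scrMK_le_add hp hq1 σ _ _ _ _ _ _ fun ω => ?_)
    simp only [Kernel.const_apply]
    exact MK_triangle₂ hp y0 _ _
  let G : Kernel Ω Y → ℝ≥0∞ := fun η =>
    ∑ k, ENNReal.ofReal (lam k) * scrMK p q σ (m k) η ^ κ0
  let H : (Fin K → ℝ≥0∞) → ℝ≥0∞ := fun a => ∑ k, ENNReal.ofReal (lam k) * a k ^ κ0
  have hH : Continuous H := by
    refine continuous_finsetSum _ fun k _ => ?_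
    exact (ENNReal.continuous_const_mul ENNReal.ofReal_ne_top).comp
      (ENNReal.continuous_rpow_const.comp (continuous_apply k))
  let T : Set ℝ≥0∞ := G '' {η | MemP p q σ y0 η}
  have hTne : T.Nonempty := ⟨_, m k0, hm k0, rfl⟩
  obtain ⟨t, -, htend, htT⟩ := exists_seq_tendsto_sInf hTne (OrderBot.bddBelow T)
  choose ηs hηs hGs using htT
  obtain ⟨a, φ, hφ, hφt⟩ := CompactSpace.tendsto_subseq
    (fun n => fun k => scrMK p q σ (m k) (ηs n))
  have hHa : H a = sInf T := by
    refine tendsto_nhds_unique ((hH.tendsto a).comp hφt) ?_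
    refine (htend.comp hφ.tendsto_atTop).congr fun n => ?_
    exact (hGs (φ n)).symm
  have hVfin : H a ≠ ∞ := by
    rw [hHa]
    refine ne_top_of_le_ne_top ?_ (sInf_le (⟨m k0, hm k0, rfl⟩ : G (m k0) ∈ T))
    refine ENNReal.sum_ne_top.2 fun k _ => ?_
    exact ENNReal.mul_ne_top ENNReal.ofReal_ne_top
      (ENNReal.rpow_ne_top_of_nonneg hκ0.le (hfin k _ (hm k0)))
  have ha : ∀ k, a k ≠ ∞ := by
    intro k hk
    have h1 := ENNReal.sum_ne_top.1 hVfin k (Finset.mem_univ k)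
    rw [hk, ENNReal.top_rpow_of_pos hκ0, ENNReal.mul_top] at h1
    · exact h1 rfl
    · exact (ENNReal.ofReal_pos.2 (hlam k).1).ne'
  obtain ⟨η, hη, hle⟩ := exists_limit_point hp hpq y0 σ m hmM a ha (by
    intro n
    have hev : ∀ᶠ j in atTop, ∀ k, scrMK p q σ (m k) (ηs (φ j)) ≤ a k + ((n : ℝ≥0∞) + 1)⁻¹ := by
      rw [eventually_all]
      intro k
      have h1 := (tendsto_pi_nhds.1 hφt) k
      have h2 : a k < a k + ((n : ℝ≥0∞) + 1)⁻¹ :=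
        ENNReal.lt_add_right (ha k) (by simp)
      exact (h1.eventually_lt_const h2).mono fun j hj => hj.le
    obtain ⟨j, hj⟩ := hev.exists
    exact ⟨ηs (φ j), (hηs (φ j)).1, hj⟩)
  refine ⟨η, ⟨hη, ?_⟩, fun η' hη' => ?_⟩
  · refine ne_top_of_le_ne_top (ENNReal.add_ne_top.2
      ⟨(hm k0).2, ne_top_of_le_ne_top (ha k0) (hle k0)⟩)
      (scrMK_le_add hp hq1 σ _ _ _ _ _ _ fun ω => ?_)
    simp only [Kernel.const_apply]
    exact MK_triangle₁ hp y0 _ _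
  · calc G η ≤ H a := by
          refine Finset.sum_le_sum fun k _ => ?_
          gcongr
          exact hle k
      _ = sInf T := hHa
      _ ≤ G η' := sInf_le ⟨η', hη', rfl⟩
end
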